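/- Every 2-random Turing degree satisfies the join property: if a is 2-random then for every non-zero degree b < a there exists c < a such that b ∨ c = a. -/

import Mathlib

/-
Common framework: oracle (relative) partial computability via codes,
Turing reducibility, the jump, Cantor-space measure, Martin-Löf randomness
and genericity relative to an oracle, Turing functionals.
-/

open scoped ENNReal

namespace TypicalDegree

/-- Codes for partial functions recursive in an oracle (Kleene-style),
    following `Nat.Partrec.Code` with an extra `oracle` constructor. -/
inductive OracleCode : Type
  | zero : OracleCode
  | succ : OracleCode
  | left : OracleCode
  | right : OracleCode
  | oracle : OracleCode
  | pair : OracleCode → OracleCode → OracleCode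
  | comp : OracleCode → OracleCode → OracleCode
  | prec : OracleCode → OracleCode → OracleCode
  | rfind' : OracleCode → OracleCode

/-- Evaluation of an oracle code relative to an oracle `g : ℕ →. ℕ`. -/
def OracleCode.eval (g : ℕ →. ℕ) : OracleCode → ℕ →. ℕ
  | .zero => pure 0
  | .succ => Nat.succ
  | .left => ↑fun n : ℕ => n.unpair.1
  | .right => ↑fun n : ℕ => n.unpair.2
  | .oracle => g
  | .pair cf cg => fun n => Nat.pair <$> OracleCode.eval g cf n <*> OracleCode.eval g cg n
  | .comp cf cg => fun n => OracleCode.eval g cg n >>= OracleCode.eval g cf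
  | .prec cf cg =>
    Nat.unpaired fun a n =>
      n.rec (OracleCode.eval g cf a) fun y IH => do
        let i ← IH
        OracleCode.eval g cg (Nat.pair a (Nat.pair y i))
  | .rfind' cf =>
    Nat.unpaired fun a m =>
      (Nat.rfind fun n => (fun m => m = 0) <$> OracleCode.eval g cf (Nat.pair a (n + m))).map
        (· + m)

/-- An effective injective numbering of oracle codes. -/
def OracleCode.encodeCode : OracleCode → ℕ
  | .zero => 0
  | .succ => 1
  | .left => 2
  | .right => 3
  | .oracle => 4
  | .pair cf cg => 4 * Nat.pair cf.encodeCode cg.encodeCode + 5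
  | .comp cf cg => 4 * Nat.pair cf.encodeCode cg.encodeCode + 6
  | .prec cf cg => 4 * Nat.pair cf.encodeCode cg.encodeCode + 7
  | .rfind' cf => 4 * Nat.pair cf.encodeCode cf.encodeCode + 8

/-- The characteristic (total) oracle of an element of Cantor space. -/
def chi (X : ℕ → Bool) : ℕ →. ℕ := fun n => Part.some (cond (X n) 1 0)

/-- `f` is partial recursive relative to the oracle `g`. -/
def RedIn (f g : ℕ →. ℕ) : Prop := ∃ c : OracleCode, c.eval g = f

/-- A total function `ℕ → ℕ` viewed as a partial function. -/
def natFun (f : ℕ → ℕ) : ℕ →. ℕ := fun n => Part.some (f n)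

/-- Turing reducibility between elements of Cantor space. -/
def TRed (X Y : ℕ → Bool) : Prop := RedIn (chi X) (chi Y)

/-- Turing equivalence. -/
def TEquiv (X Y : ℕ → Bool) : Prop := TRed X Y ∧ TRed Y X

/-- `X` is computable. -/
def ComputableSeq (X : ℕ → Bool) : Prop := TRed X fun _ => false

/-- `f : ℕ → ℕ` is computable. -/
def ComputableFun (f : ℕ → ℕ) : Prop := RedIn (natFun f) (chi fun _ => false)

/-- The Turing jump of `X`: the halting problem relative to `X`,
    under the numbering `encodeCode`. -/
noncomputable def jump (X : ℕ → Bool) : ℕ → Bool := fun n =>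
  @decide (∃ c : OracleCode, c.encodeCode = n ∧ (c.eval (chi X) n).Dom) (Classical.dec _)

/-- `∅'`, the halting problem. -/
noncomputable def zeroJump : ℕ → Bool := jump fun _ => false

/-- `X` extends the finite binary string `σ` (i.e. `σ ⊂ X`). -/
def extendsStr (X : ℕ → Bool) (σ : List Bool) : Prop :=
  ∀ i : Fin σ.length, X i.1 = σ.get i

/-- `⟦V⟧`: the open set of infinite sequences extending some string in `V`. -/
def openOf (V : Set (List Bool)) : Set (ℕ → Bool) := {X | ∃ σ ∈ V, extendsStr X σ}

/-- The (fair-coin) measure of the open set `⟦V⟧` determined by a set of strings `V`: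
    the supremum over `n` of the proportion of length-`n` strings with a prefix in `V`. -/
noncomputable def stringMeasure (V : Set (List Bool)) : ℝ≥0∞ :=
  ⨆ n : ℕ, (Nat.card {f : Fin n → Bool // ∃ σ ∈ V, σ <+: List.ofFn f} : ℝ≥0∞) / 2 ^ n

/-- The fair-coin (Lebesgue) measure on Cantor space, as the outer measure obtained from
    open coverings by sets of strings; it agrees with Lebesgue measure on measurable sets. -/
noncomputable def cantorMeasure (S : Set (ℕ → Bool)) : ℝ≥0∞ :=
  ⨅ (V : Set (List Bool)) (_ : S ⊆ openOf V), stringMeasure V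

/-- `W` is computably enumerable relative to `X`. -/
def CEIn (X : ℕ → Bool) (W : Set (List Bool)) : Prop :=
  ∃ c : OracleCode, ∀ σ : List Bool, σ ∈ W ↔ (c.eval (chi X) (Encodable.encode σ)).Dom

/-- `W` is computably enumerable. -/
def CE (W : Set (List Bool)) : Prop := CEIn (fun _ => false) W

/-- The c.e. set of strings with index `d`. -/
def ceSetOf (d : OracleCode) : Set (List Bool) :=
  {σ | (d.eval (chi fun _ => false) (Encodable.encode σ)).Dom}

/-- The sequence `V` of sets of strings is uniformly c.e. relative to `X`. -/
def UniformCEIn (X : ℕ → Bool) (V : ℕ → Set (List Bool)) : Prop :=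
  ∃ c : OracleCode, ∀ (i : ℕ) (σ : List Bool),
    σ ∈ V i ↔ (c.eval (chi X) (Nat.pair i (Encodable.encode σ))).Dom

/-- A Martin-Löf test relative to `X`. -/
def MLTest (X : ℕ → Bool) (V : ℕ → Set (List Bool)) : Prop :=
  UniformCEIn X V ∧ ∀ i : ℕ, stringMeasure (V i) < (2 : ℝ≥0∞)⁻¹ ^ i

/-- `Y` is Martin-Löf random relative to `X`. -/
def MLRandomIn (X Y : ℕ → Bool) : Prop :=
  ∀ V : ℕ → Set (List Bool), MLTest X V → ∃ i, Y ∉ openOf (V i)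

/-- `Y` is 1-random. -/
def OneRandom (Y : ℕ → Bool) : Prop := MLRandomIn (fun _ => false) Y

/-- `Y` is 2-random: Martin-Löf random relative to `∅'`. -/
def TwoRandom (Y : ℕ → Bool) : Prop := MLRandomIn zeroJump Y

/-- `Y` is weakly 2-random: it avoids every null `Π⁰₂` class
    (every null intersection of a uniformly c.e. sequence of open sets). -/
def Weak2Random (Y : ℕ → Bool) : Prop :=
  ∀ V : ℕ → Set (List Bool), UniformCEIn (fun _ => false) V →
    cantorMeasure (⋂ i, openOf (V i)) = 0 → Y ∉ ⋂ i, openOf (V i)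

/-- `Y` is 1-generic relative to `X`. -/
def OneGenericIn (X Y : ℕ → Bool) : Prop :=
  ∀ W : Set (List Bool), CEIn X W →
    ∃ σ : List Bool, extendsStr Y σ ∧ (σ ∈ W ∨ ∀ τ : List Bool, σ <+: τ → τ ∉ W)

/-- `Y` is 1-generic. -/
def OneGeneric (Y : ℕ → Bool) : Prop := OneGenericIn (fun _ => false) Y

/-- `Y` is 2-generic: 1-generic relative to `∅'`. -/
def TwoGeneric (Y : ℕ → Bool) : Prop := OneGenericIn zeroJump Y

/-- The Turing functional coded by `c` is total on oracle `X` with value `Y ∈ 2^ω`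
    (i.e. `Ψ^X = Y`). -/
def FTotal (c : OracleCode) (X : ℕ → Bool) (Y : ℕ → Bool) : Prop :=
  c.eval (chi X) = chi Y

/-- `Ψ^X ⊇ σ`: the output of the functional `c` on oracle `X` extends the string `σ`. -/
def FExtends (c : OracleCode) (X : ℕ → Bool) (σ : List Bool) : Prop :=
  ∀ i : Fin σ.length, c.eval (chi X) i.1 = Part.some (cond (σ.get i) 1 0)

/-- `π(Ψ,σ) = μ({X : Ψ^X ⊇ σ})`. -/
noncomputable def piMeasure (c : OracleCode) (σ : List Bool) : ℝ≥0∞ :=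
  cantorMeasure {X | FExtends c X σ}

/-- A Turing functional is special if every infinite binary sequence
    in its range is incomputable. -/
def Special (c : OracleCode) : Prop :=
  ∀ X Y : ℕ → Bool, FTotal c X Y → ¬ ComputableSeq Y

/-- The code `c` computes the total function `T` on strings (no oracle). -/
def ComputesFun (c : OracleCode) (T : List Bool → Bool) : Prop :=
  ∀ σ : List Bool, c.eval (chi fun _ => false) (Encodable.encode σ) = Part.some (cond (T σ) 1 0)

/-- `T` is (the characteristic function of) a tree: closed under prefixes. -/
def IsTree (T : List Bool → Bool) : Prop :=
  ∀ σ τ : List Bool, σ <+: τ → T τ = true → T σ = true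

/-- The set of infinite paths through the tree `T`; `Π⁰₁` classes are the
    sets of paths through computable trees. -/
def pathsOf (T : List Bool → Bool) : Set (ℕ → Bool) :=
  {X | ∀ n : ℕ, T (List.ofFn fun i : Fin n => X i.1) = true}

/-- The computable join `X ⊕ Y`. -/
def join (X Y : ℕ → Bool) : ℕ → Bool := fun n =>
  if n % 2 = 0 then X (n / 2) else Y (n / 2)

/-- A finite string used as a (partial) oracle. -/
def strOracle (τ : List Bool) : ℕ →. ℕ := fun n =>
  if h : n < τ.length then Part.some (cond (τ.get ⟨n, h⟩) 1 0) else Part.none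

/-- `Ψ^{τ₀}` and `Ψ^{τ₁}` are incompatible: they give different outputs somewhere. -/
def SplitPair (c : OracleCode) (τ₀ τ₁ : List Bool) : Prop :=
  ∃ (n v₀ v₁ : ℕ), v₀ ∈ c.eval (strOracle τ₀) n ∧ v₁ ∈ c.eval (strOracle τ₁) n ∧ v₀ ≠ v₁

/-- `(U,V)` is a `Ψ`-splitting above `τ`. -/
def SplittingAbove (c : OracleCode) (τ : List Bool) (U V : Finset (List Bool)) : Prop :=
  (∃ ℓ : ℕ, ∀ σ ∈ U ∪ V, σ.length = ℓ ∧ τ <+: σ) ∧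
    ∀ σ₀ ∈ U, ∀ σ₁ ∈ V, SplitPair c σ₀ σ₁

/-- The output sequence `Ψ^X` of the functional `c` on oracle `X`
    (defaults to `false` when not total). -/
noncomputable def outSeq (c : OracleCode) (X : ℕ → Bool) : ℕ → Bool := fun n =>
  @dite _ (∃ Y : ℕ → Bool, FTotal c X Y) (Classical.dec _) (fun h => h.choose n) fun _ => false

/-- `Ψ^X ↾ n`, as a finite string. -/
noncomputable def outStr (c : OracleCode) (X : ℕ → Bool) (n : ℕ) : List Bool :=
  List.ofFn fun i : Fin n => outSeq c X i.1

/-- The degree of `M` is a minimal Turing degree. -/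
def MinimalDeg (M : ℕ → Bool) : Prop :=
  ¬ ComputableSeq M ∧ ∀ Z : ℕ → Bool, TRed Z M → ComputableSeq Z ∨ TRed M Z


section Part1
/-! ### Oracle infrastructure -/

theorem mem_eval_pair {g : ℕ →. ℕ} {c d : OracleCode} {n v : ℕ} :
    v ∈ (OracleCode.pair c d).eval g n ↔ ∃ a ∈ c.eval g n, ∃ b ∈ d.eval g n, v = Nat.pair a b := by
  simp only [OracleCode.eval, Seq.seq]
  constructor
  · intro h
    obtain ⟨f, hf, h⟩ := Part.mem_bind_iff.1 h
    obtain ⟨a, ha, rfl⟩ := (Part.mem_map_iff _).1 hf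
    obtain ⟨b, hb, rfl⟩ := (Part.mem_map_iff _).1 h
    exact ⟨a, ha, b, hb, rfl⟩
  · rintro ⟨a, ha, b, hb, rfl⟩
    exact Part.mem_bind (Part.mem_map _ ha) (Part.mem_map _ hb)

theorem mem_eval_comp {g : ℕ →. ℕ} {c d : OracleCode} {n v : ℕ} :
    v ∈ (OracleCode.comp c d).eval g n ↔ ∃ a ∈ d.eval g n, v ∈ c.eval g a :=
  Part.mem_bind_iff

theorem mem_eval_prec_zero {g : ℕ →. ℕ} {c d : OracleCode} {a v : ℕ} :
    v ∈ (OracleCode.prec c d).eval g (Nat.pair a 0) ↔ v ∈ c.eval g a := by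
  simp [OracleCode.eval]

theorem mem_eval_prec_succ {g : ℕ →. ℕ} {c d : OracleCode} {a m v : ℕ} :
    v ∈ (OracleCode.prec c d).eval g (Nat.pair a (m+1)) ↔
      ∃ w ∈ (OracleCode.prec c d).eval g (Nat.pair a m),
        v ∈ d.eval g (Nat.pair a (Nat.pair m w)) := by
  simp [OracleCode.eval]

theorem mem_eval_rfind {g : ℕ →. ℕ} {c : OracleCode} {a m v : ℕ} :
    v ∈ (OracleCode.rfind' c).eval g (Nat.pair a m) ↔
      ∃ k, v = k + m ∧ 0 ∈ c.eval g (Nat.pair a (k + m)) ∧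
        ∀ j < k, ∃ w ∈ c.eval g (Nat.pair a (j + m)), w ≠ 0 := by
  simp only [OracleCode.eval, Nat.unpaired, Nat.unpair_pair]
  constructor
  · intro h
    obtain ⟨k, hk, rfl⟩ := (Part.mem_map_iff _).1 h
    obtain ⟨h1, h2⟩ := Nat.mem_rfind.1 hk
    refine ⟨k, rfl, ?_, ?_⟩
    · obtain ⟨w, hw, hw'⟩ := (Part.mem_map_iff _).1 h1
      have : w = 0 := by simpa using hw'
      exact this ▸ hw
    · intro j hj
      obtain ⟨w, hw, hw'⟩ := (Part.mem_map_iff _).1 (h2 hj)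
      exact ⟨w, hw, by simpa using hw'⟩
  · rintro ⟨k, rfl, h1, h2⟩
    refine Part.mem_map _ (Nat.mem_rfind.2 ⟨?_, ?_⟩)
    · exact (Part.mem_map_iff _).2 ⟨0, h1, by simp⟩
    · intro j hj
      obtain ⟨w, hw, hw'⟩ := h2 j hj
      exact (Part.mem_map_iff _).2 ⟨w, hw, by simpa using hw'⟩

theorem redIn_comp {f h g : ℕ →. ℕ} (hf : RedIn f g) (hh : RedIn h g) :
    RedIn (fun n => h n >>= f) g := by
  obtain ⟨c, rfl⟩ := hf
  obtain ⟨d, rfl⟩ := hh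
  exact ⟨.comp c d, rfl⟩

theorem redIn_pair {f h g : ℕ →. ℕ} (hf : RedIn f g) (hh : RedIn h g) :
    RedIn (fun n => Nat.pair <$> f n <*> h n) g := by
  obtain ⟨c, rfl⟩ := hf
  obtain ⟨d, rfl⟩ := hh
  exact ⟨.pair c d, rfl⟩

theorem redIn_oracle (g : ℕ →. ℕ) : RedIn g g := ⟨.oracle, rfl⟩

theorem redIn_of_partrec {f : ℕ →. ℕ} (hf : Nat.Partrec f) (g : ℕ →. ℕ) : RedIn f g := by
  induction hf with
  | zero => exact ⟨.zero, rfl⟩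
  | succ => exact ⟨.succ, rfl⟩
  | left => exact ⟨.left, rfl⟩
  | right => exact ⟨.right, rfl⟩
  | pair _ _ h1 h2 => exact redIn_pair h1 h2
  | comp _ _ h1 h2 => exact redIn_comp h1 h2
  | prec _ _ h1 h2 =>
    obtain ⟨c, rfl⟩ := h1
    obtain ⟨d, rfl⟩ := h2
    exact ⟨.prec c d, rfl⟩
  | rfind _ h1 =>
    obtain ⟨c, rfl⟩ := h1
    refine ⟨.comp (.rfind' c) (.pair (.pair .left .right) .zero), ?_⟩
    funext n
    simp [OracleCode.eval, Seq.seq, pure, PFun.pure, Part.map_id']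

/-- total functions -/
theorem redIn_compT {f h : ℕ → ℕ} {g : ℕ →. ℕ} (hf : RedIn (natFun f) g) (hh : RedIn (natFun h) g) :
    RedIn (natFun fun n => f (h n)) g := by
  have := redIn_comp hf hh
  refine (congrArg (fun q => RedIn q g) ?_).mpr this
  funext n
  exact (Part.bind_some (h n) (natFun f)).symm

theorem redIn_pairT {f h : ℕ → ℕ} {g : ℕ →. ℕ} (hf : RedIn (natFun f) g) (hh : RedIn (natFun h) g) :
    RedIn (natFun fun n => Nat.pair (f n) (h n)) g := by
  have := redIn_pair hf hh
  refine (congrArg (fun q => RedIn q g) ?_).mpr this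
  funext n
  simp [natFun, Seq.seq]

theorem redIn_of_primrec {f : ℕ → ℕ} (hf : Primrec f) (g : ℕ →. ℕ) : RedIn (natFun f) g :=
  redIn_of_partrec (Partrec.nat_iff.1 hf.to_comp) g

theorem redIn_precT {z : ℕ} {s : ℕ → ℕ} {g : ℕ →. ℕ} (hs : RedIn (natFun s) g) :
    RedIn (natFun fun n => Nat.rec z (fun y ih => s (Nat.pair y ih)) n) g := by
  have hz : RedIn (natFun fun _ => z) g := redIn_of_primrec (Primrec.const z) g
  have hs' : RedIn (natFun fun n => s n.unpair.2) g :=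
    redIn_compT hs (redIn_of_primrec (Primrec.snd.comp Primrec.unpair) g)
  obtain ⟨c, hc⟩ := hz
  obtain ⟨d, hd⟩ := hs'
  have h3 : RedIn ((OracleCode.prec c d).eval g) g := ⟨_, rfl⟩
  have h4 : RedIn (natFun fun n => Nat.pair 0 n) g :=
    redIn_of_primrec (Primrec₂.natPair.comp (Primrec.const 0) Primrec.id) g
  have h5 := redIn_comp h3 h4
  have e : (natFun fun n => Nat.rec z (fun y ih => s (Nat.pair y ih)) n)
      = (fun n => (natFun fun n => Nat.pair 0 n) n >>= (OracleCode.prec c d).eval g) := by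
    funext n
    simp only [natFun, OracleCode.eval, hc, hd, Part.bind_eq_bind, Part.bind_some, Nat.unpaired,
      Nat.unpair_pair]
    induction n with
    | zero => simp
    | succ n ih => 
      simp only [← ih]
      simp
  rw [e]
  exact h5

/-- initial segment of a sequence -/
def restr (X : ℕ → Bool) (m : ℕ) : List Bool := (List.range m).map X

@[simp] theorem restr_length (X : ℕ → Bool) (m : ℕ) : (restr X m).length = m := by simp [restr]

theorem restr_succ (X : ℕ → Bool) (m : ℕ) : restr X (m+1) = restr X m ++ [X m] := by
  simp [restr, List.range_succ]

theorem restr_zero (X : ℕ → Bool) : restr X 0 = [] := by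
  simp [restr]

theorem restr_getElem? (X : ℕ → Bool) (m i : ℕ) :
    (restr X m)[i]? = if i < m then some (X i) else none := by
  by_cases h : i < m
  · simp [restr, h]
  · simp [restr, h]

theorem restr_take (X : ℕ → Bool) {m l : ℕ} (h : l ≤ m) : (restr X m).take l = restr X l := by
  apply List.ext_getElem? 
  intro i
  rw [List.getElem?_take, restr_getElem?, restr_getElem?]
  split_ifs <;> first | rfl | omega

theorem restr_pref (X : ℕ → Bool) {m l : ℕ} (h : l ≤ m) : restr X l <+: restr X m := by
  rw [← restr_take X h]; exact List.take_prefix _ _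

theorem extendsStr_iff (X : ℕ → Bool) (σ : List Bool) :
    extendsStr X σ ↔ σ = restr X σ.length := by
  constructor
  · intro h
    apply List.ext_getElem?
    intro i
    rw [restr_getElem?]
    split_ifs with hi
    · rw [List.getElem?_eq_getElem hi]
      have := h ⟨i, hi⟩
      simp at this
      rw [this]
    · simp; omega
  · intro h i
    have h1 := restr_getElem? X σ.length i
    rw [← h] at h1
    simp at h1
    simp [h1]

theorem redIn_restr (Y : ℕ → Bool) :
    RedIn (natFun fun n => Encodable.encode (restr Y n)) (chi Y) := by
  have hT : Primrec fun p : ℕ => Encodable.encode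
      (((Encodable.decode p.unpair.1 : Option (List Bool)).getD []) ++ [p.unpair.2 == 1]) := by
    refine Primrec.encode.comp (Primrec.list_concat.comp
      (Primrec.option_getD.comp (Primrec.decode.comp (Primrec.fst.comp Primrec.unpair))
        (Primrec.const [])) ?_)
    exact Primrec.beq.comp (Primrec.snd.comp Primrec.unpair) (Primrec.const 1)
  have hO : RedIn (natFun fun n => cond (Y n) 1 0) (chi Y) := redIn_oracle _
  have h1 : RedIn (natFun fun p => Nat.pair p.unpair.2 (cond (Y p.unpair.1) 1 0)) (chi Y) :=
    redIn_pairT (redIn_of_primrec (Primrec.snd.comp Primrec.unpair) _)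
      (redIn_compT hO (redIn_of_primrec (Primrec.fst.comp Primrec.unpair) _))
  have h2 := redIn_precT (z := Encodable.encode ([] : List Bool))
    (redIn_compT (redIn_of_primrec hT (chi Y)) h1)
  convert h2 using 2
  funext n
  induction n with
  | zero => simp [restr_zero]
  | succ n ih =>
    simp only [← ih, restr_succ]
    simp
    cases Y n <;> rfl

theorem tred_of_approx (F : List Bool → ℕ → Option Bool) (hF : Primrec₂ F) (Y Z : ℕ → Bool)
    (h1 : ∀ n, ∃ m, F (restr Y m) n = some (Z n))
    (h2 : ∀ n m v, F (restr Y m) n = some v → v = Z n) : TRed Z Y := by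
  -- argument pairs `(n, code of string)`
  have hdec : Primrec fun p : ℕ => F ((Encodable.decode p.unpair.2 : Option (List Bool)).getD [])
      p.unpair.1 :=
    hF.comp (Primrec.option_getD.comp (Primrec.decode.comp (Primrec.snd.comp Primrec.unpair))
        (Primrec.const [])) (Primrec.fst.comp Primrec.unpair)
  have hP : Primrec fun p : ℕ => cond (F ((Encodable.decode p.unpair.2 :
      Option (List Bool)).getD []) p.unpair.1).isSome 0 1 :=
    Primrec.cond (Primrec.option_isSome.comp hdec) (Primrec.const 0) (Primrec.const 1)
  have hQ : Primrec fun p : ℕ => cond ((F ((Encodable.decode p.unpair.2 :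
      Option (List Bool)).getD []) p.unpair.1).getD false) 1 0 :=
    Primrec.cond (Primrec.option_getD.comp hdec (Primrec.const false))
      (Primrec.const 1) (Primrec.const 0)
  have hR : RedIn (natFun fun p => Nat.pair p.unpair.1 (Encodable.encode (restr Y p.unpair.2)))
      (chi Y) :=
    redIn_pairT (redIn_of_primrec (Primrec.fst.comp Primrec.unpair) _)
      (redIn_compT (redIn_restr Y) (redIn_of_primrec (Primrec.snd.comp Primrec.unpair) _))
  have hP' := redIn_compT (redIn_of_primrec hP (chi Y)) hR
  have hQ' := redIn_compT (redIn_of_primrec hQ (chi Y)) hR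
  obtain ⟨c, hc⟩ := hP'
  obtain ⟨d, hd⟩ := hQ'
  have hid : RedIn (natFun fun n => n) (chi Y) := redIn_of_primrec Primrec.id _
  obtain ⟨i, hi⟩ := hid
  obtain ⟨i0, hi0⟩ : RedIn (natFun fun n => Nat.pair n 0) (chi Y) :=
    redIn_of_primrec (Primrec₂.natPair.comp Primrec.id (Primrec.const 0)) _
  refine ⟨.comp d (.pair i (.comp (.rfind' c) i0)), ?_⟩
  funext n
  classical
  have hex : ∃ m, (F (restr Y m) n).isSome = true := by
    obtain ⟨m, hm⟩ := h1 n
    exact ⟨m, by simp [hm]⟩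
  have hv := Nat.find_spec hex
  obtain ⟨v, hv⟩ := Option.isSome_iff_exists.1 hv
  refine Part.eq_some_iff.2 ?_
  rw [mem_eval_comp]
  refine ⟨Nat.pair n (Nat.find hex), ?_, ?_⟩
  · rw [mem_eval_pair]
    refine ⟨n, by rw [hi]; exact Part.mem_some _, Nat.find hex, ?_, rfl⟩
    rw [mem_eval_comp]
    refine ⟨Nat.pair n 0, by rw [hi0]; exact Part.mem_some _, ?_⟩
    rw [mem_eval_rfind]
    refine ⟨Nat.find hex, rfl, ?_, ?_⟩
    · rw [hc]
      simp [natFun, hv]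
    · intro j hj
      have := Nat.find_min hex hj
      rw [hc]
      simp only [Bool.not_eq_true] at this
      simp [natFun, this]
  · rw [hd]
    have := h2 _ _ _ hv
    simp [natFun, hv, this]

end Part1

section Part2
/-! ### Use principle -/

theorem eval_mono {g g' : ℕ →. ℕ} (h : ∀ n v, v ∈ g n → v ∈ g' n) (c : OracleCode) :
    ∀ n v, v ∈ c.eval g n → v ∈ c.eval g' n := by
  induction c with
  | zero => exact fun n v h => h
  | succ => exact fun n v h => h
  | left => exact fun n v h => h
  | right => exact fun n v h => h
  | oracle => exact h
  | pair c d hc hd =>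
    intro n v hv
    rw [mem_eval_pair] at hv ⊢
    obtain ⟨a, ha, b, hb, rfl⟩ := hv
    exact ⟨a, hc _ _ ha, b, hd _ _ hb, rfl⟩
  | comp c d hc hd =>
    intro n v hv
    rw [mem_eval_comp] at hv ⊢
    obtain ⟨a, ha, hb⟩ := hv
    exact ⟨a, hd _ _ ha, hc _ _ hb⟩
  | prec c d hc hd =>
    intro n v hv
    rw [← Nat.pair_unpair n] at hv ⊢
    generalize (Nat.unpair n).1 = a at *
    generalize (Nat.unpair n).2 = m at *
    induction m generalizing v with
    | zero => rw [mem_eval_prec_zero] at hv ⊢; exact hc _ _ hv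
    | succ m ih =>
      rw [mem_eval_prec_succ] at hv ⊢
      obtain ⟨w, hw, hv⟩ := hv
      exact ⟨w, ih _ hw, hd _ _ hv⟩
  | rfind' c hc =>
    intro n v hv
    rw [← Nat.pair_unpair n] at hv ⊢
    rw [mem_eval_rfind] at hv ⊢
    obtain ⟨k, hk, h0, hj⟩ := hv
    refine ⟨k, hk, hc _ _ h0, fun j hjk => ?_⟩
    obtain ⟨w, hw, hw'⟩ := hj j hjk
    exact ⟨w, hc _ _ hw, hw'⟩

theorem mem_strOracle {τ : List Bool} {n v : ℕ} :
    v ∈ strOracle τ n ↔ ∃ b, τ[n]? = some b ∧ v = cond b 1 0 := by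
  unfold strOracle
  split_ifs with h
  · simp [List.getElem?_eq_getElem h]
  · simp [List.getElem?_eq_none (not_lt.1 h)]

theorem prefix_getElem? {α : Type*} {σ τ : List α} (h : σ <+: τ) {n : ℕ} {b : α} 
    (hb : σ[n]? = some b) : τ[n]? = some b := by
  obtain ⟨r, rfl⟩ := h
  have : n < σ.length := by
    by_contra h
    rw [List.getElem?_eq_none (not_lt.1 h)] at hb
    simp at hb
  rw [List.getElem?_append_left this]; exact hb

theorem strOracle_mono {σ τ : List Bool} (h : σ <+: τ) (n v : ℕ) (hv : v ∈ strOracle σ n) :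
    v ∈ strOracle τ n := by
  rw [mem_strOracle] at hv ⊢
  obtain ⟨b, hb, rfl⟩ := hv
  exact ⟨b, prefix_getElem? h hb, rfl⟩

theorem strOracle_restr (X : ℕ → Bool) (m n v : ℕ) (hv : v ∈ strOracle (restr X m) n) :
    v ∈ chi X n := by
  rw [mem_strOracle] at hv
  obtain ⟨b, hb, rfl⟩ := hv
  rw [restr_getElem?] at hb
  split_ifs at hb
  simp at hb
  simp [chi, hb]

theorem eval_use (X : ℕ → Bool) (c : OracleCode) :
    ∀ n v, v ∈ c.eval (chi X) n → ∃ m, v ∈ c.eval (strOracle (restr X m)) n := by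
  have up : ∀ (c : OracleCode) {m m' : ℕ}, m ≤ m' → ∀ n v, v ∈ c.eval (strOracle (restr X m)) n → 
     v ∈ c.eval (strOracle (restr X m')) n := fun c m m' h => 
      eval_mono (strOracle_mono (restr_pref X h)) c
  induction c with
  | zero => exact fun n v h => ⟨0, h⟩
  | succ => exact fun n v h => ⟨0, h⟩
  | left => exact fun n v h => ⟨0, h⟩
  | right => exact fun n v h => ⟨0, h⟩
  | oracle =>
    intro n v h
    refine ⟨n+1, mem_strOracle.2 ⟨X n, by rw [restr_getElem?]; simp, ?_⟩⟩
    exact Part.mem_some_iff.1 h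
  | pair c d hc hd =>
    intro n v hv
    rw [mem_eval_pair] at hv
    obtain ⟨a, ha, b, hb, rfl⟩ := hv
    obtain ⟨m1, h1⟩ := hc _ _ ha
    obtain ⟨m2, h2⟩ := hd _ _ hb
    refine ⟨max m1 m2, mem_eval_pair.2 ⟨a, up _ (le_max_left _ _) _ _ h1, b,
      up _ (le_max_right _ _) _ _ h2, rfl⟩⟩
  | comp c d hc hd =>
    intro n v hv
    rw [mem_eval_comp] at hv
    obtain ⟨a, ha, hb⟩ := hv
    obtain ⟨m1, h1⟩ := hd _ _ ha
    obtain ⟨m2, h2⟩ := hc _ _ hb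
    refine ⟨max m1 m2, mem_eval_comp.2 ⟨a, up _ (le_max_left _ _) _ _ h1,
      up _ (le_max_right _ _) _ _ h2⟩⟩
  | prec c d hc hd =>
    intro n v hv
    rw [← Nat.pair_unpair n] at hv ⊢
    generalize (Nat.unpair n).1 = a at *
    generalize (Nat.unpair n).2 = m at *
    induction m generalizing v with
    | zero =>
      rw [mem_eval_prec_zero] at hv
      obtain ⟨m1, h1⟩ := hc _ _ hv
      exact ⟨m1, mem_eval_prec_zero.2 h1⟩
    | succ m ih =>
      rw [mem_eval_prec_succ] at hv
      obtain ⟨w, hw, hv⟩ := hv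
      obtain ⟨m1, h1⟩ := ih _ hw
      obtain ⟨m2, h2⟩ := hd _ _ hv
      exact ⟨max m1 m2, mem_eval_prec_succ.2 ⟨w, up _ (le_max_left _ _) _ _ h1,
        up _ (le_max_right _ _) _ _ h2⟩⟩
  | rfind' c hc =>
    intro n v hv
    rw [← Nat.pair_unpair n] at hv ⊢
    rw [mem_eval_rfind] at hv
    obtain ⟨k, hk, h0, hj⟩ := hv
    obtain ⟨m1, h1⟩ := hc _ _ h0
    have : ∀ k' ≤ k, ∃ m2, ∀ j < k', ∃ w ∈ c.eval (strOracle (restr X m2))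
        (Nat.pair (Nat.unpair n).1 (j + (Nat.unpair n).2)), w ≠ 0 := by
      intro k'
      induction k' with
      | zero => exact fun _ => ⟨0, fun j hj => absurd hj (Nat.not_lt_zero _)⟩
      | succ k' ih =>
        intro hk'
        obtain ⟨m2, h2⟩ := ih (by omega)
        obtain ⟨w, hw, hw'⟩ := hj k' (by omega)
        obtain ⟨m3, h3⟩ := hc _ _ hw
        refine ⟨max m2 m3, fun j hj => ?_⟩
        rcases Nat.lt_succ_iff_lt_or_eq.1 hj with h | rfl
        · obtain ⟨w, hw, hw'⟩ := h2 j h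
          exact ⟨w, up _ (le_max_left _ _) _ _ hw, hw'⟩
        · exact ⟨w, up _ (le_max_right _ _) _ _ h3, hw'⟩
    obtain ⟨m2, h2⟩ := this k le_rfl
    refine ⟨max m1 m2, mem_eval_rfind.2 ⟨k, hk, up _ (le_max_left _ _) _ _ h1, fun j hj => ?_⟩⟩
    obtain ⟨w, hw, hw'⟩ := h2 j hj
    exact ⟨w, up _ (le_max_right _ _) _ _ hw, hw'⟩

theorem partrec_strOracle : Partrec₂ fun (σ : List Bool) (n : ℕ) => strOracle σ n := by
  have : Partrec fun p : List Bool × ℕ => ((p.1[p.2]?).map (fun b : Bool => cond b 1 0) : Part ℕ) := by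
    refine Computable.ofOption ?_
    refine (Primrec.option_map Primrec.list_getElem? ?_).to_comp
    exact Primrec.cond Primrec.snd (Primrec.const 1) (Primrec.const 0)
  refine this.of_eq fun p => ?_
  ext v
  rw [mem_strOracle]
  simp only [Part.mem_coe, Option.mem_def, Option.map_eq_some_iff]
  exact ⟨fun ⟨a, h, h'⟩ => ⟨a, h, h'.symm⟩, fun ⟨a, h, h'⟩ => ⟨a, h, h'.symm⟩⟩

theorem partrec_eval_str (c : OracleCode) :
    Partrec fun p : List Bool × ℕ => c.eval (strOracle p.1) p.2 := by
  induction c with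
  | zero => exact (Computable.const 0).partrec
  | succ => exact (Computable.succ.comp Computable.snd).partrec
  | left => exact (Computable.fst.comp (Computable.unpair.comp Computable.snd)).partrec
  | right => exact (Computable.snd.comp (Computable.unpair.comp Computable.snd)).partrec
  | oracle => exact partrec_strOracle
  | pair c d hc hd =>
    have h1 : Partrec fun p : List Bool × ℕ => (c.eval (strOracle p.1) p.2).bind fun a =>
        (d.eval (strOracle p.1) p.2).map fun b => Nat.pair a b := by
      refine hc.bind (Partrec.map (hd.comp Computable.fst) ?_)
      exact (Primrec₂.natPair.comp (Primrec.snd.comp Primrec.fst) Primrec.snd).to_comp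
    refine h1.of_eq fun p => ?_
    ext v
    rw [mem_eval_pair]
    simp [eq_comm]
  | comp c d hc hd =>
    exact hd.bind (hc.comp (Computable.pair (Computable.fst.comp Computable.fst) Computable.snd))
  | prec c d hc hd =>
    have h1 : Partrec fun p : List Bool × ℕ => p.2.unpair.2.rec
        (c.eval (strOracle p.1) p.2.unpair.1) (fun y IH => Part.bind IH fun i =>
          d.eval (strOracle p.1) (Nat.pair p.2.unpair.1 (Nat.pair y i))) := by
      refine Partrec.nat_rec (h := fun (p : List Bool × ℕ) (q : ℕ × ℕ) => d.eval (strOracle p.1)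
        (Nat.pair p.2.unpair.1 (Nat.pair q.1 q.2))) (Computable.snd.comp (Computable.unpair.comp Computable.snd))
        (hc.comp (Computable.pair Computable.fst 
          (Computable.fst.comp (Computable.unpair.comp Computable.snd)))) ?_
      have h2 : Primrec fun q : (List Bool × ℕ) × (ℕ × ℕ) =>
          (q.1.1, Nat.pair q.1.2.unpair.1 (Nat.pair q.2.1 q.2.2)) :=
        Primrec.pair (Primrec.fst.comp Primrec.fst)
          (Primrec₂.natPair.comp (Primrec.fst.comp (Primrec.unpair.comp
            (Primrec.snd.comp Primrec.fst))) (Primrec₂.natPair.comp (Primrec.fst.comp Primrec.snd)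
              (Primrec.snd.comp Primrec.snd)))
      exact hd.comp h2.to_comp
    exact h1.of_eq fun p => rfl
  | rfind' c hc =>
    have h1 : Partrec fun p : List Bool × ℕ => (Nat.rfind fun n => (c.eval (strOracle p.1)
        (Nat.pair p.2.unpair.1 (n + p.2.unpair.2))).map (fun m => decide (m = 0))).map
          (fun k => k + p.2.unpair.2) := by
      have h2 : Primrec fun q : (List Bool × ℕ) × ℕ =>
          (q.1.1, Nat.pair q.1.2.unpair.1 (q.2 + q.1.2.unpair.2)) :=
        Primrec.pair (Primrec.fst.comp Primrec.fst)
          (Primrec₂.natPair.comp (Primrec.fst.comp (Primrec.unpair.comp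
            (Primrec.snd.comp Primrec.fst))) (Primrec.nat_add.comp Primrec.snd
                (Primrec.snd.comp (Primrec.unpair.comp (Primrec.snd.comp Primrec.fst)))))
      have h3 := hc.comp h2.to_comp
      have h4 : Primrec fun m : ℕ => decide (m = 0) :=
            (PrimrecRel.comp Primrec.eq Primrec.id (Primrec.const 0)).decide
      have h5 := h3.map (h4.comp Primrec.snd).to_comp.to₂
      have h6 : Primrec fun q : (List Bool × ℕ) × ℕ => q.2 + q.1.2.unpair.2 :=
        (Primrec.nat_add.comp Primrec.snd (Primrec.snd.comp (Primrec.unpair.comp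
            (Primrec.snd.comp Primrec.fst))))
      exact (Partrec.rfind h5.to₂).map h6.to_comp.to₂
    exact h1.of_eq fun p => rfl

/-- bounded search -/
def bsearch {α : Type*} (p : ℕ → Option α) (t : ℕ) : Option α :=
  Nat.rec none (fun k acc => acc.or (p k)) t

theorem bsearch_succ {α : Type*} (p : ℕ → Option α) (t : ℕ) :
    bsearch p (t+1) = (bsearch p t).or (p t) := rfl

theorem bsearch_eq_none {α : Type*} {p : ℕ → Option α} {t : ℕ} :
    bsearch p t = none ↔ ∀ i < t, p i = none := by
  induction t with
  | zero => simp [bsearch]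
  | succ t ih =>
    rw [bsearch_succ]
    rw [Option.or_eq_none_iff, ih]
    constructor
    · rintro ⟨h1, h2⟩ i hi
      rcases Nat.lt_succ_iff_lt_or_eq.1 hi with h | rfl
      · exact h1 i h
      · exact h2
    · exact fun h => ⟨fun i hi => h i (by omega), h t (by omega)⟩

theorem bsearch_eq_some {α : Type*} {p : ℕ → Option α} {t : ℕ} {a : α} :
    bsearch p t = some a ↔ ∃ j < t, p j = some a ∧ ∀ i < j, p i = none := by
  have hn : ∀ t, bsearch p t = none ↔ ∀ i < t, p i = none := fun t => bsearch_eq_none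
  induction t with
  | zero => simp [bsearch]
  | succ t ih =>
    rw [bsearch_succ]
    rcases hb : bsearch p t with _ | b
    · rw [hn] at hb
      simp only [Option.none_or]
      constructor
      · exact fun h => ⟨t, by omega, h, hb⟩
      · rintro ⟨j, hj, h1, h2⟩
        rcases Nat.lt_succ_iff_lt_or_eq.1 hj with h | rfl
        · rw [hb j h] at h1; simp at h1
        · exact h1
    · simp only [Option.some_or]
      rw [← hb]
      refine ih.trans ?_
      constructor
      · rintro ⟨j, hj, h⟩
        exact ⟨j, by omega, h⟩
      · rintro ⟨j, hj, h1, h2⟩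
        refine ⟨j, ?_, h1, h2⟩
        by_contra hlt
        have : j = t := by omega
        subst this
        have := (hn j).2 h2
        rw [this] at hb; simp at hb

theorem bsearch_mono {α : Type*} {p : ℕ → Option α} {t t' : ℕ} (h : t ≤ t') {a : α}
    (ha : bsearch p t = some a) : bsearch p t' = some a := by
  rw [bsearch_eq_some] at *
  obtain ⟨j, hj, h1⟩ := ha
  exact ⟨j, by omega, h1⟩

theorem primrec_bsearch {α β : Type*} [Primcodable α] [Primcodable β] {p : β → ℕ → Option α}
    {t : β → ℕ} (hp : Primrec₂ p) (ht : Primrec t) : Primrec fun b => bsearch (p b) (t b) := by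
  refine (Primrec.nat_rec' (f := t) (g := fun _ => none)
    (h := fun b q => q.2.or (p b q.1)) ht (Primrec.const none) ?_).of_eq fun b => rfl
  refine (Primrec.option_orElse.comp (Primrec.snd.comp Primrec.snd)
    (hp.comp Primrec.fst (Primrec.fst.comp Primrec.snd))).of_eq fun q => ?_
  rcases q with ⟨b, k, _ | a⟩ <;> rfl

theorem use_principle (c : OracleCode) : ∃ F : List Bool → ℕ → Option Bool, Primrec₂ F ∧
    (∀ σ τ n v, σ <+: τ → F σ n = some v → F τ n = some v) ∧
    (∀ X Z, c.eval (chi X) = chi Z → ∀ n, ∃ m, F (restr X m) n = some (Z n)) := by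
  obtain ⟨d, hd⟩ := Nat.Partrec.Code.exists_code.1 (partrec_eval_str c)
  have hd' : ∀ σ n, d.eval (Encodable.encode (σ, n)) = (c.eval (strOracle σ) n) := by
    intro σ n
    rw [hd]
    simp only [Encodable.encodek, Part.coe_some, Part.bind_some]
    exact Part.map_id' (fun _ => rfl) _
  set p : List Bool × ℕ → ℕ → Option ℕ := fun q l =>
    d.evaln q.1.length (Encodable.encode (q.1.take l, q.2)) with hp
  set F0 : List Bool → ℕ → Option ℕ := fun σ n => bsearch (p (σ, n)) (σ.length + 1) with hF0
  have hpp : Primrec₂ p := by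
    have := Nat.Partrec.Code.primrec_evaln
    refine this.comp (Primrec.pair (Primrec.pair (Primrec.list_length.comp
      (Primrec.fst.comp Primrec.fst)) (Primrec.const d)) (Primrec.encode.comp (Primrec.pair
        ?_ (Primrec.snd.comp Primrec.fst))))
    exact Primrec.list_take.comp Primrec.snd (Primrec.fst.comp Primrec.fst)
  have hF0p : Primrec₂ F0 :=
    primrec_bsearch hpp (Primrec.succ.comp (Primrec.list_length.comp Primrec.fst))
  have sound : ∀ σ n v, F0 σ n = some v → v ∈ c.eval (strOracle σ) n := by
    intro σ n v h
    obtain ⟨j, hj, h1, -⟩ := bsearch_eq_some.1 h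
    have := Nat.Partrec.Code.evaln_sound h1
    rw [hd'] at this
    exact eval_mono (strOracle_mono (List.take_prefix _ _)) c _ _ this
  have compl : ∀ σ l n v k, k ≤ σ.length → l ≤ σ.length →
      d.evaln k (Encodable.encode (σ.take l, n)) = some v → F0 σ n = some v := by
    intro σ l n v k hk hl h
    have h1 : p (σ, n) l = some v := Nat.Partrec.Code.evaln_mono hk h
    rcases h2 : F0 σ n with _ | w
    · have := bsearch_eq_none.1 h2 l (by omega)
      rw [this] at h1; simp at h1
    · have h3 := sound _ _ _ h2
      have h4 := Nat.Partrec.Code.evaln_sound h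
      rw [hd'] at h4
      have h5 := eval_mono (strOracle_mono (List.take_prefix l σ)) c _ _ h4
      rw [Part.mem_unique h3 h5]
  refine ⟨fun σ n => (F0 σ n).map (fun v => decide (v ≠ 0)), ?_, ?_, ?_⟩
  · refine Primrec.option_map hF0p ?_
    exact ((PrimrecRel.comp Primrec.eq Primrec.snd (Primrec.const 0)).not).decide
  · intro σ τ n v hpre h
    simp only [Option.map_eq_some_iff] at h ⊢
    obtain ⟨w, hw, rfl⟩ := h
    refine ⟨w, ?_, rfl⟩
    obtain ⟨j, hj, h1, -⟩ := bsearch_eq_some.1 hw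
    have hle := hpre.length_le
    have ht : τ.take j = σ.take j := by
      obtain ⟨r, rfl⟩ := hpre
      rw [List.take_append_of_le_length (by omega)]
    refine compl τ j n w σ.length hle (by omega) ?_
    rw [ht]
    exact h1
  · intro X Z hXZ n
    have h1 : (cond (Z n) 1 0) ∈ c.eval (chi X) n := by rw [hXZ]; exact Part.mem_some _
    obtain ⟨m, hm⟩ := eval_use X c _ _ h1
    rw [← hd'] at hm
    obtain ⟨k, hk⟩ := Nat.Partrec.Code.evaln_complete.1 hm
    refine ⟨max m k, ?_⟩
    have := compl (restr X (max m k)) m n _ k (by simp) (by simp)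
      (by rw [restr_take X (le_max_left _ _)]; exact hk)
    simp only [this]
    cases Z n <;> simp

/-! ### Sigma-2 sets are c.e. in the jump -/

theorem encodeCode_inj : ∀ c d : OracleCode, c.encodeCode = d.encodeCode → c = d := by
  intro c
  induction c with
  | pair a b ha hb =>
    intro d h
    cases d <;> simp only [OracleCode.encodeCode] at h <;> try omega
    rename_i a' b'
    have h3 : Nat.pair a.encodeCode b.encodeCode = Nat.pair a'.encodeCode b'.encodeCode := by omega
    obtain ⟨h1, h2⟩ := Nat.pair_eq_pair.1 h3
    rw [ha _ h1, hb _ h2]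
  | comp a b ha hb =>
    intro d h
    cases d <;> simp only [OracleCode.encodeCode] at h <;> try omega
    rename_i a' b'
    have h3 : Nat.pair a.encodeCode b.encodeCode = Nat.pair a'.encodeCode b'.encodeCode := by omega
    obtain ⟨h1, h2⟩ := Nat.pair_eq_pair.1 h3
    rw [ha _ h1, hb _ h2]
  | prec a b ha hb =>
    intro d h
    cases d <;> simp only [OracleCode.encodeCode] at h <;> try omega
    rename_i a' b'
    have h3 : Nat.pair a.encodeCode b.encodeCode = Nat.pair a'.encodeCode b'.encodeCode := by omega
    obtain ⟨h1, h2⟩ := Nat.pair_eq_pair.1 h3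
    rw [ha _ h1, hb _ h2]
  | rfind' a ha =>
    intro d h
    cases d <;> simp only [OracleCode.encodeCode] at h <;> try omega
    rename_i a'
    have h3 : Nat.pair a.encodeCode a.encodeCode = Nat.pair a'.encodeCode a'.encodeCode := by omega
    obtain ⟨h1, h2⟩ := Nat.pair_eq_pair.1 h3
    rw [ha _ h1]
  | _ => 
    intro d h
    cases d <;> simp only [OracleCode.encodeCode] at h <;> first | rfl | omega

/-- constant codes -/
def constCode : ℕ → OracleCode
  | 0 => .zero
  | n+1 => .comp .succ (constCode n)

theorem constCode_eval (g : ℕ →. ℕ) (n m v : ℕ) : v ∈ (constCode n).eval g m ↔ v = n := by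
  induction n generalizing v with
  | zero => simp [constCode, OracleCode.eval, pure, PFun.pure]
  | succ n ih =>
    rw [constCode, mem_eval_comp]
    simp only [ih]
    simp [OracleCode.eval]

theorem sigma2_ce (R : ℕ → ℕ → Bool) (hR : Primrec₂ R) : ∃ d : OracleCode, ∀ z,
    (d.eval (chi zeroJump) z).Dom ↔ ∃ w, ∀ v, R (Nat.pair z w) v = true := by
  have h0 : Partrec fun q : ℕ => Nat.rfind fun v => Part.some (!(R q v)) := by
    refine Partrec.rfind ?_
    exact (Primrec.not.comp hR).to_comp.partrec
  obtain ⟨c0, hc0⟩ := redIn_of_partrec (Partrec.nat_iff.1 h0) (chi fun _ => false)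
  have hdom : ∀ q, (∃ r, r ∈ c0.eval (chi fun _ => false) q) ↔ ∃ v, R q v = false := by
    intro q
    rw [hc0]
    constructor
    · rintro ⟨r, hr⟩
      have := Nat.rfind_spec hr
      simp at this
      exact ⟨r, this⟩
    · rintro ⟨v, hv⟩
      have : (Nat.rfind fun v => Part.some (!(R q v))).Dom := by
        refine Nat.rfind_dom.2 ⟨v, ?_, fun _ => trivial⟩
        simp [hv]
      exact ⟨_, Part.get_mem this⟩
  set ec : ℕ → ℕ := fun n => (constCode n).encodeCode with hec
  have hecp : Primrec ec := by
    refine (Primrec.nat_rec₁ (f := fun _ r => 4 * Nat.pair 1 r + 6) 0 ?_).of_eq ?_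
    · exact Primrec.nat_add.comp (Primrec.nat_mul.comp (Primrec.const 4)
        (Primrec₂.natPair.comp (Primrec.const 1) Primrec.snd)) (Primrec.const 6)
    · intro n
      induction n with
      | zero => rfl
      | succ n ih => 
        simp only [ih]
        rfl
  set q : ℕ → ℕ := fun n => (OracleCode.comp c0 (constCode n)).encodeCode with hq
  have hqp : Primrec q := by
    exact Primrec.nat_add.comp (Primrec.nat_mul.comp (Primrec.const 4)
        (Primrec₂.natPair.comp (Primrec.const c0.encodeCode) hecp)) (Primrec.const 6)
  have hzq : ∀ n, zeroJump (q n) = false ↔ ∀ v, R n v = true := by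
    intro n
    rw [← not_iff_not]
    simp only [Bool.not_eq_false, not_forall, Bool.not_eq_true]
    rw [← hdom n]
    unfold zeroJump jump
    rw [@decide_eq_true_iff _ (Classical.dec _)]
    constructor
    · rintro ⟨c, hc, hd⟩
      have := encodeCode_inj _ _ hc
      subst this
      have := Part.get_mem hd
      rw [mem_eval_comp] at this
      obtain ⟨a, ha, hr⟩ := this
      rw [constCode_eval] at ha
      subst ha
      exact ⟨_, hr⟩
    · rintro ⟨r, hr⟩
      refine ⟨_, rfl, Part.dom_iff_mem.2 ⟨r, mem_eval_comp.2 ⟨n, ?_, hr⟩⟩⟩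
      rw [constCode_eval]
  have hO : RedIn (natFun fun n => cond (zeroJump n) 1 0) (chi zeroJump) := redIn_oracle _
  obtain ⟨c1, hc1⟩ := redIn_compT hO (redIn_of_primrec hqp _)
  obtain ⟨i0, hi0⟩ : RedIn (natFun fun n => Nat.pair n 0) (chi zeroJump) :=
    redIn_of_primrec (Primrec₂.natPair.comp Primrec.id (Primrec.const 0)) _
  refine ⟨.comp (.rfind' c1) i0, fun z => ?_⟩
  have hv1 : ∀ n v, v ∈ c1.eval (chi zeroJump) n ↔ v = cond (zeroJump (q n)) 1 0 := by
    intro n v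
    rw [hc1]
    exact Part.mem_some_iff
  rw [Part.dom_iff_mem]
  constructor
  · rintro ⟨y, hy⟩
    rw [mem_eval_comp] at hy
    obtain ⟨a, ha, hy⟩ := hy
    rw [hi0] at ha
    have ha := Part.mem_some_iff.1 ha
    subst ha
    rw [mem_eval_rfind] at hy
    obtain ⟨k, -, h1, -⟩ := hy
    rw [hv1] at h1
    refine ⟨k, (hzq _).1 ?_⟩
    revert h1
    cases zeroJump (q (Nat.pair z (k+0))) <;> simp_all
  · intro hw
    classical
    have hw' : ∃ w, zeroJump (q (Nat.pair z w)) = false := by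
      obtain ⟨w, hw⟩ := hw
      exact ⟨w, (hzq _).2 hw⟩
    refine ⟨Nat.find hw', mem_eval_comp.2 ⟨Nat.pair z 0, by rw [hi0]; exact Part.mem_some _, ?_⟩⟩
    rw [mem_eval_rfind]
    refine ⟨Nat.find hw', rfl, ?_, ?_⟩
    · rw [hv1]
      have := Nat.find_spec hw'
      simp [this]
    · intro j hj
      have := Nat.find_min hw' hj
      refine ⟨_, (hv1 _ _).2 rfl, ?_⟩
      simp at this
      simp [this]

end Part2

section Part3
/-! ### Measure on Cantor space -/
open MeasureTheory

/-- the fair-coin measure -/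
noncomputable def coin : Measure (ℕ → Bool) :=
  Measure.infinitePi fun _ : ℕ => (PMF.uniformOfFintype Bool).toMeasure

instance coin_prob : IsProbabilityMeasure coin := by unfold coin; infer_instance

/-- cylinder -/
def cyl (σ : List Bool) : Set (ℕ → Bool) := {X | extendsStr X σ}

theorem mem_cyl {X : ℕ → Bool} {σ : List Bool} : X ∈ cyl σ ↔ σ = restr X σ.length :=
  extendsStr_iff X σ

theorem mem_cyl_iff_pref {X : ℕ → Bool} {σ : List Bool} {m : ℕ} (h : σ.length ≤ m) :
    X ∈ cyl σ ↔ σ <+: restr X m := by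
  rw [mem_cyl]
  constructor
  · intro h1
    rw [h1]
    exact restr_pref X h
  · intro h1
    rw [List.prefix_iff_eq_take, restr_take X h] at h1
    exact h1

theorem cyl_eq_pi (σ : List Bool) :
    cyl σ = Set.pi (Finset.range σ.length) fun i => {σ.getD i false} := by
  ext X
  simp only [cyl, extendsStr, Set.mem_ofPred_eq, Set.mem_pi, Finset.coe_range, Set.mem_Iio,
    Set.mem_singleton_iff]
  constructor
  · intro h i hi
    have := h ⟨i, hi⟩
    simp at this
    simp [this, hi]
  · intro h i
    have := h i.1 i.2
    simp at this
    simp [this]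

theorem coin_cyl (σ : List Bool) : coin (cyl σ) = 2⁻¹ ^ σ.length := by
  rw [cyl_eq_pi, coin, Measure.infinitePi_pi]
  · simp
  · intro i _
    exact measurableSet_singleton _

theorem isOpen_cyl (σ : List Bool) : IsOpen (cyl σ) := by
  rw [cyl_eq_pi]
  exact isOpen_set_pi (Finset.finite_toSet _) fun i _ => isOpen_discrete _

theorem meas_cyl (σ : List Bool) : MeasurableSet (cyl σ) := (isOpen_cyl σ).measurableSet

theorem cyl_anti {σ τ : List Bool} (h : σ <+: τ) : cyl τ ⊆ cyl σ := by
  intro X hX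
  have := mem_cyl.1 hX
  rw [mem_cyl_iff_pref h.length_le, ← this]
  exact h

theorem mem_cyl_restr (X : ℕ → Bool) (m : ℕ) : X ∈ cyl (restr X m) := by
  rw [mem_cyl]; simp

theorem cyl_disj {σ τ : List Bool} (h1 : ¬ σ <+: τ) (h2 : ¬ τ <+: σ) :
    Disjoint (cyl σ) (cyl τ) := by
  rw [Set.disjoint_left]
  intro X hX hY
  rcases le_total σ.length τ.length with h | h
  · apply h1
    rw [mem_cyl_iff_pref h, ← mem_cyl.1 hY] at hX
    exact hX
  · apply h2
    rw [mem_cyl_iff_pref h, ← mem_cyl.1 hX] at hY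
    exact hY

theorem openOf_eq (V : Set (List Bool)) : openOf V = ⋃ σ ∈ V, cyl σ := by
  ext X; simp [openOf, cyl]

theorem mem_openOf {V : Set (List Bool)} {X : ℕ → Bool} : X ∈ openOf V ↔ ∃ σ ∈ V, X ∈ cyl σ :=
  Iff.rfl

theorem isOpen_openOf (V : Set (List Bool)) : IsOpen (openOf V) := by
  rw [openOf_eq]
  exact isOpen_biUnion fun σ _ => isOpen_cyl σ

theorem meas_openOf (V : Set (List Bool)) : MeasurableSet (openOf V) :=
  (isOpen_openOf V).measurableSet

theorem coin_finset (n : ℕ) (S : Finset (List Bool)) (hS : ∀ σ ∈ S, σ.length = n) :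
    coin (⋃ σ ∈ S, cyl σ) = S.card * 2⁻¹ ^ n := by
  rw [measure_biUnion_finset]
  · rw [Finset.sum_congr rfl (g := fun _ => (2⁻¹ : ℝ≥0∞) ^ n)]
    · simp
    · intro σ hσ
      rw [coin_cyl, hS σ hσ]
  · intro σ hσ τ hτ hne
    have e : σ.length = τ.length := by rw [hS σ hσ, hS τ hτ]
    refine cyl_disj (fun h => hne (h.eq_of_length e)) (fun h => hne (h.eq_of_length e.symm).symm)
  · exact fun σ _ => meas_cyl σ

theorem stringMeasure_le (V : Set (List Bool)) : stringMeasure V ≤ coin (openOf V) := by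
  classical
  unfold stringMeasure
  refine iSup_le fun n => ?_
  set T : Finset (Fin n → Bool) := Finset.univ.filter fun f => ∃ σ ∈ V, σ <+: List.ofFn f with hT
  have h1 : Nat.card {f : Fin n → Bool // ∃ σ ∈ V, σ <+: List.ofFn f} = T.card := by
    rw [Nat.card_eq_fintype_card, Fintype.card_subtype]
  have h2 := coin_finset n (T.image List.ofFn) (by
    intro σ hσ
    obtain ⟨f, _, rfl⟩ := Finset.mem_image.1 hσ
    simp)
  rw [Finset.card_image_of_injective _ List.ofFn_injective] at h2
  rw [h1, ENNReal.div_eq_inv_mul, mul_comm, ENNReal.inv_pow, ← h2]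
  apply measure_mono
  intro X hX
  simp only [Set.mem_iUnion, Finset.mem_image] at hX
  obtain ⟨_, ⟨f, hf, rfl⟩, hX⟩ := hX
  obtain ⟨σ, hσ, hpre⟩ := (Finset.mem_filter.1 hf).2
  exact ⟨σ, hσ, cyl_anti hpre hX⟩

/-- all strings of a given length -/
def allStr : ℕ → List (List Bool)
  | 0 => [[]]
  | t+1 => (allStr t).flatMap fun y => [y ++ [false], y ++ [true]]

theorem mem_allStr {t : ℕ} {y : List Bool} : y ∈ allStr t ↔ y.length = t := by
  induction t generalizing y with
  | zero => simp [allStr]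
  | succ t ih =>
    simp only [allStr, List.mem_flatMap, ih]
    constructor
    · rintro ⟨a, rfl, h⟩
      simp at h
      rcases h with rfl | rfl <;> simp
    · intro h
      rcases List.eq_nil_or_concat y with rfl | ⟨z, b, rfl⟩
      · simp at h
      · refine ⟨z, by simpa using h, ?_⟩
        cases b <;> simp

theorem allStr_nodup (t : ℕ) : (allStr t).Nodup := by
  induction t with
  | zero => simp [allStr]
  | succ t ih =>
    rw [allStr, List.nodup_flatMap]
    refine ⟨fun y _ => by simp, ?_⟩
    refine ih.imp ?_
    intro a b hab
    simp [Function.onFun, hab, hab.symm]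

theorem primrec_allStr : Primrec allStr := by
  refine (Primrec.nat_rec₁ (f := fun _ (l : List (List Bool)) => l.flatMap fun y => 
    [y ++ [false], y ++ [true]]) [[]] ?_).of_eq ?_
  · refine Primrec.list_flatMap Primrec.snd ?_
    refine Primrec.list_cons.comp (Primrec.list_concat.comp Primrec.snd (Primrec.const _)) ?_
    refine Primrec.list_cons.comp (Primrec.list_concat.comp Primrec.snd (Primrec.const _)) ?_
    exact Primrec.const _
  · intro n
    induction n with
    | zero => rfl
    | succ n ih => simp only [allStr, ih]

/-- number of strings of length `t` satisfying `P` -/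
def cnt (P : List Bool → Bool) (t : ℕ) : ℕ := ((allStr t).filter P).length

theorem coin_cnt (P : List Bool → Bool) (t : ℕ) :
    coin {X | P (restr X t) = true} = cnt P t * 2⁻¹ ^ t := by
  classical
  have h := coin_finset t ((allStr t).filter P).toFinset (by
    intro σ hσ
    simp only [List.mem_toFinset, List.mem_filter, mem_allStr] at hσ
    exact hσ.1)
  rw [List.toFinset_card_of_nodup ((allStr_nodup t).filter _)] at h
  rw [cnt, ← h]
  congr 1
  ext X
  simp only [Set.mem_ofPred_eq, List.mem_toFinset, List.mem_filter, mem_allStr, Set.mem_iUnion]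
  constructor
  · intro hP
    exact ⟨restr X t, ⟨by simp, hP⟩, mem_cyl_restr X t⟩
  · rintro ⟨σ, ⟨rfl, hP⟩, hX⟩
    rw [← mem_cyl.1 hX]; exact hP

theorem primrec_cnt {β : Type*} [Primcodable β] {P : β → List Bool → Bool} {t : β → ℕ}
    (hP : Primrec₂ P) (ht : Primrec t) : Primrec fun b => cnt (P b) (t b) := by
  have h1 : Primrec fun b => ((allStr (t b)).flatMap fun y => cond (P b y) [y] []).length := by
    refine Primrec.list_length.comp (Primrec.list_flatMap (primrec_allStr.comp ht) ?_)
    exact Primrec.cond hP (Primrec.list_cons.comp Primrec.snd (Primrec.const [])) (Primrec.const [])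
  refine h1.of_eq fun b => ?_
  unfold cnt
  congr 1
  generalize allStr (t b) = l
  induction l with
  | nil => rfl
  | cons a l ih =>
    rw [List.flatMap_cons, ih, List.filter_cons]
    cases P b a <;> simp

theorem test_lemma {A : ℕ → Bool} (hA : TwoRandom A) (R : ℕ × List Bool × ℕ × ℕ → Bool)
    (hR : Primrec R)
    (hμ : ∀ i, coin (openOf {σ | ∃ w, ∀ v, R (i, σ, w, v) = true}) ≤ 2⁻¹ ^ i) :
    ∃ i, A ∉ openOf {σ | ∃ w, ∀ v, R (i, σ, w, v) = true} := by
  obtain ⟨d, hd⟩ := sigma2_ce (fun p v => R (p.unpair.1.unpair.1 + 1,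
    (Encodable.decode p.unpair.1.unpair.2 : Option (List Bool)).getD [], p.unpair.2, v)) (by
      have hu1 : Primrec fun q : ℕ × ℕ => q.1.unpair.1.unpair := 
        Primrec.unpair.comp (Primrec.fst.comp (Primrec.unpair.comp Primrec.fst))
      have hu2 : Primrec fun q : ℕ × ℕ => q.1.unpair.2 := 
        Primrec.snd.comp (Primrec.unpair.comp Primrec.fst)
      exact hR.comp (Primrec.pair (Primrec.succ.comp (Primrec.fst.comp hu1)) (Primrec.pair 
        (Primrec.option_getD.comp (Primrec.decode.comp (Primrec.snd.comp hu1)) (Primrec.const []))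
        (Primrec.pair hu2 Primrec.snd))))
  have := hA (fun i => {σ | ∃ w, ∀ v, R (i+1, σ, w, v) = true}) ⟨⟨d, ?_⟩, ?_⟩
  · obtain ⟨i, hi⟩ := this
    exact ⟨i+1, hi⟩
  · intro i σ
    rw [hd]
    simp
  · intro i
    refine ((stringMeasure_le _).trans (hμ (i+1))).trans_lt ?_
    rw [pow_succ, ← div_eq_mul_inv]
    exact ENNReal.half_lt_self (by simp) (by simp)

end Part3

section Part4
open MeasureTheory

theorem enn_aux (a m i : ℕ) : (a : ℝ≥0∞) * 2⁻¹ ^ m ≤ 2⁻¹ ^ i ↔ a * 2 ^ i ≤ 2 ^ m := by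
  rw [← ENNReal.inv_pow, ← ENNReal.inv_pow, ENNReal.le_inv_iff_mul_le, mul_right_comm,
    ← div_eq_mul_inv, ENNReal.div_le_iff (by simp) (by simp), one_mul]
  norm_cast

theorem primrec_two_pow : Primrec fun n : ℕ => 2 ^ n := by
  refine (Primrec.nat_rec₁ (f := fun _ (l : ℕ) => l * 2) 1 ?_).of_eq ?_
  · exact Primrec.nat_mul.comp Primrec.snd (Primrec.const 2)
  · intro n
    induction n with
    | zero => rfl
    | succ n ih => simp only [ih, pow_succ]

theorem meas_str (P : List Bool → Bool) (m : ℕ) : MeasurableSet {X | P (restr X m) = true} := by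
  have : {X | P (restr X m) = true} = ⋃ σ ∈ {σ : List Bool | σ.length = m ∧ P σ = true}, cyl σ := by
    ext X
    simp only [Set.mem_ofPred_eq, Set.mem_iUnion]
    constructor
    · intro h
      exact ⟨restr X m, ⟨by simp, h⟩, mem_cyl_restr X m⟩
    · rintro ⟨σ, ⟨rfl, h⟩, hX⟩
      rw [← mem_cyl.1 hX]; exact h
  rw [this]
  exact (isOpen_biUnion fun σ _ => isOpen_cyl σ).measurableSet

theorem weak_two {A : ℕ → Bool} (hA : TwoRandom A) (P : ℕ → List Bool → Bool) (hP : Primrec₂ P)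
    (mono : ∀ n y y', y <+: y' → P n y = true → P n y' = true)
    (anti : ∀ n n' y, n ≤ n' → P n' y = true → P n y = true)
    (h : ∀ n, ∃ m, P n (restr A m) = true) :
    coin {X | ∀ n, ∃ m, P n (restr X m) = true} ≠ 0 := by
  intro h0
  set K : ℕ → ℕ → Set (ℕ → Bool) := fun n m => {X | P n (restr X m) = true} with hK
  set O : ℕ → Set (ℕ → Bool) := fun n => ⋃ m, K n m with hO
  have hKm : ∀ n, Monotone (K n) := fun n m m' hm X hX => mono _ _ _ (restr_pref X hm) hX
  have hOa : Antitone O := by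
    intro n n' hn
    exact Set.iUnion_mono fun m X hX => anti _ _ _ hn hX
  have hOmeas : ∀ n, MeasurableSet (O n) := fun n => MeasurableSet.iUnion fun m => meas_str _ _
  have hle : ∀ n i, coin (O n) ≤ 2⁻¹ ^ i ↔ ∀ m, cnt (P n) m * 2 ^ i ≤ 2 ^ m := by
    intro n i
    rw [(hKm n).measure_iUnion, iSup_le_iff]
    refine forall_congr' fun m => ?_
    rw [hK, coin_cnt, enn_aux]
  have hI : coin (⋂ n, O n) = 0 := by
    rw [← h0]
    congr 1
    ext X
    simp [hO, hK]
  have htend := tendsto_measure_iInter_atTop (μ := coin) (fun n => (hOmeas n).nullMeasurableSet) hOa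
    ⟨0, measure_ne_top _ _⟩
  rw [hI] at htend
  have hμ : ∀ i, coin (openOf {σ | ∃ w, ∀ v, (P w σ && decide (cnt (P w) v * 2 ^ i ≤ 2 ^ v)) = true})
      ≤ 2⁻¹ ^ i := by
    intro i
    by_cases hex : ∃ n, coin (O n) ≤ 2⁻¹ ^ i
    · classical
      refine le_trans (measure_mono ?_) (Nat.find_spec hex)
      intro X hX
      obtain ⟨y, ⟨n, hn⟩, hXy⟩ := mem_openOf.1 hX
      have h1 : coin (O n) ≤ 2⁻¹ ^ i := by
        rw [hle]
        intro m
        have := hn m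
        simp at this
        exact this.2
      refine hOa (Nat.find_min' hex h1) ?_
      refine Set.mem_iUnion.2 ⟨y.length, ?_⟩
      have := hn 0
      simp at this
      simp only [hK, Set.mem_ofPred_eq, ← mem_cyl.1 hXy]
      exact this.1
    · refine le_trans (le_of_eq ?_) (zero_le)
      convert measure_empty (μ := coin)
      rw [Set.eq_empty_iff_forall_notMem]
      intro X hX
      obtain ⟨y, ⟨n, hn⟩, hXy⟩ := mem_openOf.1 hX
      refine hex ⟨n, (hle _ _).2 fun m => ?_⟩
      have := hn m
      simp at this
      exact this.2
  obtain ⟨i, hi⟩ := test_lemma hA (fun q : ℕ × List Bool × ℕ × ℕ =>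
      P q.2.2.1 q.2.1 && decide (cnt (P q.2.2.1) q.2.2.2 * 2 ^ q.1 ≤ 2 ^ q.2.2.2)) (by
    have hw : Primrec fun q : ℕ × List Bool × ℕ × ℕ => q.2.2.1 :=
      Primrec.fst.comp (Primrec.snd.comp Primrec.snd)
    have hv : Primrec fun q : ℕ × List Bool × ℕ × ℕ => q.2.2.2 :=
      Primrec.snd.comp (Primrec.snd.comp Primrec.snd)
    refine Primrec.and.comp (hP.comp hw (Primrec.fst.comp Primrec.snd)) ?_
    refine (PrimrecRel.comp Primrec.nat_le ?_ (primrec_two_pow.comp hv)).decide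
    refine Primrec.nat_mul.comp ?_ (primrec_two_pow.comp Primrec.fst)
    exact primrec_cnt (P := fun (q : ℕ × List Bool × ℕ × ℕ) y => P q.2.2.1 y)
      (hP.comp (hw.comp Primrec.fst) Primrec.snd) hv) hμ
  · apply hi
    have : ∃ n, coin (O n) ≤ 2⁻¹ ^ i := by
      have h1 : ∀ᶠ n in Filter.atTop, coin (O n) < 2⁻¹ ^ i :=
        htend.eventually (gt_mem_nhds (ENNReal.pow_pos (by simp) i))
      obtain ⟨n, hn⟩ := h1.exists
      exact ⟨n, hn.le⟩
    obtain ⟨n, hn⟩ := this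
    rw [hle] at hn
    obtain ⟨m, hm⟩ := h n
    refine mem_openOf.2 ⟨restr A m, ⟨n, fun v => ?_⟩, mem_cyl_restr A m⟩
    simp [hm, hn v]

theorem sacks (F : List Bool → ℕ → Option Bool) (hF : Primrec₂ F)
    (mono : ∀ σ τ n v, σ <+: τ → F σ n = some v → F τ n = some v) (B : ℕ → Bool)
    (h : coin {X | ∀ n, ∃ m, F (restr X m) n = some (B n)} ≠ 0) : ComputableSeq B := by
  classical
  set S := {X | ∀ n, ∃ m, F (restr X m) n = some (B n)} with hS
  have hlt : coin S < 2 * coin S := by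
    rw [two_mul]
    exact ENNReal.lt_add_right (measure_ne_top _ _) h
  obtain ⟨U, hSU, hUo, hU⟩ := Set.exists_isOpen_lt_of_lt S _ hlt
  set K : ℕ → Set (ℕ → Bool) := fun t => {X | decide (cyl (restr X t) ⊆ U) = true} with hK
  have hKm : Monotone K := by
    intro t t' htt X hX
    simp only [hK, Set.mem_ofPred_eq, decide_eq_true_eq] at hX ⊢
    exact (cyl_anti (restr_pref X htt)).trans hX
  have hKmeas : ∀ t, MeasurableSet (K t) := fun t => meas_str (fun y => decide (cyl y ⊆ U)) t
  have hKU : ∀ t, K t ⊆ U := by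
    intro t X hX
    simp only [hK, Set.mem_ofPred_eq, decide_eq_true_eq] at hX
    exact hX (mem_cyl_restr X t)
  have hcov : S ⊆ ⋃ t, K t := by
    intro X hX
    have hXU := hSU hX
    obtain ⟨I, u, hu, hIu⟩ := isOpen_pi_iff.1 hUo X hXU
    obtain ⟨t, ht⟩ : ∃ t, ∀ i ∈ I, i < t := ⟨I.sup id + 1, fun i hi => 
      Nat.lt_succ_of_le (Finset.le_sup (f := id) hi)⟩
    refine Set.mem_iUnion.2 ⟨t, ?_⟩
    simp only [hK, Set.mem_ofPred_eq, decide_eq_true_eq]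
    intro Y hY
    apply hIu
    intro i hi
    have h1 := mem_cyl.1 hY
    simp only [restr_length] at h1
    have h2 := restr_getElem? X t i
    rw [h1, restr_getElem?, if_pos (ht i hi), if_pos (ht i hi)] at h2
    simp at h2
    rw [h2]
    exact (hu i hi).2
  have hlim : ∃ t, coin U < 2 * coin (S ∩ K t) := by
    by_contra hcon
    push Not at hcon
    have h1 : coin S = ⨆ t, coin (S ∩ K t) := by
      have hm : Monotone fun t => S ∩ K t := fun t t' htt => Set.inter_subset_inter_right _ (hKm htt)
      rw [← hm.measure_iUnion, ← Set.inter_iUnion, Set.inter_eq_left.2 hcov]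
    have h2 : 2 * coin S ≤ coin U := by
      rw [h1, ENNReal.mul_iSup]
      exact iSup_le hcon
    exact absurd hU (not_lt.2 h2)
  obtain ⟨t, ht⟩ := hlim
  have ht2 : coin (K t) < 2 * coin (S ∩ K t) := (measure_mono (hKU t)).trans_lt ht
  set D : List (List Bool) := (allStr t).filter fun y => decide (cyl y ⊆ U) with hD
  have hKD : ∀ X m, t ≤ m → (X ∈ K t ↔ D.elem ((restr X m).take t) = true) := by
    intro X m hm
    rw [restr_take X hm]
    simp [hK, hD, mem_allStr]
  -- the counting predicates
  set Q : Bool × ℕ → List Bool → Bool := fun q y =>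
    D.elem (y.take t) && decide (F y q.2 = some q.1) with hQ
  have hinD : Primrec fun y : List Bool => D.elem (y.take t) := by
    have h1 : PrimrecPred fun y : List Bool => ∃ a ∈ D, y.take t = a := by
      refine (PrimrecRel.exists_mem_list (R := fun a (y : List Bool) => y.take t = a) ?_).comp
        (Primrec.const D) Primrec.id
      exact PrimrecRel.comp Primrec.eq (Primrec.list_take.comp (Primrec.const t) Primrec.snd)
        Primrec.fst
    refine h1.decide.of_eq fun y => ?_
    rw [Bool.eq_iff_iff]
    simp
  have hQp : Primrec₂ Q := by
    refine Primrec.and.comp (hinD.comp Primrec.snd) ?_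
    refine (PrimrecRel.comp Primrec.eq (hF.comp Primrec.snd (Primrec.snd.comp Primrec.fst)) 
      (Primrec.option_some.comp (Primrec.fst.comp Primrec.fst))).decide
  have hcK : ∀ m, t ≤ m → coin (K t) = cnt (fun y => D.elem (y.take t)) m * 2⁻¹ ^ m := by
    intro m hm
    rw [← coin_cnt]
    congr 1
    ext X
    exact hKD X m hm
  have hmaj : ∀ m b n, t ≤ m → (coin (K t) < 2 * coin {X | Q (b, n) (restr X m) = true} ↔
      cnt (fun y => D.elem (y.take t)) m < 2 * cnt (Q (b, n)) m) := by
    intro m b n hm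
    rw [hcK m hm, coin_cnt, ← mul_assoc]
    rw [ENNReal.mul_lt_mul_iff_left (by simp) (by simp)]
    norm_cast
  have hmaj_true : ∀ m b n, t ≤ m → coin (K t) < 2 * coin {X | Q (b, n) (restr X m) = true} →
      b = B n := by
    intro m b n hm hb
    by_contra hne
    have hdis : Disjoint (S ∩ K t) {X | Q (b, n) (restr X m) = true} := by
      rw [Set.disjoint_left]
      rintro X ⟨hXS, -⟩ hXQ
      obtain ⟨m', hm'⟩ := hXS n
      simp only [hQ, Set.mem_ofPred_eq, Bool.and_eq_true, decide_eq_true_eq] at hXQ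
      have h1 := mono _ (restr X (max m m')) _ _ (restr_pref X (le_max_left _ _)) hXQ.2
      have h2 := mono _ (restr X (max m m')) _ _ (restr_pref X (le_max_right _ _)) hm'
      rw [h1] at h2
      exact hne (Option.some.inj h2)
    have h3 : coin (S ∩ K t) + coin {X | Q (b, n) (restr X m) = true} ≤ coin (K t) := by
      rw [← measure_union hdis (meas_str _ _)]
      apply measure_mono
      rintro X (hX | hX)
      · exact hX.2
      · simp only [hQ, Set.mem_ofPred_eq, Bool.and_eq_true] at hX
        exact (hKD X m hm).2 hX.1
    have h4 := ENNReal.add_lt_add ht2 hb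
    rw [← mul_add, ← two_mul] at h4
    exact absurd (lt_of_lt_of_le h4 (mul_le_mul_right h3 2)) (lt_irrefl _)
  refine tred_of_approx (fun σ n => if t ≤ σ.length ∧
      cnt (fun y => D.elem (y.take t)) σ.length < 2 * cnt (Q (true, n)) σ.length then some true
    else if t ≤ σ.length ∧ 
      cnt (fun y => D.elem (y.take t)) σ.length < 2 * cnt (Q (false, n)) σ.length then some false
    else none) ?_ _ _ ?_ ?_
  · have hl : Primrec fun p : List Bool × ℕ => p.1.length := Primrec.list_length.comp Primrec.fst
    have key : ∀ b : Bool, PrimrecPred fun p : List Bool × ℕ => t ≤ p.1.length ∧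
        cnt (fun y => D.elem (y.take t)) p.1.length < 2 * cnt (Q (b, p.2)) p.1.length := by
      intro b
      refine (PrimrecRel.comp Primrec.nat_le (Primrec.const t) hl).and
        (PrimrecRel.comp Primrec.nat_lt ?_ ?_)
      · exact primrec_cnt (P := fun (_ : List Bool × ℕ) y => D.elem (y.take t))
          (hinD.comp Primrec.snd) hl
      · refine Primrec.nat_mul.comp (Primrec.const 2) ?_
        exact primrec_cnt (P := fun (p : List Bool × ℕ) y => Q (b, p.2) y)
          (hQp.comp (Primrec.pair (Primrec.const b) (Primrec.snd.comp Primrec.fst)) Primrec.snd) hl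
    exact Primrec.ite (key true) (Primrec.const _) (Primrec.ite (key false) (Primrec.const _)
      (Primrec.const _))
  · intro n
    have hex : ∃ m, t ≤ m ∧ cnt (fun y => D.elem (y.take t)) m < 2 * cnt (Q (B n, n)) m := by
      by_contra hcon
      push Not at hcon
      have h1 : ∀ m, t ≤ m → 2 * coin {X | Q (B n, n) (restr X m) = true} ≤ coin (K t) := by
        intro m hm
        rw [← not_lt, hmaj m _ _ hm, not_lt]
        exact hcon m hm
      have h2 : coin (S ∩ K t) ≤ ⨆ m, coin {X | Q (B n, n) (restr X (t+m)) = true} := by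
        have hm : Monotone fun m => {X | Q (B n, n) (restr X (t+m)) = true} := by
          intro m m' hmm X hX
          simp only [hQ, Set.mem_ofPred_eq, Bool.and_eq_true, decide_eq_true_eq] at hX ⊢
          exact ⟨(hKD _ _ (by omega)).1 ((hKD _ _ (by omega)).2 hX.1), 
            mono _ _ _ _ (restr_pref X (by omega)) hX.2⟩
        rw [← hm.measure_iUnion]
        apply measure_mono
        rintro X ⟨hXS, hXK⟩
        obtain ⟨m', hm'⟩ := hXS n
        refine Set.mem_iUnion.2 ⟨m', ?_⟩
        simp only [hQ, Set.mem_ofPred_eq, Bool.and_eq_true, decide_eq_true_eq]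
        exact ⟨(hKD _ _ (by omega)).1 hXK, mono _ _ _ _ (restr_pref X (by omega)) hm'⟩
      have h3 : 2 * coin (S ∩ K t) ≤ coin (K t) := by
        refine (mul_le_mul_right h2 2).trans ?_
        rw [ENNReal.mul_iSup]
        exact iSup_le fun m => h1 _ (by omega)
      exact absurd ht2 (not_lt.2 h3)
    obtain ⟨m, hm, hmc⟩ := hex
    refine ⟨m, ?_⟩
    simp only [restr_length]
    rcases hB : B n with _ | _
    · rw [hB] at hmc
      rw [if_neg, if_pos ⟨hm, hmc⟩]
      rintro ⟨-, h5⟩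
      have := hmaj_true m true n hm ((hmaj _ _ _ hm).2 h5)
      rw [hB] at this
      simp at this
    · rw [hB] at hmc
      rw [if_pos ⟨hm, hmc⟩]
  · intro n m v hv
    simp only [restr_length] at hv
    split_ifs at hv with h1 h2
    · have := hmaj_true m true n h1.1 ((hmaj _ _ _ h1.1).2 h1.2)
      simp at hv
      rw [hv, this]
    · have := hmaj_true m false n h2.1 ((hmaj _ _ _ h2.1).2 h2.2)
      simp at hv
      rw [hv, this]

end Part4

section Part5
/-! ### The construction: definitions and primitive recursiveness -/

/-- a splitting pair together with the argument -/
abbrev Item := List Bool × List Bool × ℕ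
/-- history entries -/
abbrev Ent := ℕ × ℕ × List ℕ
/-- states -/
abbrev St := List Bool × List ℕ × List Ent

/-- candidates -/
def cands (L : ℕ) : List Item :=
  (allStr L).flatMap fun v => (allStr L).flatMap fun u => (List.range (L+1)).map fun n => (v, u, n)

/-- the condition for appending a candidate -/
def selOk (F : List Bool → ℕ → Option Bool) (x : List Bool) (acc : List Item) (c : Item) : Prop :=
  x <+: c.1 ∧ x <+: c.2.1 ∧ x.length < c.1.length ∧ F c.1 c.2.2 = some false ∧
    F c.2.1 c.2.2 = some true ∧
    ∀ it ∈ acc, ¬ it.1 <+: c.1 ∧ ¬ it.1 <+: c.2.1 ∧ ¬ it.2.1 <+: c.1 ∧ ¬ it.2.1 <+: c.2.1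

instance selOkDec (F x acc c) : Decidable (selOk F x acc c) := by
  unfold selOk; infer_instance

/-- one selection step -/
def selStep (F : List Bool → ℕ → Option Bool) (x : List Bool) (acc : List Item) (c : Item) :
    List Item := if selOk F x acc c then acc ++ [c] else acc

/-- selected items -/
def sel (F : List Bool → ℕ → Option Bool) (x : List Bool) : ℕ → List Item
  | 0 => []
  | L+1 => (cands L).foldl (selStep F x) (sel F x L)

/-- the probe used in `found` -/
def foundP (e : ℕ) (ρ : List ℕ) (j : ℕ) : Option (List ℕ) :=
  (Encodable.decode j.unpair.1 : Option (List ℕ)).bind fun τ =>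
    if ρ <+: τ ∧ (Nat.Partrec.Code.evaln j.unpair.2 (Denumerable.ofNat Nat.Partrec.Code e)
      (Encodable.encode τ)).isSome = true then some τ else none

/-- search for an extension of `ρ` in the `e`-th c.e. set -/
def found (e : ℕ) (ρ : List ℕ) (t : ℕ) : Option (List ℕ) := bsearch (foundP e ρ) t

/-- index of the requirement considered at a state -/
def sid (st : St) : ℕ := (Nat.unpair st.2.2.length).1

/-- does the state act for its requirement -/
def attends (st : St) : Prop := ∀ q ∈ st.2.2, q.1 = sid st →
  (q.2.1 = 0 ∨ q.2.1 = 3 ∨ (q.2.1 = 1 ∧ (found (sid st) q.2.2 st.2.2.length).isSome = true))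

instance attendsDec (st : St) : Decidable (attends st) := by
  unfold attends; infer_instance

/-- the V-child -/
def vChild (st : St) (it : Item) : St :=
  (it.1, st.2.1 ++ [it.2.2 + 1, Encodable.encode it.1],
    st.2.2 ++ [(sid st, 1, st.2.1 ++ [it.2.2 + 1])])

/-- the N-child -/
def nChild (st : St) (y : List Bool) : St :=
  (y, st.2.1 ++ [0, Encodable.encode y], st.2.2 ++ [(sid st, 0, [])])

/-- the U-child -/
def uChild (st : St) (τ : List ℕ) (y : List Bool) : St :=
  (y, τ ++ [Encodable.encode y], st.2.2 ++ [(sid st, 2, [])])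

/-- the no-op child -/
def zChild (st : St) (y : List Bool) : St :=
  (y, st.2.1 ++ [Encodable.encode y], st.2.2 ++ [(sid st, 3, [])])

/-- the children below the `u`-part of an item -/
def uPart (t : ℕ) (st : St) (it : Item) (z : List Bool) : List St :=
  if ∀ b ∈ z, b = false then
    (found (sid st) (st.2.1 ++ [it.2.2 + 1]) t).elim [] fun τ => [uChild st τ (it.2.1 ++ z)]
  else [nChild st (it.2.1 ++ z)]

/-- children belonging to an item -/
def itemCh (k t : ℕ) (st : St) (it : Item) : List St :=
  vChild st it :: (allStr (sid st + k + 1)).flatMap (uPart t st it)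

/-- all children visible with fuel `t` -/
def children (F : List Bool → ℕ → Option Bool) (k t : ℕ) (st : St) : List St :=
  if attends st then (sel F st.1 t).flatMap (itemCh k t st)
  else [zChild st (st.1 ++ [false]), zChild st (st.1 ++ [true])]

/-- the next state along `y` -/
def next (F : List Bool → ℕ → Option Bool) (k : ℕ) (y : List Bool) (st : St) : Option St :=
  ((children F k y.length st).filter fun c => c.1 <+: y).head?

/-- the root state -/
def root : St := ([], [], [])

/-- the run along `y` -/
def run (F : List Bool → ℕ → Option Bool) (k : ℕ) (y : List Bool) (s : ℕ) : Option St :=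
  Nat.rec (some root) (fun _ o => o.bind (next F k y)) s

section prim

theorem primrec_pref {α : Type*} [Primcodable α] :
    PrimrecRel fun a b : List α => a <+: b := by
  refine PrimrecPred.of_eq (PrimrecRel.comp Primrec.eq Primrec.fst
    (Primrec.list_take.comp (Primrec.list_length.comp Primrec.fst) Primrec.snd)) fun q => ?_
  exact List.prefix_iff_eq_take.symm

theorem primrec_cands : Primrec cands := by
  unfold cands
  refine Primrec.list_flatMap primrec_allStr ?_
  refine Primrec.list_flatMap (primrec_allStr.comp Primrec.fst) ?_
  refine Primrec.list_map (Primrec.list_range.comp (Primrec.succ.comp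
    (Primrec.fst.comp Primrec.fst))) ?_
  exact Primrec.pair (Primrec.snd.comp (Primrec.fst.comp Primrec.fst))
    (Primrec.pair (Primrec.snd.comp Primrec.fst) Primrec.snd)

variable {F : List Bool → ℕ → Option Bool}

theorem primrec_selStep (hF : Primrec₂ F) :
    Primrec fun q : List Bool × List Item × Item => selStep F q.1 q.2.1 q.2.2 := by
  have hx : Primrec fun q : List Bool × List Item × Item => q.1 := Primrec.fst
  have ha : Primrec fun q : List Bool × List Item × Item => q.2.1 := Primrec.fst.comp Primrec.snd
  have hc : Primrec fun q : List Bool × List Item × Item => q.2.2 := Primrec.snd.comp Primrec.snd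
  have hv := Primrec.fst.comp hc
  have hu := Primrec.fst.comp (Primrec.snd.comp hc)
  have hn := Primrec.snd.comp (Primrec.snd.comp hc)
  have hok : PrimrecPred fun q : List Bool × List Item × Item => selOk F q.1 q.2.1 q.2.2 := by
    unfold selOk
    refine (PrimrecRel.comp primrec_pref hx hv).and ?_
    refine (PrimrecRel.comp primrec_pref hx hu).and ?_
    refine (PrimrecRel.comp Primrec.nat_lt (Primrec.list_length.comp hx)
      (Primrec.list_length.comp hv)).and ?_
    refine (PrimrecRel.comp Primrec.eq (hF.comp hv hn) (Primrec.const _)).and ?_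
    refine (PrimrecRel.comp Primrec.eq (hF.comp hu hn) (Primrec.const _)).and ?_
    have hR : PrimrecRel fun (it c : Item) => ¬ it.1 <+: c.1 ∧ ¬ it.1 <+: c.2.1 ∧
        ¬ it.2.1 <+: c.1 ∧ ¬ it.2.1 <+: c.2.1 := by
      have h1 : Primrec fun p : Item × Item => p.1.1 := Primrec.fst.comp Primrec.fst
      have h2 : Primrec fun p : Item × Item => p.1.2.1 :=
        Primrec.fst.comp (Primrec.snd.comp Primrec.fst)
      have h3 : Primrec fun p : Item × Item => p.2.1 := Primrec.fst.comp Primrec.snd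
      have h4 : Primrec fun p : Item × Item => p.2.2.1 :=
        Primrec.fst.comp (Primrec.snd.comp Primrec.snd)
      exact (PrimrecRel.comp primrec_pref h1 h3).not.and
        ((PrimrecRel.comp primrec_pref h1 h4).not.and
        ((PrimrecRel.comp primrec_pref h2 h3).not.and
        (PrimrecRel.comp primrec_pref h2 h4).not))
    exact PrimrecRel.comp hR.forall_mem_list ha hc
  unfold selStep
  exact Primrec.ite hok (Primrec.list_concat.comp ha hc) ha

theorem primrec_sel (hF : Primrec₂ F) : Primrec₂ (sel F) := by
  have h1 : Primrec fun p : List Bool × ℕ => (Nat.rec ([] : List Item) (fun L acc => 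
      (cands L).foldl (selStep F p.1) acc) p.2 : List Item) := by
    refine Primrec.nat_rec' (f := fun p : List Bool × ℕ => p.2) (g := fun _ => ([] : List Item))
      (h := fun p q => (cands q.1).foldl (selStep F p.1) q.2) Primrec.snd (Primrec.const []) ?_
    refine Primrec.list_foldl (f := fun r : (List Bool × ℕ) × (ℕ × List Item) => cands r.2.1)
      (g := fun r => r.2.2) (h := fun r s => selStep F r.1.1 s.1 s.2) 
      (primrec_cands.comp (Primrec.fst.comp Primrec.snd)) (Primrec.snd.comp Primrec.snd) ?_
    exact (primrec_selStep hF).comp (Primrec.pair (Primrec.fst.comp (Primrec.fst.comp Primrec.fst))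
      Primrec.snd)
  refine h1.of_eq fun p => ?_
  rcases p with ⟨x, L⟩
  induction L with
  | zero => rfl
  | succ L ih => 
    simp only at ih
    simp only [sel, ih]

theorem primrec_found : Primrec fun q : ℕ × List ℕ × ℕ => found q.1 q.2.1 q.2.2 := by
  unfold found
  refine primrec_bsearch (p := fun (q : ℕ × List ℕ × ℕ) j => foundP q.1 q.2.1 j) ?_
    (Primrec.snd.comp Primrec.snd)
  unfold foundP
  refine Primrec.option_bind (Primrec.decode.comp (Primrec.fst.comp
    (Primrec.unpair.comp Primrec.snd))) ?_
  refine Primrec.ite (PrimrecPred.and ?_ ?_) (Primrec.option_some.comp Primrec.snd)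
    (Primrec.const none)
  · exact PrimrecRel.comp primrec_pref (Primrec.fst.comp (Primrec.snd.comp (Primrec.fst.comp
      Primrec.fst))) Primrec.snd
  · have h1 : Primrec fun q : ((ℕ × List ℕ × ℕ) × ℕ) × List ℕ => q.1.2.unpair.2 :=
      Primrec.snd.comp (Primrec.unpair.comp (Primrec.snd.comp Primrec.fst))
    have h2 : Primrec fun q : ((ℕ × List ℕ × ℕ) × ℕ) × List ℕ =>
        Denumerable.ofNat Nat.Partrec.Code q.1.1.1 :=
      (Primrec.ofNat _).comp (Primrec.fst.comp (Primrec.fst.comp Primrec.fst))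
    have h3 : Primrec fun q : ((ℕ × List ℕ × ℕ) × ℕ) × List ℕ => Encodable.encode q.2 :=
      Primrec.encode.comp Primrec.snd
    have h4 : Primrec fun q : ((ℕ × List ℕ × ℕ) × ℕ) × List ℕ =>
        Nat.Partrec.Code.evaln q.1.2.unpair.2 (Denumerable.ofNat Nat.Partrec.Code q.1.1.1)
          (Encodable.encode q.2) :=
      Nat.Partrec.Code.primrec_evaln.comp (Primrec.pair (Primrec.pair h1 h2) h3)
    exact PrimrecRel.comp Primrec.eq (Primrec.option_isSome.comp h4) (Primrec.const true)

theorem primrec_h : Primrec fun st : St => st.2.2 := Primrec.snd.comp Primrec.snd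

theorem primrec_sg : Primrec fun st : St => st.2.1 := Primrec.fst.comp Primrec.snd

theorem primrec_sid : Primrec sid :=
  Primrec.fst.comp (Primrec.unpair.comp (Primrec.list_length.comp primrec_h))

theorem primrec_attends : PrimrecPred attends := by
  have hR : PrimrecRel fun (q : Ent) (st : St) => q.1 = sid st →
    (q.2.1 = 0 ∨ q.2.1 = 3 ∨ (q.2.1 = 1 ∧ (found (sid st) q.2.2 st.2.2.length).isSome = true)) := by
    have h1 : Primrec fun p : Ent × St => p.1.2.1 := Primrec.fst.comp (Primrec.snd.comp Primrec.fst)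
    have hs : Primrec fun p : Ent × St => sid p.2 := primrec_sid.comp Primrec.snd
    have hf : Primrec fun p : Ent × St => found (sid p.2) p.1.2.2 p.2.2.2.length :=
      primrec_found.comp (Primrec.pair hs (Primrec.pair (Primrec.snd.comp (Primrec.snd.comp
        Primrec.fst)) (Primrec.list_length.comp (primrec_h.comp Primrec.snd))))
    have hA : PrimrecPred fun p : Ent × St => p.1.1 = sid p.2 :=
      PrimrecRel.comp Primrec.eq (Primrec.fst.comp Primrec.fst) hs
    have hk : ∀ i : ℕ, PrimrecPred fun p : Ent × St => p.1.2.1 = i := fun i =>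
      PrimrecRel.comp Primrec.eq h1 (Primrec.const i)
    have := hA.not.or ((hk 0).or ((hk 3).or ((hk 1).and (PrimrecRel.comp Primrec.eq
      (Primrec.option_isSome.comp hf) (Primrec.const true)))))
    refine PrimrecPred.of_eq this fun p => ?_
    exact imp_iff_not_or.symm
  unfold attends
  exact PrimrecRel.comp hR.forall_mem_list primrec_h Primrec.id

theorem primrec_hApp (i : ℕ) : Primrec₂ fun (st : St) (ρ : List ℕ) => st.2.2 ++ [(sid st, i, ρ)] :=
  Primrec.list_concat.comp (primrec_h.comp Primrec.fst) (Primrec.pair (primrec_sid.comp Primrec.fst)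
    (Primrec.pair (Primrec.const i) Primrec.snd))

theorem primrec_app2 : Primrec fun q : List ℕ × ℕ × ℕ => q.1 ++ [q.2.1, q.2.2] :=
  Primrec.list_append.comp Primrec.fst (Primrec.list_cons.comp (Primrec.fst.comp Primrec.snd)
    (Primrec.list_cons.comp (Primrec.snd.comp Primrec.snd) (Primrec.const [])))

theorem primrec_vChild : Primrec₂ vChild := by
  unfold vChild
  have hn : Primrec fun p : St × Item => p.2.2.2 + 1 :=
    Primrec.succ.comp (Primrec.snd.comp (Primrec.snd.comp Primrec.snd))
  have hv : Primrec fun p : St × Item => p.2.1 := Primrec.fst.comp Primrec.snd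
  refine Primrec.pair hv (Primrec.pair ?_ ?_)
  · exact primrec_app2.comp (Primrec.pair (primrec_sg.comp Primrec.fst) (Primrec.pair hn
      (Primrec.encode.comp hv)))
  · exact (primrec_hApp 1).comp Primrec.fst (Primrec.list_concat.comp
      (primrec_sg.comp Primrec.fst) hn)

theorem primrec_nChild : Primrec₂ nChild := by
  unfold nChild
  refine Primrec.pair Primrec.snd (Primrec.pair ?_ ?_)
  · exact primrec_app2.comp (Primrec.pair (primrec_sg.comp Primrec.fst) (Primrec.pair
      (Primrec.const 0) (Primrec.encode.comp Primrec.snd)))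
  · exact (primrec_hApp 0).comp Primrec.fst (Primrec.const [])

theorem primrec_uChild : Primrec fun q : St × List ℕ × List Bool => uChild q.1 q.2.1 q.2.2 := by
  unfold uChild
  have hy : Primrec fun q : St × List ℕ × List Bool => q.2.2 := Primrec.snd.comp Primrec.snd
  refine Primrec.pair hy (Primrec.pair ?_ ?_)
  · exact Primrec.list_concat.comp (Primrec.fst.comp Primrec.snd) (Primrec.encode.comp hy)
  · exact (primrec_hApp 2).comp Primrec.fst (Primrec.const [])

theorem primrec_zChild : Primrec₂ zChild := by
  unfold zChild
  refine Primrec.pair Primrec.snd (Primrec.pair ?_ ?_)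
  · exact Primrec.list_concat.comp (primrec_sg.comp Primrec.fst) (Primrec.encode.comp Primrec.snd)
  · exact (primrec_hApp 3).comp Primrec.fst (Primrec.const [])

theorem primrec_allFalse : PrimrecPred fun z : List Bool => ∀ b ∈ z, b = false :=
  PrimrecPred.forall_mem_list (PrimrecRel.comp Primrec.eq Primrec.id (Primrec.const false))

theorem primrec_uPart : Primrec fun q : ℕ × St × Item × List Bool =>
    uPart q.1 q.2.1 q.2.2.1 q.2.2.2 := by
  have hst : Primrec fun q : ℕ × St × Item × List Bool => q.2.1 := Primrec.fst.comp Primrec.snd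
  have hit : Primrec fun q : ℕ × St × Item × List Bool => q.2.2.1 :=
    Primrec.fst.comp (Primrec.snd.comp Primrec.snd)
  have hz : Primrec fun q : ℕ × St × Item × List Bool => q.2.2.2 :=
    Primrec.snd.comp (Primrec.snd.comp Primrec.snd)
  have hn : Primrec fun q : ℕ × St × Item × List Bool => q.2.2.1.2.2 + 1 :=
    Primrec.succ.comp (Primrec.snd.comp (Primrec.snd.comp hit))
  have huz : Primrec fun q : ℕ × St × Item × List Bool => q.2.2.1.2.1 ++ q.2.2.2 :=
    Primrec.list_append.comp (Primrec.fst.comp (Primrec.snd.comp hit)) hz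
  have hf : Primrec fun q : ℕ × St × Item × List Bool =>
      found (sid q.2.1) (q.2.1.2.1 ++ [q.2.2.1.2.2 + 1]) q.1 :=
    primrec_found.comp (Primrec.pair (primrec_sid.comp hst) (Primrec.pair
      (Primrec.list_concat.comp (primrec_sg.comp hst) hn) Primrec.fst))
  unfold uPart
  refine Primrec.ite (primrec_allFalse.comp hz) ?_ ?_
  · refine (Primrec.option_casesOn (o := fun q : ℕ × St × Item × List Bool =>
      found (sid q.2.1) (q.2.1.2.1 ++ [q.2.2.1.2.2 + 1]) q.1) (f := fun _ => [])
      (g := fun q τ => [uChild q.2.1 τ (q.2.2.1.2.1 ++ q.2.2.2)]) hf (Primrec.const []) ?_).of_eq ?_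
    · refine Primrec.list_cons.comp (primrec_uChild.comp (Primrec.pair (hst.comp Primrec.fst)
        (Primrec.pair Primrec.snd (huz.comp Primrec.fst)))) (Primrec.const [])
    · intro q
      cases found (sid q.2.1) (q.2.1.2.1 ++ [q.2.2.1.2.2 + 1]) q.1 <;> rfl
  · exact Primrec.list_cons.comp (primrec_nChild.comp hst huz) (Primrec.const [])

theorem primrec_itemCh : Primrec fun q : (ℕ × ℕ × St) × Item =>
    itemCh q.1.1 q.1.2.1 q.1.2.2 q.2 := by
  have hst : Primrec fun q : (ℕ × ℕ × St) × Item => q.1.2.2 :=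
    Primrec.snd.comp (Primrec.snd.comp Primrec.fst)
  have ht : Primrec fun q : (ℕ × ℕ × St) × Item => q.1.2.1 :=
    Primrec.fst.comp (Primrec.snd.comp Primrec.fst)
  have hr : Primrec fun q : (ℕ × ℕ × St) × Item => sid q.1.2.2 + q.1.1 + 1 :=
    Primrec.succ.comp (Primrec.nat_add.comp (primrec_sid.comp hst) (Primrec.fst.comp Primrec.fst))
  have ha : Primrec fun q : (ℕ × ℕ × St) × Item => allStr (sid q.1.2.2 + q.1.1 + 1) := by
    have := primrec_allStr.comp hr
    exact this
  have hg : Primrec fun q : ((ℕ × ℕ × St) × Item) × List Bool =>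
      ((q.1.1.2.1, q.1.1.2.2, q.1.2, q.2) : ℕ × St × Item × List Bool) :=
    Primrec.pair (ht.comp Primrec.fst) (Primrec.pair (hst.comp Primrec.fst)
      (Primrec.pair (Primrec.snd.comp Primrec.fst) Primrec.snd))
  have hu : Primrec₂ fun (q : (ℕ × ℕ × St) × Item) (z : List Bool) =>
      uPart q.1.2.1 q.1.2.2 q.2 z := by
    have := Primrec.comp primrec_uPart hg
    exact this
  have hv : Primrec fun q : (ℕ × ℕ × St) × Item => vChild q.1.2.2 q.2 := by
    have := Primrec₂.comp primrec_vChild hst Primrec.snd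
    exact this
  have := Primrec.list_cons.comp hv (Primrec.list_flatMap ha hu)
  exact this

theorem primrec_children (hF : Primrec₂ F) :
    Primrec fun q : ℕ × ℕ × St => children F q.1 q.2.1 q.2.2 := by
  have hst : Primrec fun q : ℕ × ℕ × St => q.2.2 := Primrec.snd.comp Primrec.snd
  have ht : Primrec fun q : ℕ × ℕ × St => q.2.1 := Primrec.fst.comp Primrec.snd
  have hs : Primrec fun q : ℕ × ℕ × St => sel F q.2.2.1 q.2.1 := by
    have := Primrec₂.comp (primrec_sel hF) (Primrec.fst.comp hst) ht
    exact this
  have hi : Primrec₂ fun (q : ℕ × ℕ × St) (it : Item) => itemCh q.1 q.2.1 q.2.2 it :=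
    primrec_itemCh
  have hb := Primrec.list_flatMap hs hi
  unfold children
  refine Primrec.ite (primrec_attends.comp hst) ?_ ?_
  · exact hb
  · have : ∀ b : Bool, Primrec fun q : ℕ × ℕ × St => zChild q.2.2 (q.2.2.1 ++ [b]) := fun b => by
      have h1 : Primrec fun q : ℕ × ℕ × St => q.2.2.1 ++ [b] :=
        Primrec.list_concat.comp (Primrec.fst.comp hst) (Primrec.const b)
      have := Primrec₂.comp primrec_zChild hst h1
      exact this
    have := Primrec.list_cons.comp (this false) (Primrec.list_cons.comp (this true)
      (Primrec.const []))
    exact this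

theorem primrec_next (hF : Primrec₂ F) :
    Primrec fun q : ℕ × List Bool × St => next F q.1 q.2.1 q.2.2 := by
  unfold next
  refine Primrec.list_head?.comp ?_
  have hR : PrimrecRel fun (c : St) (y : List Bool) => c.1 <+: y :=
    PrimrecRel.comp primrec_pref (Primrec.fst.comp Primrec.fst) Primrec.snd
  have hy : Primrec fun q : ℕ × List Bool × St => q.2.1 := Primrec.fst.comp Primrec.snd
  refine hR.listFilter.comp ((primrec_children hF).comp (Primrec.pair Primrec.fst 
    (Primrec.pair (Primrec.list_length.comp hy) (Primrec.snd.comp Primrec.snd)))) hy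

theorem primrec_run (hF : Primrec₂ F) :
    Primrec fun q : ℕ × List Bool × ℕ => run F q.1 q.2.1 q.2.2 := by
  unfold run
  refine Primrec.nat_rec' (f := fun q : ℕ × List Bool × ℕ => q.2.2) (g := fun _ => some root)
    (h := fun q r => r.2.bind (next F q.1 q.2.1)) (Primrec.snd.comp Primrec.snd)
    (Primrec.const _) ?_
  refine Primrec.option_bind (Primrec.snd.comp Primrec.snd) ?_
  exact (primrec_next hF).comp (Primrec.pair (Primrec.fst.comp (Primrec.fst.comp Primrec.fst))
    (Primrec.pair (Primrec.fst.comp (Primrec.snd.comp (Primrec.fst.comp Primrec.fst)))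
      Primrec.snd))

end prim

end Part5

section Part6
/-! ### Combinatorics of the construction -/

/-- incompatibility -/
def Inc (a b : List Bool) : Prop := ¬ a <+: b ∧ ¬ b <+: a

theorem Inc.symm {a b} (h : Inc a b) : Inc b a := ⟨h.2, h.1⟩

/-- incompatibility of items -/
def IncItem (a b : Item) : Prop := Inc a.1 b.1 ∧ Inc a.1 b.2.1 ∧ Inc a.2.1 b.1 ∧ Inc a.2.1 b.2.1

theorem IncItem.symm {a b} (h : IncItem a b) : IncItem b a :=
  ⟨h.1.symm, h.2.2.1.symm, h.2.1.symm, h.2.2.2.symm⟩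

theorem not_inc {a b y : List Bool} (ha : a <+: y) (hb : b <+: y) : ¬ Inc a b := by
  intro h
  rcases List.prefix_or_prefix_of_prefix ha hb with h' | h'
  · exact h.1 h'
  · exact h.2 h'

/-- items are good -/
structure GoodItem (F : List Bool → ℕ → Option Bool) (x : List Bool) (it : Item) : Prop where
  pv : x <+: it.1
  pu : x <+: it.2.1
  lt : x.length < it.1.length
  eq : it.2.1.length = it.1.length
  fv : F it.1 it.2.2 = some false
  fu : F it.2.1 it.2.2 = some true

theorem GoodItem.inc {F x it} (h : GoodItem F x it) : Inc it.1 it.2.1 := by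
  have hne : it.1 ≠ it.2.1 := by
    intro h'
    have := h.fv
    rw [h', h.fu] at this
    simp at this
  constructor
  · intro hp; exact hne (hp.eq_of_length h.eq.symm)
  · intro hp; exact hne (hp.eq_of_length h.eq).symm

section sel
variable {F : List Bool → ℕ → Option Bool} {x : List Bool}

theorem selStep_pref (acc c) : acc <+: selStep F x acc c := by
  unfold selStep; split_ifs <;> simp

theorem foldl_pref (l : List Item) : ∀ acc, acc <+: l.foldl (selStep F x) acc := by
  induction l with
  | nil => intro acc; simp
  | cons c l ih => intro acc; exact (selStep_pref acc c).trans (ih _)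

theorem sel_mono {L L' : ℕ} (h : L ≤ L') : sel F x L <+: sel F x L' := by
  induction h with
  | refl => exact List.prefix_rfl
  | step _ ih => exact ih.trans (foldl_pref _ _)

theorem mem_cands {L : ℕ} {c : Item} :
    c ∈ cands L ↔ c.1.length = L ∧ c.2.1.length = L ∧ c.2.2 ≤ L := by
  rcases c with ⟨v, u, n⟩
  simp only [cands, List.mem_flatMap, List.mem_map, List.mem_range, mem_allStr]
  constructor
  · rintro ⟨v', h1, u', h2, n', h3, h4⟩
    simp only [Prod.mk.injEq] at h4
    obtain ⟨rfl, rfl, rfl⟩ := h4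
    exact ⟨h1, h2, by omega⟩
  · rintro ⟨h1, h2, h3⟩
    exact ⟨v, h1, u, h2, n, Nat.lt_succ_of_le h3, rfl⟩

/-- the invariant -/
def SelInv (F : List Bool → ℕ → Option Bool) (x : List Bool) (L : ℕ) (acc : List Item) : Prop :=
  (∀ it ∈ acc, GoodItem F x it ∧ it.1.length ≤ L) ∧ acc.Pairwise IncItem

theorem selInv_foldl (L : ℕ) (l : List Item) (hl : ∀ c ∈ l, c ∈ cands L) :
    ∀ acc, SelInv F x L acc → SelInv F x L (l.foldl (selStep F x) acc) := by
  induction l with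
  | nil => intro acc h; exact h
  | cons c l ih =>
    intro acc h
    refine ih (fun d hd => hl d (List.mem_cons_of_mem _ hd)) _ ?_
    have hc := mem_cands.1 (hl c List.mem_cons_self)
    unfold selStep
    split_ifs with hok
    · refine ⟨?_, ?_⟩
      · intro it hit
        rcases List.mem_append.1 hit with hit | hit
        · exact h.1 it hit
        · rw [List.mem_singleton] at hit
          subst hit
          exact ⟨⟨hok.1, hok.2.1, hok.2.2.1, by omega, hok.2.2.2.1, hok.2.2.2.2.1⟩, hc.1.le⟩
      · rw [List.pairwise_append]
        refine ⟨h.2, List.pairwise_singleton _ _, ?_⟩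
        intro it hit d hd
        rw [List.mem_singleton] at hd
        subst hd
        have ho := hok.2.2.2.2.2 it hit
        have hl1 := (h.1 it hit).2
        have hl2 := (h.1 it hit).1.eq
        have key : ∀ a b : List Bool, a.length ≤ L → b.length = L → ¬ a <+: b → Inc a b := by
          intro a b ha hb hab
          refine ⟨hab, fun hba => hab ?_⟩
          have := hba.length_le
          rw [hba.eq_of_length (by omega)]
        exact ⟨key _ _ hl1 hc.1 ho.1, key _ _ hl1 hc.2.1 ho.2.1,
          key _ _ (by omega) hc.1 ho.2.2.1, key _ _ (by omega) hc.2.1 ho.2.2.2⟩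
    · exact h

theorem selInv_sel (L : ℕ) : SelInv F x L (sel F x L) := by
  induction L with
  | zero => exact ⟨by simp [sel], by simp [sel]⟩
  | succ L ih =>
    have h := selInv_foldl L (cands L) (fun c hc => hc) (sel F x L) ih
    exact ⟨fun it hit => ⟨(h.1 it hit).1, (h.1 it hit).2.trans (Nat.le_succ L)⟩, h.2⟩

theorem sel_good {L it} (h : it ∈ sel F x L) : GoodItem F x it := ((selInv_sel L).1 it h).1

theorem sel_inc {L L' it it'} (h : it ∈ sel F x L) (h' : it' ∈ sel F x L') (hne : it ≠ it') :
    IncItem it it' := by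
  have h1 := (sel_mono (F := F) (x := x) (le_max_left L L')).subset h
  have h2 := (sel_mono (F := F) (x := x) (le_max_right L L')).subset h'
  haveI : Std.Symm IncItem := ⟨fun a b hab => hab.symm⟩
  exact (selInv_sel (max L L')).2.forall h1 h2 hne

theorem foldl_mem (l : List Item) (c : Item) (hc : c ∈ l) : ∀ acc,
    ∃ acc', acc' <+: l.foldl (selStep F x) acc ∧ selStep F x acc' c <+: l.foldl (selStep F x) acc := by
  induction l with
  | nil => simp at hc
  | cons d l ih =>
    intro acc
    rcases List.mem_cons.1 hc with rfl | hc
    · exact ⟨acc, foldl_pref (c :: l) acc, foldl_pref l _⟩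
    · exact ih hc _

theorem sel_exhaust {L n : ℕ} {v u : List Bool} (hv : v.length = L) (hu : u.length = L)
    (hn : n ≤ L) (hx : x.length < L) (hxv : x <+: v) (hxu : x <+: u) (fv : F v n = some false)
    (fu : F u n = some true) : ∃ it ∈ sel F x (L+1), it.1 <+: v ∨ it.1 <+: u ∨ it.2.1 <+: v ∨
      it.2.1 <+: u := by
  obtain ⟨acc, h1, h2⟩ := foldl_mem (F := F) (x := x) (cands L) (v, u, n)
    (mem_cands.2 ⟨hv, hu, hn⟩) (sel F x L)
  by_cases hok : selOk F x acc (v, u, n)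
  · refine ⟨(v, u, n), h2.subset ?_, Or.inl List.prefix_rfl⟩
    simp [selStep, hok]
  · by_contra hcon
    push Not at hcon
    refine hok ⟨hxv, hxu, by simp only; omega, fv, fu, fun it hit => ?_⟩
    have := hcon it (h1.subset hit)
    exact this

end sel

/-- the `e`-th c.e. set of strings of numbers -/
def WW (e : ℕ) : Set (List ℕ) :=
  {τ | ((Denumerable.ofNat Nat.Partrec.Code e).eval (Encodable.encode τ)).Dom}

theorem found_spec {e ρ t τ} (h : found e ρ t = some τ) : ρ <+: τ ∧ τ ∈ WW e := by
  obtain ⟨j, _, hj, _⟩ := bsearch_eq_some.1 h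
  unfold foundP at hj
  rw [Option.bind_eq_some_iff] at hj
  obtain ⟨τ', _, h2⟩ := hj
  split_ifs at h2 with hc
  obtain rfl : τ' = τ := by simpa using h2
  refine ⟨hc.1, ?_⟩
  obtain ⟨a, ha⟩ := Option.isSome_iff_exists.1 hc.2
  exact Part.dom_iff_mem.2 ⟨a, Nat.Partrec.Code.evaln_sound ha⟩

theorem found_mono {e ρ t t' τ} (ht : t ≤ t') (h : found e ρ t = some τ) :
    found e ρ t' = some τ := bsearch_mono ht h

theorem found_none {e ρ} (h : ∀ t, found e ρ t = none) {τ} (hτ : ρ <+: τ) : τ ∉ WW e := by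
  intro hW
  obtain ⟨a, ha⟩ := Part.dom_iff_mem.1 hW
  obtain ⟨n, hn⟩ := Nat.Partrec.Code.evaln_complete.1 ha
  have := bsearch_eq_none.1 (h (Nat.pair (Encodable.encode τ) n + 1)) _ (Nat.lt_succ_self _)
  unfold foundP at this
  simp only [Nat.unpair_pair, Encodable.encodek, Option.bind_some] at this
  rw [if_pos ⟨hτ, Option.isSome_iff_exists.2 ⟨a, hn⟩⟩] at this
  simp at this

section children
variable {F : List Bool → ℕ → Option Bool} {k : ℕ}

/-- description of item children -/
def IsItemCh (k t : ℕ) (st : St) (it : Item) (c : St) : Prop :=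
  c = vChild st it ∨ ∃ z : List Bool, z.length = sid st + k + 1 ∧
    ((¬ (∀ b ∈ z, b = false) ∧ c = nChild st (it.2.1 ++ z)) ∨
    ((∀ b ∈ z, b = false) ∧ ∃ τ, found (sid st) (st.2.1 ++ [it.2.2 + 1]) t = some τ ∧
      c = uChild st τ (it.2.1 ++ z)))

theorem mem_itemCh {t st it c} : c ∈ itemCh k t st it ↔ IsItemCh k t st it c := by
  unfold itemCh IsItemCh uPart
  rw [List.mem_cons, List.mem_flatMap]
  refine or_congr Iff.rfl (exists_congr fun z => ?_)
  rw [mem_allStr]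
  refine and_congr Iff.rfl ?_
  split_ifs with hz
  · rw [or_iff_right (fun h => h.1 hz), and_iff_right hz]
    cases hf : found (sid st) (st.2.1 ++ [it.2.2 + 1]) t with
    | none => simp
    | some τ => simp
  · rw [or_iff_left (fun h => hz h.1), and_iff_right hz]
    simp

theorem mem_children {t st c} : c ∈ children F k t st ↔
    (attends st ∧ ∃ it ∈ sel F st.1 t, IsItemCh k t st it c) ∨
    (¬ attends st ∧ ∃ b : Bool, c = zChild st (st.1 ++ [b])) := by
  unfold children
  split_ifs with h
  · simp [h, List.mem_flatMap, mem_itemCh]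
  · simp [h]

theorem children_mono {t t' st c} (ht : t ≤ t') (h : c ∈ children F k t st) :
    c ∈ children F k t' st := by
  rw [mem_children] at h ⊢
  rcases h with ⟨ha, it, hit, hc⟩ | h
  · refine Or.inl ⟨ha, it, (sel_mono ht).subset hit, ?_⟩
    rcases hc with hc | ⟨z, hz, hc | ⟨h0, τ, hτ, hc⟩⟩
    · exact Or.inl hc
    · exact Or.inr ⟨z, hz, Or.inl hc⟩
    · exact Or.inr ⟨z, hz, Or.inr ⟨h0, τ, found_mono ht hτ, hc⟩⟩
  · exact Or.inr h

theorem itemCh_pre {t st it c} (h : IsItemCh k t st it c) : it.1 <+: c.1 ∨ it.2.1 <+: c.1 := by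
  rcases h with rfl | ⟨z, -, ⟨-, rfl⟩ | ⟨-, τ, -, rfl⟩⟩
  · exact Or.inl List.prefix_rfl
  · exact Or.inr (List.prefix_append _ _)
  · exact Or.inr (List.prefix_append _ _)

theorem item_unique {x : List Bool} {t t' it it' y} (h : it ∈ sel F x t) (h' : it' ∈ sel F x t')
    (hy : it.1 <+: y ∨ it.2.1 <+: y) (hy' : it'.1 <+: y ∨ it'.2.1 <+: y) : it = it' := by
  by_contra hne
  have := sel_inc h h' hne
  rcases hy with hy | hy <;> rcases hy' with hy' | hy'
  · exact not_inc hy hy' this.1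
  · exact not_inc hy hy' this.2.1
  · exact not_inc hy hy' this.2.2.1
  · exact not_inc hy hy' this.2.2.2

theorem children_unique {t st c c' y} (h : c ∈ children F k t st) (h' : c' ∈ children F k t st)
    (hy : c.1 <+: y) (hy' : c'.1 <+: y) : c = c' := by
  rw [mem_children] at h h'
  rcases h with ⟨ha, it, hit, hc⟩ | ⟨ha, b, rfl⟩
  · rcases h' with ⟨-, it', hit', hc'⟩ | ⟨ha', -⟩
    · obtain rfl : it = it' := item_unique (y := y) hit hit'
        ((itemCh_pre hc).imp (fun h => h.trans hy) (fun h => h.trans hy))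
        ((itemCh_pre hc').imp (fun h => h.trans hy') (fun h => h.trans hy'))
      have hinc := (sel_good hit).inc
      have zz : ∀ z z' : List Bool, z.length = sid st + k + 1 → z'.length = sid st + k + 1 →
          it.2.1 ++ z <+: y → it.2.1 ++ z' <+: y → z = z' := by
        intro z z' hz hz' h1 h2
        have h3 : it.2.1 ++ z = it.2.1 ++ z' := by
          rcases List.prefix_or_prefix_of_prefix h1 h2 with h | h
          · exact h.eq_of_length (by simp [hz, hz'])
          · exact (h.eq_of_length (by simp [hz, hz'])).symm
        exact List.append_cancel_left h3
      have vu : ∀ z : List Bool, it.1 <+: y → it.2.1 ++ z <+: y → False := fun z h1 h2 =>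
        not_inc h1 ((List.prefix_append _ _).trans h2) hinc
      rcases hc with rfl | ⟨z, hz, ⟨h0, rfl⟩ | ⟨h0, τ, hτ, rfl⟩⟩ <;>
      rcases hc' with rfl | ⟨z', hz', ⟨h0', rfl⟩ | ⟨h0', τ', hτ', rfl⟩⟩
      · rfl
      · exact (vu _ hy hy').elim
      · exact (vu _ hy hy').elim
      · exact (vu _ hy' hy).elim
      · rw [zz z z' hz hz' hy hy']
      · rw [zz z z' hz hz' hy hy'] at h0; exact (h0 h0').elim
      · exact (vu _ hy' hy).elim
      · rw [zz z z' hz hz' hy hy'] at h0; exact (h0' h0).elim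
      · rw [hτ] at hτ'
        obtain rfl : τ = τ' := by simpa using hτ'
        rw [zz z z' hz hz' hy hy']
    · exact (ha' ha).elim
  · rcases h' with ⟨ha', -⟩ | ⟨-, b', rfl⟩
    · exact (ha ha').elim
    · have h3 : st.1 ++ [b] = st.1 ++ [b'] := by
        rcases List.prefix_or_prefix_of_prefix hy hy' with h | h
        · exact h.eq_of_length (by simp [zChild])
        · exact (h.eq_of_length (by simp [zChild])).symm
      rw [h3]

theorem next_iff {y st c} : next F k y st = some c ↔
    c ∈ children F k y.length st ∧ c.1 <+: y := by
  unfold next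
  constructor
  · intro h
    have := List.mem_of_mem_head? h
    rw [List.mem_filter] at this
    simpa using this
  · rintro ⟨h1, h2⟩
    have hm : c ∈ (children F k y.length st).filter fun c => c.1 <+: y := by
      rw [List.mem_filter]; simpa using ⟨h1, h2⟩
    cases hh : ((children F k y.length st).filter fun c => c.1 <+: y).head? with
    | none => rw [List.head?_eq_none_iff] at hh; rw [hh] at hm; simp at hm
    | some d =>
      have := List.mem_of_mem_head? hh
      rw [List.mem_filter] at this
      rw [children_unique h1 this.1 h2 (by simpa using this.2)]

/-- basic facts about children -/
theorem child_facts {t st c} (h : c ∈ children F k t st) :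
    st.1 <+: c.1 ∧ st.1.length < c.1.length ∧ st.2.1 <+: c.2.1 ∧
    st.2.1.length < c.2.1.length ∧ ∃ i ρ, c.2.2 = st.2.2 ++ [(sid st, i, ρ)] ∧
      (attends st ↔ i ≠ 3) := by
  rw [mem_children] at h
  rcases h with ⟨ha, it, hit, hc⟩ | ⟨ha, b, rfl⟩
  · have hg := sel_good hit
    rcases hc with rfl | ⟨z, hz, ⟨h0, rfl⟩ | ⟨h0, τ, hτ, rfl⟩⟩
    · refine ⟨hg.pv, hg.lt, ?_, ?_, 1, _, rfl, by simp [ha]⟩ <;> simp [vChild]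
    · refine ⟨hg.pu.trans (List.prefix_append _ _), ?_, ?_, ?_, 0, _, rfl, by simp [ha]⟩
      · have := hg.lt; have := hg.eq; simp [nChild]; omega
      all_goals simp [nChild]
    · have hp := (found_spec hτ).1
      have hp2 : st.2.1 <+: τ := (List.prefix_append _ _).trans hp
      refine ⟨hg.pu.trans (List.prefix_append _ _), ?_, ?_, ?_, 2, _, rfl, by simp [ha]⟩
      · have := hg.lt; have := hg.eq; simp [uChild]; omega
      · exact hp2.trans (List.prefix_append _ _)
      · have := hp2.length_le; simp [uChild]; omega
  · refine ⟨List.prefix_append _ _, ?_, List.prefix_append _ _, ?_, 3, _, rfl, by simp [ha]⟩ <;>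
    simp [zChild]

theorem run_succ (y s) : run F k y (s+1) = (run F k y s).bind (next F k y) := rfl

theorem run_facts {y s st} (h : run F k y s = some st) :
    st.2.2.length = s ∧ st.1 <+: y ∧ s ≤ st.2.1.length := by
  induction s generalizing st with
  | zero =>
    obtain rfl : root = st := by simpa [run] using h
    simp [root]
  | succ s ih =>
    rw [run_succ, Option.bind_eq_some_iff] at h
    obtain ⟨st0, h0, h1⟩ := h
    have h1 := next_iff.1 h1
    obtain ⟨_, _, _, h4, i, ρ, h5, _⟩ := child_facts h1.1
    obtain ⟨a, b, c⟩ := ih h0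
    exact ⟨by rw [h5]; simp [a], h1.2, by omega⟩

theorem run_transfer {y y' s st} (h : run F k y s = some st) (hy : st.1 <+: y')
    (hl : y.length ≤ y'.length) : run F k y' s = some st := by
  induction s generalizing st with
  | zero => exact h
  | succ s ih =>
    rw [run_succ, Option.bind_eq_some_iff] at h ⊢
    obtain ⟨st0, h0, h1⟩ := h
    have h1 := next_iff.1 h1
    have h2 := child_facts h1.1
    exact ⟨st0, ih h0 (h2.1.trans hy), next_iff.2 ⟨children_mono hl h1.1, hy⟩⟩

/-- the trajectory of `X` -/
def Tr (F : List Bool → ℕ → Option Bool) (k : ℕ) (X : ℕ → Bool) (s : ℕ) (st : St) : Prop :=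
  ∃ m, run F k (restr X m) s = some st

variable {X Y : ℕ → Bool} {s : ℕ} {st : St}

theorem Tr.mem (h : Tr F k X s st) : X ∈ cyl st.1 := by
  obtain ⟨m, h⟩ := h
  have := (run_facts h).2.1
  refine (mem_cyl_iff_pref (m := m) ?_).2 this
  simpa using this.length_le

theorem Tr.len (h : Tr F k X s st) : st.2.2.length = s := by
  obtain ⟨m, h⟩ := h; exact (run_facts h).1

theorem Tr.le (h : Tr F k X s st) : s ≤ st.2.1.length := by
  obtain ⟨m, h⟩ := h; exact (run_facts h).2.2

theorem Tr.transfer (h : Tr F k X s st) (hY : Y ∈ cyl st.1) : Tr F k Y s st := by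
  obtain ⟨m, h⟩ := h
  refine ⟨max m st.1.length, run_transfer h ?_ (by simp)⟩
  exact (mem_cyl_iff_pref (le_max_right _ _)).1 hY

theorem Tr.run_mono {m m'} (h : run F k (restr X m) s = some st) (hm : m ≤ m') :
    run F k (restr X m') s = some st :=
  run_transfer h ((run_facts h).2.1.trans (restr_pref X hm)) (by simpa using hm)

theorem Tr.unique {st'} (h : Tr F k X s st) (h' : Tr F k X s st') : st = st' := by
  obtain ⟨m, h⟩ := h
  obtain ⟨m', h'⟩ := h'
  have h1 := Tr.run_mono h (le_max_left m m')
  have h2 := Tr.run_mono h' (le_max_right m m')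
  rw [h1] at h2; simpa using h2

theorem Tr.pred {c} (h : Tr F k X (s+1) c) : ∃ st t, Tr F k X s st ∧ c ∈ children F k t st := by
  obtain ⟨m, h⟩ := h
  rw [run_succ, Option.bind_eq_some_iff] at h
  obtain ⟨st0, h0, h1⟩ := h
  exact ⟨st0, _, ⟨m, h0⟩, (next_iff.1 h1).1⟩

theorem Tr.child {c t} (h : Tr F k X s st) (hc : c ∈ children F k t st) (hX : X ∈ cyl c.1) :
    Tr F k X (s+1) c := by
  obtain ⟨m, h⟩ := h
  refine ⟨max (max m t) c.1.length, ?_⟩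
  rw [run_succ, Option.bind_eq_some_iff]
  refine ⟨st, Tr.run_mono h ((le_max_left m t).trans (le_max_left _ _)), next_iff.2 ⟨?_, ?_⟩⟩
  · exact children_mono (by rw [restr_length]; exact (le_max_right m t).trans (le_max_left _ _)) hc
  · exact (mem_cyl_iff_pref (le_max_right _ _)).1 hX

theorem Tr.root : Tr F k X 0 root := ⟨0, rfl⟩

theorem Tr.prev {s'} (h : Tr F k X s' st) (hs : s ≤ s') : ∃ st0, Tr F k X s st0 ∧
    st0.1 <+: st.1 ∧ st0.2.1 <+: st.2.1 ∧ st0.2.2 <+: st.2.2 := by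
  induction hs generalizing st with
  | refl => exact ⟨st, h, List.prefix_rfl, List.prefix_rfl, List.prefix_rfl⟩
  | step _ ih =>
    obtain ⟨st1, t, h1, hc⟩ := h.pred
    obtain ⟨st0, h0, a, b, d⟩ := ih h1
    obtain ⟨p1, -, p2, -, i, ρ, p3, -⟩ := child_facts hc
    exact ⟨st0, h0, a.trans p1, b.trans p2, d.trans (p3 ▸ List.prefix_append _ _)⟩

theorem Tr.mono {s' st'} (h : Tr F k X s st) (h' : Tr F k X s' st') (hs : s ≤ s') :
    st.1 <+: st'.1 ∧ st.2.1 <+: st'.2.1 ∧ st.2.2 <+: st'.2.2 := by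
  obtain ⟨st0, h0, h1⟩ := h'.prev hs
  rw [h.unique h0]; exact h1

/-- number of times that requirement `e` acted -/
def acts (e : ℕ) (h : List Ent) : ℕ := h.countP fun q => q.1 = e ∧ q.2.1 ≠ 3

theorem acts_mono {e} {h h' : List Ent} (hh : h <+: h') : acts e h ≤ acts e h' :=
  List.Sublist.countP_le hh.sublist

theorem acts_child {e c t} (hc : c ∈ children F k t st) :
    acts e c.2.2 = acts e st.2.2 + if attends st ∧ sid st = e then 1 else 0 := by
  obtain ⟨-, -, -, -, i, ρ, p3, p4⟩ := child_facts hc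
  rw [p3, acts, List.countP_append]
  congr 1
  rw [List.countP_singleton]
  simp only [p4, and_comm, decide_eq_true_eq]

theorem acts_reach {e j} (h : Tr F k X s st) (hj : j < acts e st.2.2) :
    ∃ s0 st0, s0 < s ∧ Tr F k X s0 st0 ∧ attends st0 ∧ sid st0 = e ∧ acts e st0.2.2 = j := by
  induction s generalizing st with
  | zero =>
    rw [h.unique Tr.root] at hj; simp [TypicalDegree.root, acts] at hj
  | succ s ih =>
    obtain ⟨st1, t, h1, hc⟩ := h.pred
    by_cases hlt : j < acts e st1.2.2
    · obtain ⟨s0, st0, a, b⟩ := ih h1 hlt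
      exact ⟨s0, st0, by omega, b⟩
    · rw [acts_child hc] at hj
      split_ifs at hj with hif
      · exact ⟨s, st1, by omega, h1, hif.1, hif.2, by omega⟩
      · omega

end children

end Part6

section Part7
section meas
open MeasureTheory

/-! ### Measure estimates for the construction -/

theorem sum_density {ι : Type*} [Countable ι] (P : ι → Set (ℕ → Bool))
    (hm : ∀ i, MeasurableSet (P i)) (hd : Pairwise (Function.onFun Disjoint P))
    (T : Set (ℕ → Bool)) (hT : T ⊆ ⋃ i, P i) (δ : ℝ≥0∞)
    (h : ∀ i, coin (T ∩ P i) + δ * coin (P i) ≤ coin (P i)) :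
    coin T + δ * coin (⋃ i, P i) ≤ coin (⋃ i, P i) := by
  have h1 : coin T ≤ ∑' i, coin (T ∩ P i) := by
    refine le_trans (measure_mono ?_) (measure_iUnion_le _)
    intro X hX
    obtain ⟨i, hi⟩ := Set.mem_iUnion.1 (hT hX)
    exact Set.mem_iUnion.2 ⟨i, hX, hi⟩
  rw [measure_iUnion hd hm]
  calc coin T + δ * ∑' i, coin (P i) ≤ ∑' i, coin (T ∩ P i) + ∑' i, δ * coin (P i) := by
        rw [ENNReal.tsum_mul_left]; gcongr
    _ = ∑' i, (coin (T ∩ P i) + δ * coin (P i)) := ENNReal.tsum_add.symm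
    _ ≤ _ := ENNReal.tsum_le_tsum h

variable {F : List Bool → ℕ → Option Bool} {k : ℕ}

/-- zeros -/
def zs (r : ℕ) : List Bool := (List.range r).map fun _ => false

@[simp] theorem zs_length (r) : (zs r).length = r := by simp [zs]

theorem zs_false (r) : ∀ b ∈ zs r, b = false := by
  intro b hb; simp [zs] at hb; exact hb.2

theorem eq_zs {z : List Bool} (h : ∀ b ∈ z, b = false) : z = zs z.length := by
  rw [List.eq_replicate_of_mem h]; simp [zs]

theorem Tr.vch {X s st it t} (h : Tr F k X s st) (ha : attends st) (hit : it ∈ sel F st.1 t)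
    (hX : X ∈ cyl it.1) : Tr F k X (s+1) (vChild st it) :=
  h.child (mem_children.2 (Or.inl ⟨ha, it, hit, Or.inl rfl⟩)) hX

theorem Tr.uch {X s st it t τ} (h : Tr F k X s st) (ha : attends st) (hit : it ∈ sel F st.1 t)
    (hX : X ∈ cyl (it.2.1 ++ zs (sid st + k + 1)))
    (hf : found (sid st) (st.2.1 ++ [it.2.2 + 1]) t = some τ) :
    Tr F k X (s+1) (uChild st τ (it.2.1 ++ zs (sid st + k + 1))) :=
  h.child (mem_children.2 (Or.inl ⟨ha, it, hit, Or.inr ⟨_, zs_length _,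
    Or.inr ⟨zs_false _, τ, hf, rfl⟩⟩⟩)) hX

theorem Tr.nch {X s st it t z} (h : Tr F k X s st) (ha : attends st) (hit : it ∈ sel F st.1 t)
    (hz : z.length = sid st + k + 1) (hz' : ¬ ∀ b ∈ z, b = false)
    (hX : X ∈ cyl (it.2.1 ++ z)) :
    Tr F k X (s+1) (nChild st (it.2.1 ++ z)) :=
  h.child (mem_children.2 (Or.inl ⟨ha, it, hit, Or.inr ⟨_, hz,
    Or.inl ⟨hz', rfl⟩⟩⟩)) hX

theorem block_one {e ρ} {st : St} (hm : (e, 1, ρ) ∈ st.2.2) (hf : ∀ t, found e ρ t = none)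
    (hs : sid st = e) : ¬ attends st := by
  intro ha
  have := ha _ hm hs.symm
  simp [hs, hf] at this

theorem block_two {e ρ} {st : St} (hm : (e, 2, ρ) ∈ st.2.2)
    (hs : sid st = e) : ¬ attends st := by
  intro ha
  have := ha _ hm hs.symm
  simp at this

/-- the dead part for `e` -/
def deadE (F : List Bool → ℕ → Option Bool) (k e : ℕ) : Set (ℕ → Bool) :=
  {X | ∃ s st it t, Tr F k X s st ∧ attends st ∧ sid st = e ∧ it ∈ sel F st.1 t ∧
    X ∈ cyl (it.2.1 ++ zs (e + k + 1)) ∧ ∀ v, found e (st.2.1 ++ [it.2.2 + 1]) v = none}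

theorem deadE_le (e : ℕ) : coin (deadE F k e) ≤ 2⁻¹ ^ (e + k + 1) := by
  let ι := {p : St × Item // (∃ X s, Tr F k X s p.1) ∧ attends p.1 ∧ sid p.1 = e ∧
    (∃ t, p.2 ∈ sel F p.1.1 t) ∧ ∀ v, found e (p.1.2.1 ++ [p.2.2.2 + 1]) v = none}
  have hsub : deadE F k e ⊆ ⋃ i : ι, cyl (i.1.2.2.1 ++ zs (e + k + 1)) := by
    rintro X ⟨s, st, it, t, h1, h2, h3, h4, h5, h6⟩
    exact Set.mem_iUnion.2 ⟨⟨(st, it), ⟨X, s, h1⟩, h2, h3, ⟨t, h4⟩, h6⟩, h5⟩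
  have hlt : ∀ (i j : ι) (X s s'), Tr F k X s i.1.1 → Tr F k X s' j.1.1 → X ∈ cyl i.1.2.1 →
      ¬ s < s' := by
    intro i j X s s' hi hj hX hss
    have h2 := i.2.2.1
    have h3 := i.2.2.2.1
    obtain ⟨t, h4⟩ := i.2.2.2.2.1
    have h5 := i.2.2.2.2.2
    generalize i.1.1 = st at *
    generalize i.1.2 = it at *
    have hv := hi.vch h2 h4 hX
    have hp := (hv.mono hj hss).2.2
    refine block_one (e := e) (ρ := st.2.1 ++ [it.2.2 + 1]) (hp.subset ?_) h5 j.2.2.2.1 j.2.2.1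
    simp [vChild, h3]
  have hd : Pairwise (Function.onFun Disjoint fun i : ι => cyl i.1.2.1) := by
    intro i j hij
    refine Set.disjoint_left.2 fun X hi hj => hij ?_
    obtain ⟨Xi, s, hs⟩ := i.2.1
    obtain ⟨Xj, s', hs'⟩ := j.2.1
    obtain ⟨t, ht⟩ := i.2.2.2.2.1
    obtain ⟨t', ht'⟩ := j.2.2.2.2.1
    have hs := hs.transfer (cyl_anti (sel_good ht).pv hi)
    have hs' := hs'.transfer (cyl_anti (sel_good ht').pv hj)
    have e1 : s = s' := le_antisymm (not_lt.1 (hlt j i X s' s hs' hs hj))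
      (not_lt.1 (hlt i j X s s' hs hs' hi))
    subst e1
    have e2 := hs.unique hs'
    rw [← e2] at ht'
    have e3 : i.1.2 = j.1.2 := by
      refine item_unique (y := restr X (max i.1.2.1.length j.1.2.1.length)) ht ht' ?_ ?_
      · exact Or.inl ((mem_cyl_iff_pref (le_max_left _ _)).1 hi)
      · exact Or.inl ((mem_cyl_iff_pref (le_max_right _ _)).1 hj)
    exact Subtype.ext (Prod.ext e2 e3)
  calc coin (deadE F k e) ≤ ∑' i : ι, coin (cyl (i.1.2.2.1 ++ zs (e + k + 1))) :=
        (measure_mono hsub).trans (measure_iUnion_le _)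
    _ = ∑' i : ι, 2⁻¹ ^ (e + k + 1) * coin (cyl i.1.2.1) := by
        refine tsum_congr fun i => ?_
        obtain ⟨t, ht⟩ := i.2.2.2.2.1
        rw [coin_cyl, coin_cyl, ← pow_add, List.length_append, zs_length, (sel_good ht).eq]
        congr 1; omega
    _ = 2⁻¹ ^ (e + k + 1) * coin (⋃ i : ι, cyl i.1.2.1) := by
        rw [ENNReal.tsum_mul_left, measure_iUnion hd fun i => meas_cyl _]
    _ ≤ 2⁻¹ ^ (e + k + 1) * 1 := by gcongr; exact prob_le_one
    _ = _ := mul_one _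

theorem dead_le : coin (⋃ e, deadE F k e) ≤ 2⁻¹ ^ k := by
  refine (measure_iUnion_le _).trans ?_
  calc ∑' e, coin (deadE F k e) ≤ ∑' e, 2⁻¹ ^ k * 2⁻¹ ^ (e + 1) :=
        ENNReal.tsum_le_tsum fun e => (deadE_le e).trans (le_of_eq (by rw [← pow_add]; congr 1; omega))
    _ = 2⁻¹ ^ k := by
        rw [ENNReal.tsum_mul_left]
        have : ∑' e : ℕ, (2⁻¹ : ℝ≥0∞) ^ (e + 1) = 1 := by
          rw [ENNReal.tsum_geometric_add_one, ENNReal.one_sub_inv_two, inv_inv,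
            ENNReal.inv_mul_cancel (by simp) (by simp)]
        rw [this, mul_one]

/-- the set of those sequences which act for `e` at least `j+1` times -/
def actE (F : List Bool → ℕ → Option Bool) (k e j : ℕ) : Set (ℕ → Bool) :=
  {X | ∃ s st, Tr F k X s st ∧ attends st ∧ sid st = e ∧ acts e st.2.2 = j}

theorem actE_step (e j : ℕ) :
    coin (actE F k e (j+1)) ≤ (1 - 2⁻¹ ^ (e + k + 2)) * coin (actE F k e j) := by
  let ι := {p : St × Item // (∃ X s, Tr F k X s p.1) ∧ attends p.1 ∧ sid p.1 = e ∧
    (∃ t, p.2 ∈ sel F p.1.1 t) ∧ acts e p.1.2.2 = j}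
  let P : ι → Set (ℕ → Bool) := fun i => cyl i.1.2.1 ∪ cyl i.1.2.2.1
  have hPst : ∀ i : ι, P i ⊆ cyl i.1.1.1 := by
    intro i
    obtain ⟨t, ht⟩ := i.2.2.2.2.1
    exact Set.union_subset (cyl_anti (sel_good ht).pv) (cyl_anti (sel_good ht).pu)
  have hPtr : ∀ i : ι, ∃ s, ∀ X ∈ P i, Tr F k X s i.1.1 := by
    intro i
    obtain ⟨Xi, s, hs⟩ := i.2.1
    exact ⟨s, fun X hX => hs.transfer (hPst i hX)⟩
  have hPE : (⋃ i, P i) ⊆ actE F k e j := by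
    intro X hX
    obtain ⟨i, hi⟩ := Set.mem_iUnion.1 hX
    obtain ⟨s, hs⟩ := hPtr i
    exact ⟨s, i.1.1, hs X hi, i.2.2.1, i.2.2.2.1, i.2.2.2.2.2⟩
  have hget : ∀ X s st s' st', Tr F k X s st → Tr F k X s' st' → s < s' → attends st →
      ∃ c t it, Tr F k X (s+1) c ∧ c ∈ children F k t st ∧ it ∈ sel F st.1 t ∧ 
      (X ∈ cyl it.1 ∨ X ∈ cyl it.2.1) := by
    intro X s st s' st' h h' hss ha
    obtain ⟨c, hc, -⟩ := h'.prev (s := s+1) hss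
    obtain ⟨st0, t, h0, hc0⟩ := hc.pred
    obtain rfl := h.unique h0
    have hc1 := hc0
    rw [mem_children] at hc0
    rcases hc0 with ⟨-, it, hit, hc2⟩ | ⟨hn, -⟩
    · exact ⟨c, t, it, hc, hc1, hit, (itemCh_pre hc2).imp (fun h => cyl_anti h hc.mem)
        (fun h => cyl_anti h hc.mem)⟩
    · exact (hn ha).elim
  have hlt : ∀ X s st s' st', Tr F k X s st → Tr F k X s' st' → s < s' → attends st → sid st = e →
      acts e st.2.2 < acts e st'.2.2 := by
    intro X s st s' st' h h' hss ha hsd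
    obtain ⟨c, t, it, hc, hc1, -⟩ := hget X s st s' st' h h' hss ha
    have := acts_child (e := e) hc1
    rw [if_pos ⟨ha, hsd⟩] at this
    have := acts_mono (e := e) (hc.mono h' hss).2.2
    omega
  have hd : Pairwise (Function.onFun Disjoint P) := by
    intro i j' hij
    refine Set.disjoint_left.2 fun X hi hj => hij ?_
    obtain ⟨s, hs⟩ := hPtr i
    obtain ⟨s', hs'⟩ := hPtr j'
    obtain ⟨t, ht⟩ := i.2.2.2.2.1
    obtain ⟨t', ht'⟩ := j'.2.2.2.2.1
    have a1 := i.2.2.2.2.2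
    have a2 := j'.2.2.2.2.2
    have hs := hs X hi
    have hs' := hs' X hj
    have e1 : s = s' := by
      rcases lt_trichotomy s s' with h | h | h
      · have := hlt _ _ _ _ _ hs hs' h i.2.2.1 i.2.2.2.1; omega
      · exact h
      · have := hlt _ _ _ _ _ hs' hs h j'.2.2.1 j'.2.2.2.1; omega
    subst e1
    have e2 := hs.unique hs'
    rw [← e2] at ht'
    have g1 := (sel_good ht).eq
    have g2 := (sel_good ht').eq
    have e3 : i.1.2 = j'.1.2 := by
      refine item_unique (y := restr X (max i.1.2.1.length j'.1.2.1.length)) ht ht' ?_ ?_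
      · exact hi.imp (fun h => (mem_cyl_iff_pref (le_max_left _ _)).1 h)
          (fun h => (mem_cyl_iff_pref (by rw [g1]; exact le_max_left _ _)).1 h)
      · exact hj.imp (fun h => (mem_cyl_iff_pref (le_max_right _ _)).1 h)
          (fun h => (mem_cyl_iff_pref (by rw [g2]; exact le_max_right _ _)).1 h)
    exact Subtype.ext (Prod.ext e2 e3)
  have hT : actE F k e (j+1) ⊆ ⋃ i, P i := by
    rintro X ⟨s, st, h1, h2, h3, h4⟩
    obtain ⟨s0, st0, b1, b2, b3, b4, b5⟩ := acts_reach h1 (by rw [h4]; exact Nat.lt_succ_self j)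
    obtain ⟨c, t, it, hc, hc1, hit, hX⟩ := hget X s0 st0 s st b2 h1 b1 b3
    exact Set.mem_iUnion.2 ⟨⟨(st0, it), ⟨X, s0, b2⟩, b3, b4, ⟨t, hit⟩, b5⟩, hX⟩
  have hw : ∀ i : ι, ∃ w : List Bool, cyl w ⊆ P i ∧ w.length ≤ i.1.2.1.length + (e + k + 1) ∧
      Disjoint (actE F k e (j+1)) (cyl w) := by
    intro i
    obtain ⟨s, hs⟩ := hPtr i
    have h2 := i.2.2.1
    have h3 := i.2.2.2.1
    obtain ⟨t, h4⟩ := i.2.2.2.2.1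
    have h5 := i.2.2.2.2.2
    simp only [P] at hs ⊢
    generalize i.1.1 = st at *
    generalize i.1.2 = it at *
    have hss : ∀ X s' st', Tr F k X s st → Tr F k X s' st' → acts e st'.2.2 = j + 1 → s < s' := by
      intro X s' st' h h' ha
      by_contra hcon
      have := acts_mono (e := e) (h'.mono h (not_lt.1 hcon)).2.2
      omega
    by_cases hf : ∃ v τ, found e (st.2.1 ++ [it.2.2 + 1]) v = some τ
    · obtain ⟨v, τ, hv⟩ := hf
      have hsubw : cyl (it.2.1 ++ zs (e + k + 1)) ⊆ cyl it.2.1 := cyl_anti (List.prefix_append _ _)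
      refine ⟨it.2.1 ++ zs (e + k + 1), hsubw.trans Set.subset_union_right, ?_, ?_⟩
      · simp [(sel_good h4).eq]
      · refine Set.disjoint_left.2 ?_
        rintro X ⟨s', st', c1, c2, c3, c4⟩ hX
        have hTr := hs X (Or.inr (hsubw hX))
        have hlt' := hss X s' st' hTr c1 c4
        have hv' : found (sid st) (st.2.1 ++ [it.2.2 + 1]) (max t v) = some τ := by
          rw [h3]; exact found_mono (le_max_right _ _) hv
        have := hTr.uch h2 ((sel_mono (le_max_left t v)).subset h4) (by rw [h3]; exact hX) hv'
        have hp := (this.mono c1 hlt').2.2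
        refine block_two (e := e) (ρ := []) (hp.subset ?_) c3 c2
        simp [uChild, h3]
    · refine ⟨it.1, Set.subset_union_left, by simp, ?_⟩
      refine Set.disjoint_left.2 ?_
      rintro X ⟨s', st', c1, c2, c3, c4⟩ hX
      have hTr := hs X (Or.inl hX)
      have hlt' := hss X s' st' hTr c1 c4
      have hp := ((hTr.vch h2 h4 hX).mono c1 hlt').2.2
      refine block_one (e := e) (ρ := st.2.1 ++ [it.2.2 + 1]) (hp.subset ?_) ?_ c3 c2
      · simp [vChild, h3]
      · intro v
        push Not at hf
        exact Option.eq_none_iff_forall_ne_some.2 (hf v)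
  have hm : ∀ i, MeasurableSet (P i) := fun i => (meas_cyl _).union (meas_cyl _)
  have key := sum_density P hm hd (actE F k e (j+1)) hT (2⁻¹ ^ (e + k + 2)) (by
    intro i
    obtain ⟨w, w1, w2, w3⟩ := hw i
    obtain ⟨t, ht⟩ := i.2.2.2.2.1
    have q1 : coin (P i) ≤ 2 * 2⁻¹ ^ i.1.2.1.length := by
      refine (measure_union_le _ _).trans ?_
      rw [coin_cyl, coin_cyl, (sel_good ht).eq, two_mul]
    have q2 : (2⁻¹ : ℝ≥0∞) ^ (e + k + 2) * coin (P i) ≤ coin (cyl w) := by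
      calc (2⁻¹ : ℝ≥0∞) ^ (e + k + 2) * coin (P i)
          ≤ 2⁻¹ ^ (e + k + 2) * (2 * 2⁻¹ ^ i.1.2.1.length) := by gcongr
        _ = (2⁻¹ * 2) * 2⁻¹ ^ (i.1.2.1.length + (e + k + 1)) := by ring
        _ = 2⁻¹ ^ (i.1.2.1.length + (e + k + 1)) := by
            rw [ENNReal.inv_mul_cancel (by simp) (by simp), one_mul]
        _ ≤ 2⁻¹ ^ w.length := pow_le_pow_right_of_le_one' (by simp) w2
        _ = _ := (coin_cyl _).symm
    calc _ ≤ coin (actE F k e (j+1) ∩ P i) + coin (cyl w) := by gcongr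
      _ = coin ((actE F k e (j+1) ∩ P i) ∪ cyl w) :=
          (measure_union (w3.mono_left Set.inter_subset_left) (meas_cyl _)).symm
      _ ≤ coin (P i) := measure_mono (Set.union_subset Set.inter_subset_right w1))
  calc coin (actE F k e (j+1)) ≤ coin (⋃ i, P i) - 2⁻¹ ^ (e + k + 2) * coin (⋃ i, P i) :=
        ENNReal.le_sub_of_add_le_right (ENNReal.mul_ne_top (by simp) (measure_ne_top _ _)) key
    _ = (1 - 2⁻¹ ^ (e + k + 2)) * coin (⋃ i, P i) := by
        rw [ENNReal.sub_mul (fun _ _ => measure_ne_top _ _), one_mul]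
    _ ≤ _ := by gcongr

theorem actE_le (e j : ℕ) : coin (actE F k e j) ≤ (1 - 2⁻¹ ^ (e + k + 2)) ^ j := by
  induction j with
  | zero => simpa using prob_le_one
  | succ j ih =>
    refine (actE_step e j).trans ?_
    rw [pow_succ' _ j]
    gcongr

end meas

end Part7

section Part8
/-! ### The two randomness tests -/

section tests
variable {F : List Bool → ℕ → Option Bool}

/-- the test function for the dead part -/
def deadIt (k : ℕ) (y : List Bool) (v : ℕ) (st : St) (it : Item) : Option Unit :=
  if attends st ∧ it.2.1 ++ zs (sid st + k + 1) <+: y ∧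
    found (sid st) (st.2.1 ++ [it.2.2 + 1]) v = none then some () else none

theorem primrec_zs : Primrec zs :=
  Primrec.list_map Primrec.list_range (Primrec₂.const false)

theorem primrec_deadIt : Primrec fun q : ℕ × List Bool × ℕ × St × Item =>
    deadIt q.1 q.2.1 q.2.2.1 q.2.2.2.1 q.2.2.2.2 := by
  have hy : Primrec fun q : ℕ × List Bool × ℕ × St × Item => q.2.1 := Primrec.fst.comp Primrec.snd
  have hv : Primrec fun q : ℕ × List Bool × ℕ × St × Item => q.2.2.1 :=
    Primrec.fst.comp (Primrec.snd.comp Primrec.snd)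
  have hst : Primrec fun q : ℕ × List Bool × ℕ × St × Item => q.2.2.2.1 :=
    Primrec.fst.comp (Primrec.snd.comp (Primrec.snd.comp Primrec.snd))
  have hit : Primrec fun q : ℕ × List Bool × ℕ × St × Item => q.2.2.2.2 :=
    Primrec.snd.comp (Primrec.snd.comp (Primrec.snd.comp Primrec.snd))
  have hsid : Primrec fun q : ℕ × List Bool × ℕ × St × Item => sid q.2.2.2.1 := by
    have := Primrec.comp primrec_sid hst
    exact this
  have hr : Primrec fun q : ℕ × List Bool × ℕ × St × Item => sid q.2.2.2.1 + q.1 + 1 := by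
    have := Primrec.succ.comp (Primrec.nat_add.comp hsid Primrec.fst)
    exact this
  have hz : Primrec fun q : ℕ × List Bool × ℕ × St × Item => zs (sid q.2.2.2.1 + q.1 + 1) := by
    have := Primrec.comp primrec_zs hr
    exact this
  have huz : Primrec fun q : ℕ × List Bool × ℕ × St × Item =>
      q.2.2.2.2.2.1 ++ zs (sid q.2.2.2.1 + q.1 + 1) := by
    have := Primrec.list_append.comp (Primrec.fst.comp (Primrec.snd.comp hit)) hz
    exact this
  have hρ : Primrec fun q : ℕ × List Bool × ℕ × St × Item =>
      q.2.2.2.1.2.1 ++ [q.2.2.2.2.2.2 + 1] := by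
    have := Primrec.list_concat.comp (Primrec.fst.comp (Primrec.snd.comp hst))
      (Primrec.succ.comp (Primrec.snd.comp (Primrec.snd.comp hit)))
    exact this
  have hf : Primrec fun q : ℕ × List Bool × ℕ × St × Item =>
      found (sid q.2.2.2.1) (q.2.2.2.1.2.1 ++ [q.2.2.2.2.2.2 + 1]) q.2.2.1 := by
    have := Primrec.comp primrec_found (Primrec.pair hsid (Primrec.pair hρ hv))
    exact this
  have h1 := primrec_attends.comp hst
  have h2 := PrimrecRel.comp primrec_pref huz hy
  have h3 : PrimrecPred fun q : ℕ × List Bool × ℕ × St × Item =>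
      found (sid q.2.2.2.1) (q.2.2.2.1.2.1 ++ [q.2.2.2.2.2.2 + 1]) q.2.2.1 = none := by
    have := PrimrecRel.comp Primrec.eq hf (Primrec.const none)
    exact this
  unfold deadIt
  exact Primrec.ite (h1.and (h2.and h3)) (Primrec.const _) (Primrec.const _)

/-- the test -/
def deadR (F : List Bool → ℕ → Option Bool) (q : ℕ × List Bool × ℕ × ℕ) : Bool :=
  ((run F q.1 q.2.1 q.2.2.1.unpair.1).bind fun st =>
    (sel F st.1 q.2.2.1.unpair.2.unpair.1)[q.2.2.1.unpair.2.unpair.2]?.bind fun it =>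
      deadIt q.1 q.2.1 q.2.2.2 st it).isSome

theorem primrec_deadR (hF : Primrec₂ F) : Primrec (deadR F) := by
  have hw : Primrec fun q : ℕ × List Bool × ℕ × ℕ => q.2.2.1.unpair := by
    have := Primrec.unpair.comp (Primrec.fst.comp (Primrec.snd.comp
      (Primrec.snd : Primrec fun q : ℕ × List Bool × ℕ × ℕ => q.2)))
    exact this
  have hw2 : Primrec fun q : ℕ × List Bool × ℕ × ℕ => q.2.2.1.unpair.2.unpair := by
    have := Primrec.unpair.comp (Primrec.snd.comp hw)
    exact this
  have hrun : Primrec fun q : ℕ × List Bool × ℕ × ℕ => run F q.1 q.2.1 q.2.2.1.unpair.1 := by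
    have := Primrec.comp (primrec_run hF) (Primrec.pair 
      (Primrec.fst : Primrec fun q : ℕ × List Bool × ℕ × ℕ => q.1)
      (Primrec.pair (Primrec.fst.comp Primrec.snd) (Primrec.fst.comp hw)))
    exact this
  have hsel : Primrec fun p : (ℕ × List Bool × ℕ × ℕ) × St =>
      sel F p.2.1 p.1.2.2.1.unpair.2.unpair.1 := by
    have := Primrec₂.comp (primrec_sel hF) (Primrec.fst.comp
      (Primrec.snd : Primrec fun p : (ℕ × List Bool × ℕ × ℕ) × St => p.2))
      (Primrec.fst.comp (hw2.comp Primrec.fst))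
    exact this
  have hget : Primrec fun p : (ℕ × List Bool × ℕ × ℕ) × St =>
      (sel F p.2.1 p.1.2.2.1.unpair.2.unpair.1)[p.1.2.2.1.unpair.2.unpair.2]? := by
    have := Primrec.list_getElem?.comp hsel (Primrec.snd.comp (hw2.comp Primrec.fst))
    exact this
  have hin : Primrec fun p : ((ℕ × List Bool × ℕ × ℕ) × St) × Item =>
      ((p.1.1.1, p.1.1.2.1, p.1.1.2.2.2, p.1.2, p.2) : ℕ × List Bool × ℕ × St × Item) := by
    have h0 : Primrec fun p : ((ℕ × List Bool × ℕ × ℕ) × St) × Item => p.1.1 :=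
      Primrec.fst.comp Primrec.fst
    exact Primrec.pair (Primrec.fst.comp h0) (Primrec.pair (Primrec.fst.comp (Primrec.snd.comp h0))
      (Primrec.pair (Primrec.snd.comp (Primrec.snd.comp (Primrec.snd.comp h0)))
        (Primrec.pair (Primrec.snd.comp Primrec.fst) Primrec.snd)))
  have hd : Primrec₂ fun (p : (ℕ × List Bool × ℕ × ℕ) × St) (it : Item) =>
      deadIt p.1.1 p.1.2.1 p.1.2.2.2 p.2 it := by
    have := Primrec.comp primrec_deadIt hin
    exact this
  have hb : Primrec₂ fun (q : ℕ × List Bool × ℕ × ℕ) (st : St) =>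
      (sel F st.1 q.2.2.1.unpair.2.unpair.1)[q.2.2.1.unpair.2.unpair.2]?.bind fun it =>
      deadIt q.1 q.2.1 q.2.2.2 st it := by
    have := Primrec.option_bind hget hd
    exact this
  have := Primrec.option_isSome.comp (Primrec.option_bind hrun hb)
  exact this

theorem deadR_iff (q : ℕ × List Bool × ℕ × ℕ) : deadR F q = true ↔ ∃ st it,
    run F q.1 q.2.1 q.2.2.1.unpair.1 = some st ∧
    (sel F st.1 q.2.2.1.unpair.2.unpair.1)[q.2.2.1.unpair.2.unpair.2]? = some it ∧
    attends st ∧ it.2.1 ++ zs (sid st + q.1 + 1) <+: q.2.1 ∧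
    found (sid st) (st.2.1 ++ [it.2.2 + 1]) q.2.2.2 = none := by
  unfold deadR
  rw [Option.isSome_iff_exists]
  constructor
  · rintro ⟨a, ha⟩
    rw [Option.bind_eq_some_iff] at ha
    obtain ⟨st, h1, h2⟩ := ha
    rw [Option.bind_eq_some_iff] at h2
    obtain ⟨it, h3, h4⟩ := h2
    unfold deadIt at h4
    split_ifs at h4 with h5
    exact ⟨st, it, h1, h3, h5⟩
  · rintro ⟨st, it, h1, h3, h5⟩
    refine ⟨(), ?_⟩
    rw [Option.bind_eq_some_iff]
    refine ⟨st, h1, ?_⟩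
    rw [Option.bind_eq_some_iff]
    refine ⟨it, h3, ?_⟩
    unfold deadIt
    rw [if_pos h5]

theorem exists_dead {A : ℕ → Bool} (hA : TwoRandom A) (hF : Primrec₂ F) :
    ∃ k, ∀ e, A ∉ deadE F k e := by
  have hsub1 : ∀ k, openOf {σ | ∃ w, ∀ v, deadR F (k, σ, w, v) = true} ⊆ ⋃ e, deadE F k e := by
    intro k X hX
    obtain ⟨σ, ⟨w, hw⟩, hX⟩ := mem_openOf.1 hX
    obtain ⟨st, it, h1, h2, h3, h4, -⟩ := (deadR_iff _).1 (hw 0)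
    simp only at h1 h2 h3 h4
    rw [mem_cyl.1 hX] at h1 h4
    refine Set.mem_iUnion.2 ⟨sid st, _, st, it, _, ⟨_, h1⟩, h3, rfl, List.mem_of_getElem? h2, ?_, ?_⟩
    · refine (mem_cyl_iff_pref (m := σ.length) ?_).2 h4
      simpa using h4.length_le
    · intro v
      obtain ⟨st', it', h1', h2', -, -, h5'⟩ := (deadR_iff _).1 (hw v)
      simp only at h1' h2' h5'
      rw [mem_cyl.1 hX, h1] at h1'
      obtain rfl : st = st' := by simpa using h1'
      rw [h2] at h2'
      obtain rfl : it = it' := by simpa using h2'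
      exact h5'
  obtain ⟨k, hk⟩ := test_lemma hA (deadR F) (primrec_deadR hF)
    (fun k => (MeasureTheory.measure_mono (hsub1 k)).trans dead_le)
  refine ⟨k, fun e he => hk ?_⟩
  obtain ⟨s, st, it, t, ⟨m, h1⟩, h2, h3, h4, h5, h6⟩ := he
  obtain ⟨i, hi⟩ := List.mem_iff_getElem?.1 h4
  let M := max m (it.2.1 ++ zs (e + k + 1)).length
  refine mem_openOf.2 ⟨restr A M, ⟨Nat.pair s (Nat.pair t i), fun v => (deadR_iff _).2
    ⟨st, it, ?_, ?_, h2, ?_, ?_⟩⟩, mem_cyl_restr A M⟩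
  · simp only [Nat.unpair_pair]; exact Tr.run_mono h1 (le_max_left _ _)
  · simp only [Nat.unpair_pair]; exact hi
  · rw [h3]; exact (mem_cyl_iff_pref (le_max_right _ _)).1 h5
  · rw [h3]; exact h6 v

/-- the second test -/
def actR (F : List Bool → ℕ → Option Bool) (k e M : ℕ) (q : ℕ × List Bool × ℕ × ℕ) : Bool :=
  ((run F k q.2.1 q.2.2.1).bind fun st =>
    if attends st ∧ sid st = e ∧ acts e st.2.2 = q.1 * M then some () else none).isSome

theorem primrec_acts (e : ℕ) : Primrec (acts e) := by
  have hp : PrimrecPred fun q : Ent => q.1 = e ∧ q.2.1 ≠ 3 :=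
    (PrimrecRel.comp Primrec.eq Primrec.fst (Primrec.const e)).and
      (PrimrecRel.comp Primrec.eq (Primrec.fst.comp Primrec.snd) (Primrec.const 3)).not
  refine (Primrec.list_length.comp (Primrec.listFilter hp)).of_eq fun l => ?_
  rw [acts, List.countP_eq_length_filter]

theorem primrec_actR (hF : Primrec₂ F) (k e M : ℕ) : Primrec (actR F k e M) := by
  have hrun : Primrec fun q : ℕ × List Bool × ℕ × ℕ => run F k q.2.1 q.2.2.1 := by
    have := Primrec.comp (primrec_run hF) (Primrec.pair 
      (Primrec.const k : Primrec fun _ : ℕ × List Bool × ℕ × ℕ => k)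
      (Primrec.pair (Primrec.fst.comp Primrec.snd) (Primrec.fst.comp (Primrec.snd.comp
        Primrec.snd))))
    exact this
  have hacts : Primrec fun p : (ℕ × List Bool × ℕ × ℕ) × St => acts e p.2.2.2 := by
    have := (primrec_acts e).comp (primrec_h.comp
      (Primrec.snd : Primrec fun p : (ℕ × List Bool × ℕ × ℕ) × St => p.2))
    exact this
  have hmul : Primrec fun p : (ℕ × List Bool × ℕ × ℕ) × St => p.1.1 * M := by
    have := Primrec.nat_mul.comp (Primrec.fst.comp Primrec.fst) (Primrec.const M :
      Primrec fun _ : (ℕ × List Bool × ℕ × ℕ) × St => M)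
    exact this
  have h1 : PrimrecPred fun p : (ℕ × List Bool × ℕ × ℕ) × St => attends p.2 :=
    primrec_attends.comp Primrec.snd
  have h2 : PrimrecPred fun p : (ℕ × List Bool × ℕ × ℕ) × St => sid p.2 = e :=
    PrimrecRel.comp Primrec.eq (primrec_sid.comp Primrec.snd) (Primrec.const e)
  have h3 : PrimrecPred fun p : (ℕ × List Bool × ℕ × ℕ) × St => acts e p.2.2.2 = p.1.1 * M :=
    PrimrecRel.comp Primrec.eq hacts hmul
  have hb : Primrec₂ fun (q : ℕ × List Bool × ℕ × ℕ) (st : St) =>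
      if attends st ∧ sid st = e ∧ acts e st.2.2 = q.1 * M then some () else none := by
    have := Primrec.ite (h1.and (h2.and h3)) (Primrec.const (some ())) (Primrec.const none)
    exact this
  have := Primrec.option_isSome.comp (Primrec.option_bind hrun hb)
  exact this

theorem actR_iff {k e M} (q : ℕ × List Bool × ℕ × ℕ) : actR F k e M q = true ↔ ∃ st,
    run F k q.2.1 q.2.2.1 = some st ∧ attends st ∧ sid st = e ∧ acts e st.2.2 = q.1 * M := by
  unfold actR
  rw [Option.isSome_iff_exists]
  constructor
  · rintro ⟨a, ha⟩
    rw [Option.bind_eq_some_iff] at ha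
    obtain ⟨st, h1, h2⟩ := ha
    split_ifs at h2 with h5
    exact ⟨st, h1, h5⟩
  · rintro ⟨st, h1, h5⟩
    refine ⟨(), ?_⟩
    rw [Option.bind_eq_some_iff]
    exact ⟨st, h1, if_pos h5⟩

theorem exists_act {A : ℕ → Bool} (hA : TwoRandom A) (hF : Primrec₂ F) (k e : ℕ) :
    ∃ j, A ∉ actE F k e j := by
  have hδ : (1 - 2⁻¹ ^ (e + k + 2) : ℝ≥0∞) < 1 :=
    ENNReal.sub_lt_self (by simp) (by simp) (by simp)
  obtain ⟨M, hM⟩ : ∃ M : ℕ, (1 - 2⁻¹ ^ (e + k + 2) : ℝ≥0∞) ^ M < 2⁻¹ :=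
    ((ENNReal.tendsto_pow_atTop_nhds_zero_of_lt_one hδ).eventually
      (gt_mem_nhds (by simp : (0 : ℝ≥0∞) < 2⁻¹))).exists
  have heq : ∀ i, openOf {σ | ∃ w, ∀ v, actR F k e M (i, σ, w, v) = true} = actE F k e (i * M) := by
    intro i
    ext X
    rw [mem_openOf]
    constructor
    · rintro ⟨σ, ⟨w, hw⟩, hX⟩
      obtain ⟨st, h1, h2⟩ := (actR_iff _).1 (hw 0)
      simp only at h1 h2
      rw [mem_cyl.1 hX] at h1
      exact ⟨w, st, ⟨_, h1⟩, h2⟩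
    · rintro ⟨s, st, ⟨m, h1⟩, h2⟩
      exact ⟨restr X m, ⟨s, fun v => (actR_iff _).2 ⟨st, h1, h2⟩⟩, mem_cyl_restr X m⟩
  obtain ⟨i, hi⟩ := test_lemma hA (actR F k e M) (primrec_actR hF k e M) (by
    intro i
    rw [heq]
    refine (actE_le _ _).trans ?_
    rw [mul_comm, pow_mul]
    gcongr)
  rw [heq] at hi
  exact ⟨_, hi⟩

end tests

end Part8

section Part9
open MeasureTheory

/-! ### Totality of the trajectory of a random sequence -/

section stuck
variable {F : List Bool → ℕ → Option Bool} {k : ℕ} {A B : ℕ → Bool}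

/-- the stuck predicate -/
def stuckP (F : List Bool → ℕ → Option Bool) (x : List Bool) (n : ℕ) (y : List Bool) : Prop :=
  x <+: y ∧ n ≤ y.length ∧ (∀ it ∈ sel F x n, ¬ it.1 <+: y ∧ ¬ it.2.1 <+: y) ∧
    ∀ i < n, (F y i).isSome = true

instance stuckDec (F x n y) : Decidable (stuckP F x n y) := by
  unfold stuckP; infer_instance

theorem primrec_stuck (hF : Primrec₂ F) (x : List Bool) :
    Primrec₂ fun n y => decide (stuckP F x n y) := by
  have h : PrimrecPred fun p : ℕ × List Bool => stuckP F x p.1 p.2 := by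
    have hn : Primrec fun p : ℕ × List Bool => p.1 := Primrec.fst
    have hy : Primrec fun p : ℕ × List Bool => p.2 := Primrec.snd
    unfold stuckP
    refine (PrimrecRel.comp primrec_pref (Primrec.const x) hy).and ?_
    refine (PrimrecRel.comp Primrec.nat_le hn (Primrec.list_length.comp hy)).and ?_
    refine PrimrecPred.and ?_ ?_
    · have hR : PrimrecRel fun (it : Item) (y : List Bool) => ¬ it.1 <+: y ∧ ¬ it.2.1 <+: y := by
        have h1 : Primrec fun p : Item × List Bool => p.1.1 := Primrec.fst.comp Primrec.fst
        have h2 : Primrec fun p : Item × List Bool => p.1.2.1 :=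
          Primrec.fst.comp (Primrec.snd.comp Primrec.fst)
        exact (PrimrecRel.comp primrec_pref h1 Primrec.snd).not.and
          (PrimrecRel.comp primrec_pref h2 Primrec.snd).not
      have hs : Primrec fun p : ℕ × List Bool => sel F x p.1 := 
        (primrec_sel hF).comp (Primrec.const x) hn
      exact PrimrecRel.comp hR.forall_mem_list hs hy
    · have hR : PrimrecRel fun (i : ℕ) (y : List Bool) => (F y i).isSome = true := by
        have h1 : Primrec fun p : ℕ × List Bool => (F p.2 p.1).isSome :=
          Primrec.option_isSome.comp (hF.comp Primrec.snd Primrec.fst)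
        exact PrimrecRel.comp Primrec.eq h1 (Primrec.const true)
      have := PrimrecRel.comp hR.forall_mem_list (Primrec.list_range.comp hn) hy
      exact this.of_eq fun p => by simp
  exact h.decide

theorem stuckP_mono (mono : ∀ σ τ n v, σ <+: τ → F σ n = some v → F τ n = some v)
    {x : List Bool} {n y y'} (hy : y <+: y') (h : stuckP F x n y) : stuckP F x n y' := by
  obtain ⟨h1, h2, h3, h4⟩ := h
  refine ⟨h1.trans hy, h2.trans hy.length_le, fun it hit => ?_, fun i hi => ?_⟩
  · have hl := ((selInv_sel n).1 it hit)
    have hl2 := hl.1.eq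
    exact ⟨fun hp => (h3 it hit).1 (List.prefix_of_prefix_length_le hp hy (hl.2.trans h2)),
      fun hp => (h3 it hit).2 (List.prefix_of_prefix_length_le hp hy 
        (hl2.le.trans (hl.2.trans h2)))⟩
  · obtain ⟨v, hv⟩ := Option.isSome_iff_exists.1 (h4 i hi)
    rw [mono _ _ _ _ hy hv]; rfl

theorem stuckP_anti {x : List Bool} {n n' y} (hn : n ≤ n') (h : stuckP F x n' y) :
    stuckP F x n y := by
  obtain ⟨h1, h2, h3, h4⟩ := h
  exact ⟨h1, hn.trans h2, fun it hit => h3 it ((sel_mono hn).subset hit),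
    fun i hi => h4 i (hi.trans_le hn)⟩

theorem stuck_noitem (mono : ∀ σ τ n v, σ <+: τ → F σ n = some v → F τ n = some v)
    {x : List Bool} {X : ℕ → Bool} (h : ∀ n, ∃ m, stuckP F x n (restr X m)) {L it}
    (hit : it ∈ sel F x L) (l : ℕ) : ¬ it.1 <+: restr X l ∧ ¬ it.2.1 <+: restr X l := by
  obtain ⟨m, hm⟩ := h L
  have h1 := stuckP_mono mono (restr_pref X (le_max_left m l)) hm
  have h2 := restr_pref X (le_max_right m l)
  exact ⟨fun hp => (h1.2.2.1 it hit).1 (hp.trans h2), fun hp => (h1.2.2.1 it hit).2 (hp.trans h2)⟩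

theorem stuck_agree (mono : ∀ σ τ n v, σ <+: τ → F σ n = some v → F τ n = some v)
    {x : List Bool} {X Y : ℕ → Bool} (hX : ∀ n, ∃ m, stuckP F x n (restr X m))
    (hY : ∀ n, ∃ m, stuckP F x n (restr Y m)) {n m1 m2}
    (fX : F (restr X m1) n = some false) (fY : F (restr Y m2) n = some true) : False := by
  have hxX : ∀ l, x.length ≤ l → x <+: restr X l := by
    intro l hl
    obtain ⟨m, hm⟩ := hX 0
    have := hm.1.trans (restr_pref X (le_max_left m l))
    exact List.prefix_of_prefix_length_le this (restr_pref X (le_max_right m l)) (by simpa using hl)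
  have hxY : ∀ l, x.length ≤ l → x <+: restr Y l := by
    intro l hl
    obtain ⟨m, hm⟩ := hY 0
    have := hm.1.trans (restr_pref Y (le_max_left m l))
    exact List.prefix_of_prefix_length_le this (restr_pref Y (le_max_right m l)) (by simpa using hl)
  obtain ⟨it, hit, h⟩ := sel_exhaust (F := F) (x := x) (L := m1 + m2 + n + x.length + 1) (n := n)
    (v := restr X (m1 + m2 + n + x.length + 1)) (u := restr Y (m1 + m2 + n + x.length + 1))
    (by simp) (by simp) (by omega) (by omega) (hxX _ (by omega)) (hxY _ (by omega))
    (mono _ _ _ _ (restr_pref X (by omega)) fX) (mono _ _ _ _ (restr_pref Y (by omega)) fY)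
  rcases h with h | h | h | h
  · exact (stuck_noitem mono hX hit _).1 h
  · exact (stuck_noitem mono hY hit _).1 h
  · exact (stuck_noitem mono hX hit _).2 h
  · exact (stuck_noitem mono hY hit _).2 h

theorem not_stuck (hA : TwoRandom A) (hF : Primrec₂ F)
    (mono : ∀ σ τ n v, σ <+: τ → F σ n = some v → F τ n = some v)
    (tot : ∀ n, ∃ m, F (restr A m) n = some (B n)) (hB : ¬ ComputableSeq B) (x : List Bool)
    (hx : A ∈ cyl x) : ∃ t, ∃ it ∈ sel F x t, A ∈ cyl it.1 ∨ A ∈ cyl it.2.1 := by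
  by_contra hcon
  push Not at hcon
  have hAs : ∀ n, ∃ m, stuckP F x n (restr A m) := by
    intro n
    have h4 : ∃ m, ∀ i < n, (F (restr A m) i).isSome = true := by
      induction n with
      | zero => exact ⟨0, by simp⟩
      | succ n ih =>
        obtain ⟨m, hm⟩ := ih
        obtain ⟨m', hm'⟩ := tot n
        refine ⟨max m m', fun i hi => ?_⟩
        rcases Nat.lt_succ_iff_lt_or_eq.1 hi with hi | rfl
        · obtain ⟨v, hv⟩ := Option.isSome_iff_exists.1 (hm i hi)
          rw [mono _ _ _ _ (restr_pref A (le_max_left m m')) hv]; rfl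
        · rw [mono _ _ _ _ (restr_pref A (le_max_right m m')) hm']; rfl
    obtain ⟨m, hm⟩ := h4
    refine ⟨m + n + x.length, (mem_cyl_iff_pref (by omega)).1 hx, by simp; omega, ?_, ?_⟩
    · intro it hit
      have hp := hcon n it hit
      refine ⟨fun hp' => hp.1 ((mem_cyl_iff_pref ?_).2 hp'), 
        fun hp' => hp.2 ((mem_cyl_iff_pref ?_).2 hp')⟩ <;> simpa using hp'.length_le
    · intro i hi
      obtain ⟨v, hv⟩ := Option.isSome_iff_exists.1 (hm i hi)
      rw [mono _ _ _ _ (restr_pref A (by omega)) hv]; rfl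
  have hw := weak_two hA (fun n y => decide (stuckP F x n y)) (primrec_stuck hF x)
    (fun n y y' hy h => by simp only [decide_eq_true_eq] at h ⊢; exact stuckP_mono mono hy h)
    (fun n n' y hn h => by simp only [decide_eq_true_eq] at h ⊢; exact stuckP_anti hn h)
    (fun n => by simpa using hAs n)
  refine hB (sacks F hF mono B fun h0 => hw (measure_mono_null ?_ h0))
  intro X hX
  have hXs : ∀ n, ∃ m, stuckP F x n (restr X m) := by
    intro n; simpa using hX n
  intro n
  obtain ⟨m, hm⟩ := hXs (n+1)
  obtain ⟨v, hv⟩ := Option.isSome_iff_exists.1 (hm.2.2.2 n (Nat.lt_succ_self n))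
  obtain ⟨m', hm'⟩ := tot n
  refine ⟨m, ?_⟩
  rw [hv]
  cases v <;> cases hb : B n
  · rfl
  · rw [hb] at hm'; exact (stuck_agree mono hXs hAs hv hm').elim
  · rw [hb] at hm'; exact (stuck_agree mono hAs hXs hm' hv).elim
  · rfl

theorem total_step (hA : TwoRandom A) (hF : Primrec₂ F)
    (mono : ∀ σ τ n v, σ <+: τ → F σ n = some v → F τ n = some v)
    (tot : ∀ n, ∃ m, F (restr A m) n = some (B n)) (hB : ¬ ComputableSeq B)
    (hd : ∀ e, A ∉ deadE F k e) {s st} (h : Tr F k A s st) : ∃ c, Tr F k A (s+1) c := by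
  by_cases ha : attends st
  · obtain ⟨t, it, hit, hv | hu⟩ := not_stuck hA hF mono tot hB st.1 h.mem
    · exact ⟨_, h.vch ha hit hv⟩
    · have hr : it.2.1 <+: restr A (it.2.1.length + (sid st + k + 1)) :=
        (mem_cyl_iff_pref (by omega)).1 hu
      obtain ⟨z, hz⟩ := hr
      have hzl : z.length = sid st + k + 1 := by
        have := congrArg List.length hz
        simp at this; exact this
      have hAz : A ∈ cyl (it.2.1 ++ z) := by rw [hz]; exact mem_cyl_restr A _
      by_cases hz0 : ∀ b ∈ z, b = false
      · have hzz := eq_zs hz0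
        rw [hzl] at hzz
        subst hzz
        have hf : ∃ v τ, found (sid st) (st.2.1 ++ [it.2.2 + 1]) v = some τ := by
          by_contra hcon
          push Not at hcon
          refine hd (sid st) ⟨s, st, it, t, h, ha, rfl, hit, hAz, fun v => ?_⟩
          exact Option.eq_none_iff_forall_ne_some.2 (hcon v)
        obtain ⟨v, τ, hτ⟩ := hf
        exact ⟨_, h.uch (t := max t v) ha ((sel_mono (le_max_left t v)).subset hit) hAz
          (found_mono (le_max_right t v) hτ)⟩
      · exact ⟨_, h.nch ha hit hzl hz0 hAz⟩
  · refine ⟨zChild st (st.1 ++ [A st.1.length]), h.child (t := 0) 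
      (mem_children.2 (Or.inr ⟨ha, _, rfl⟩)) ?_⟩
    have := mem_cyl.1 h.mem
    change A ∈ cyl (st.1 ++ [A st.1.length])
    rw [mem_cyl, List.length_append, List.length_singleton, restr_succ, ← this]

theorem total (hA : TwoRandom A) (hF : Primrec₂ F)
    (mono : ∀ σ τ n v, σ <+: τ → F σ n = some v → F τ n = some v)
    (tot : ∀ n, ∃ m, F (restr A m) n = some (B n)) (hB : ¬ ComputableSeq B)
    (hd : ∀ e, A ∉ deadE F k e) (s : ℕ) : ∃ st, Tr F k A s st := by
  induction s with
  | zero => exact ⟨_, Tr.root⟩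
  | succ s ih =>
    obtain ⟨st, h⟩ := ih
    exact total_step hA hF mono tot hB hd h

end stuck

end Part9

section Part10
/-! ### Genericity of the constructed function -/

section gen
variable {F : List Bool → ℕ → Option Bool} {k : ℕ} {A : ℕ → Bool}

theorem acts_fin (hA : TwoRandom A) (hF : Primrec₂ F) (tt : ∀ s, ∃ st, Tr F k A s st) (e : ℕ) :
    ∃ s0, ∀ s st, s0 ≤ s → Tr F k A s st → sid st = e → ¬ attends st := by
  obtain ⟨j, hj⟩ := exists_act hA hF k e
  by_contra hcon
  push Not at hcon
  have key : ∀ i, ∃ s st, Tr F k A s st ∧ i ≤ acts e st.2.2 := by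
    intro i
    induction i with
    | zero => exact ⟨0, _, Tr.root, Nat.zero_le _⟩
    | succ i ih =>
      obtain ⟨s, st, h, hi⟩ := ih
      obtain ⟨s', st', hs, h', he, ha⟩ := hcon s
      obtain ⟨c, hc⟩ := tt (s'+1)
      obtain ⟨st2, t, h2, hch⟩ := hc.pred
      rw [← h'.unique h2] at hch
      refine ⟨s'+1, c, hc, ?_⟩
      rw [acts_child hch, if_pos ⟨ha, he⟩]
      have := acts_mono (e := e) (h.mono h' hs).2.2
      omega
  obtain ⟨s, st, h, hi⟩ := key (j+1)
  obtain ⟨s0, st0, -, h1, h2, h3, h4⟩ := acts_reach (e := e) (j := j) h (by omega)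
  exact hj ⟨s0, st0, h1, h2, h3, h4⟩

/-- meaning of the history entries -/
def EntOk (σ : List ℕ) (q : Ent) : Prop :=
  q.2.1 = 0 ∨ q.2.1 = 3 ∨ (q.2.1 = 1 ∧ q.2.2 <+: σ) ∨ (q.2.1 = 2 ∧ ∃ τ ∈ WW q.1, τ <+: σ)

theorem EntOk.mono {σ σ' q} (h : EntOk σ q) (hs : σ <+: σ') : EntOk σ' q := by
  rcases h with h | h | ⟨h, h'⟩ | ⟨h, τ, h1, h2⟩
  · exact Or.inl h
  · exact Or.inr (Or.inl h)
  · exact Or.inr (Or.inr (Or.inl ⟨h, h'.trans hs⟩))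
  · exact Or.inr (Or.inr (Or.inr ⟨h, τ, h1, h2.trans hs⟩))

theorem ent_ok {X s st} (h : Tr F k X s st) : ∀ q ∈ st.2.2, EntOk st.2.1 q := by
  induction s generalizing st with
  | zero =>
    rw [h.unique Tr.root]; simp [root]
  | succ s ih =>
    obtain ⟨st0, t, h0, hc⟩ := h.pred
    have hp := (child_facts hc).2.2.1
    have ih' : ∀ q ∈ st0.2.2, EntOk st.2.1 q := fun q hq => (ih h0 q hq).mono hp
    rw [mem_children] at hc
    rcases hc with ⟨ha, it, hit, rfl | ⟨z, -, ⟨-, rfl⟩ | ⟨-, τ, hf, rfl⟩⟩⟩ | ⟨-, b, rfl⟩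
    · intro q hq
      rcases List.mem_append.1 hq with hq | hq
      · exact ih' q hq
      · rw [List.mem_singleton.1 hq]
        refine Or.inr (Or.inr (Or.inl ⟨rfl, ?_⟩))
        change st0.2.1 ++ [it.2.2 + 1] <+: st0.2.1 ++ [it.2.2 + 1, Encodable.encode it.1]
        exact ⟨[Encodable.encode it.1], by simp⟩
    · intro q hq
      rcases List.mem_append.1 hq with hq | hq
      · exact ih' q hq
      · rw [List.mem_singleton.1 hq]
        exact Or.inl rfl
    · intro q hq
      rcases List.mem_append.1 hq with hq | hq
      · exact ih' q hq
      · rw [List.mem_singleton.1 hq]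
        exact Or.inr (Or.inr (Or.inr ⟨rfl, τ, (found_spec hf).2, List.prefix_append _ _⟩))
    · intro q hq
      rcases List.mem_append.1 hq with hq | hq
      · exact ih' q hq
      · rw [List.mem_singleton.1 hq]
        exact Or.inr (Or.inl rfl)

theorem list_bound {α : Type*} (l : List α) (t : α → ℕ) : ∃ T, ∀ q ∈ l, t q ≤ T := by
  induction l with
  | nil => exact ⟨0, by simp⟩
  | cons a l ih =>
    obtain ⟨T, hT⟩ := ih
    refine ⟨max (t a) T, fun q hq => ?_⟩
    rcases List.mem_cons.1 hq with rfl | hq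
    · exact le_max_left _ _
    · exact (hT q hq).trans (le_max_right _ _)

theorem generic (hA : TwoRandom A) (hF : Primrec₂ F) (tt : ∀ s, ∃ st, Tr F k A s st) (e : ℕ) :
    ∃ s st, Tr F k A s st ∧ ((∃ τ ∈ WW e, τ <+: st.2.1) ∨
      ∃ ρ, ρ <+: st.2.1 ∧ ∀ τ, ρ <+: τ → τ ∉ WW e) := by
  obtain ⟨s0, hs0⟩ := acts_fin hA hF tt e
  obtain ⟨st0, h0⟩ := tt s0
  by_contra hcon
  push Not at hcon
  have hent : ∀ s st, s0 ≤ s → Tr F k A s st → ∀ q ∈ st.2.2, q.1 = e → q.2.1 ≠ 3 →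
      q ∈ st0.2.2 := by
    intro s st hs
    induction hs generalizing st with
    | refl => intro h q hq _ _; rw [h0.unique h]; exact hq
    | step hs ih =>
      intro h q hq he h3
      obtain ⟨st1, t, h1, hc⟩ := h.pred
      obtain ⟨-, -, -, -, i, ρ, hh, hi⟩ := child_facts hc
      rw [hh] at hq
      rcases List.mem_append.1 hq with hq | hq
      · exact ih st1 h1 q hq he h3
      · rw [List.mem_singleton.1 hq] at he h3
        exact (hs0 _ _ hs h1 he (hi.2 h3)).elim
  have hfd : ∀ q : Ent, ∃ t, q ∈ st0.2.2 → q.2.1 = 1 → (found e q.2.2 t).isSome = true := by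
    intro q
    by_contra hq
    push Not at hq
    have hpre : q.2.2 <+: st0.2.1 := by
      rcases ent_ok h0 q (hq 0).1 with h | h | h | h
      · have := (hq 0).2.1; omega
      · have := (hq 0).2.1; omega
      · exact h.2
      · have := (hq 0).2.1; omega
    obtain ⟨τ, hτ, hW⟩ := (hcon s0 st0 h0).2 q.2.2 hpre
    refine found_none (e := e) (ρ := q.2.2) (fun t => ?_) hτ hW
    have := (hq t).2.2
    simpa using this
  choose t ht using hfd
  obtain ⟨T, hT⟩ := list_bound st0.2.2 t
  obtain ⟨st, h⟩ := tt (Nat.pair e (s0 + T))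
  have hle : s0 + T ≤ Nat.pair e (s0 + T) := Nat.right_le_pair _ _
  have hsid : sid st = e := by unfold sid; rw [h.len]; simp
  refine hs0 _ st (by omega) h hsid ?_
  intro q hq hqe
  rw [hsid] at hqe
  by_cases h3 : q.2.1 = 3
  · exact Or.inr (Or.inl h3)
  rcases ent_ok h q hq with h' | h' | h' | h'
  · exact Or.inl h'
  · exact Or.inr (Or.inl h')
  · refine Or.inr (Or.inr ⟨h'.1, ?_⟩)
    have hm := hent _ st (by omega) h q hq hqe h3
    obtain ⟨τ, hτ⟩ := Option.isSome_iff_exists.1 (ht q hm h'.1)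
    rw [hsid, h.len, found_mono (t' := Nat.pair e (s0 + T)) (by have := hT q hm; omega) hτ]; rfl
  · obtain ⟨τ, hτ, hp⟩ := h'.2
    rw [hqe] at hτ
    exact ((hcon _ st h).1 τ hτ hp).elim

end gen

end Part10

section Part11
/-! ### The decoder -/

/-- read the function coded in the odd part -/
def fget (z : List Bool) (i : ℕ) : Option ℕ :=
  bsearch (fun v => if z[2 * Nat.pair i v + 1]? = some true then some v else none) z.length

/-- read a string coded in the odd part -/
def gd (z : List Bool) (i : ℕ) : Option (List Bool) := (fget z i).bind Encodable.decode

/-- decode an N-child -/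
def dN (z : List Bool) (st : St) : Option St :=
  (gd z (st.2.1.length + 1)).map fun y => nChild st y

/-- decode a Z-child -/
def dZ (z : List Bool) (st : St) : Option St := (gd z st.2.1.length).map fun y => zChild st y

/-- decode a V-child -/
def dV (z : List Bool) (st : St) (n : ℕ) : Option St :=
  (gd z (st.2.1.length + 1)).map fun y => vChild st (y, [], n)

/-- decode a U-child -/
def dU (z : List Bool) (st : St) (n : ℕ) : Option St :=
  (found (sid st) (st.2.1 ++ [n + 1]) z.length).bind fun τ =>
    (gd z τ.length).map fun y => uChild st τ y

/-- decode in the attending case, having read `a` -/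
def dA (z : List Bool) (st : St) (a : ℕ) : Option St :=
  if a = 0 then dN z st else
    (z[2 * (a - 1)]?).bind fun b => if b = false then dV z st (a - 1) else dU z st (a - 1)

/-- decoding step -/
def dstep (z : List Bool) (st : St) : Option St :=
  if attends st then (fget z st.2.1.length).bind (dA z st) else dZ z st

/-- decoding run -/
def drun (z : List Bool) (s : ℕ) : Option St :=
  Nat.rec (some root) (fun _ o => o.bind (dstep z)) s

theorem drun_succ (z s) : drun z (s+1) = (drun z s).bind (dstep z) := rfl

section prim

theorem primrec_fget : Primrec₂ fget := by
  unfold fget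
  refine primrec_bsearch (β := List Bool × ℕ)
    (p := fun q v => if q.1[2 * Nat.pair q.2 v + 1]? = some true then some v else none)
    (t := fun q => q.1.length) ?_ (Primrec.list_length.comp Primrec.fst)
  have h1 : Primrec fun p : (List Bool × ℕ) × ℕ => 2 * Nat.pair p.1.2 p.2 + 1 :=
    Primrec.succ.comp (Primrec.nat_mul.comp (Primrec.const 2)
      (Primrec₂.natPair.comp (Primrec.snd.comp Primrec.fst) Primrec.snd))
  have h2 : Primrec fun p : (List Bool × ℕ) × ℕ => p.1.1[2 * Nat.pair p.1.2 p.2 + 1]? := 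
    Primrec.list_getElem?.comp (Primrec.fst.comp Primrec.fst) h1
  exact Primrec.ite (PrimrecRel.comp Primrec.eq h2 (Primrec.const (some true)))
    (Primrec.option_some.comp Primrec.snd) (Primrec.const none)

theorem primrec_gd : Primrec₂ gd := by
  have h : Primrec₂ fun (_ : List Bool × ℕ) (c : ℕ) => (Encodable.decode c : Option (List Bool)) :=
    Primrec.decode.comp Primrec.snd
  have := Primrec.option_bind (primrec_fget.comp Primrec.fst Primrec.snd) h
  exact this

theorem primrec_len1 : Primrec fun p : List Bool × St => p.2.2.1.length :=
  Primrec.list_length.comp (primrec_sg.comp Primrec.snd)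

theorem primrec_dN : Primrec₂ dN := by
  have h1 : Primrec fun p : List Bool × St => gd p.1 (p.2.2.1.length + 1) :=
    primrec_gd.comp Primrec.fst (Primrec.succ.comp primrec_len1)
  have h2 : Primrec₂ fun (p : List Bool × St) (y : List Bool) => nChild p.2 y := by
    have h3 : Primrec fun q : (List Bool × St) × List Bool => q.1.2 := Primrec.snd.comp Primrec.fst
    have := Primrec₂.comp primrec_nChild h3 Primrec.snd
    exact this
  have := Primrec.option_map h1 h2
  exact this

theorem primrec_dZ : Primrec₂ dZ := by
  have h1 : Primrec fun p : List Bool × St => gd p.1 (p.2.2.1.length) :=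
    primrec_gd.comp Primrec.fst primrec_len1
  have h2 : Primrec₂ fun (p : List Bool × St) (y : List Bool) => zChild p.2 y := by
    have h3 : Primrec fun q : (List Bool × St) × List Bool => q.1.2 := Primrec.snd.comp Primrec.fst
    have := Primrec₂.comp primrec_zChild h3 Primrec.snd
    exact this
  have := Primrec.option_map h1 h2
  exact this

theorem primrec_dV : Primrec fun q : (List Bool × St) × ℕ => dV q.1.1 q.1.2 q.2 := by
  have h1 : Primrec fun p : (List Bool × St) × ℕ => gd p.1.1 (p.1.2.2.1.length + 1) :=
    primrec_gd.comp (Primrec.fst.comp Primrec.fst) (Primrec.succ.comp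
      (primrec_len1.comp Primrec.fst))
  have h2 : Primrec₂ fun (p : (List Bool × St) × ℕ) (y : List Bool) =>
      vChild p.1.2 (y, [], p.2) := by
    have h3 : Primrec fun q : ((List Bool × St) × ℕ) × List Bool => q.1.1.2 :=
      Primrec.snd.comp (Primrec.fst.comp Primrec.fst)
    have h4 : Primrec fun q : ((List Bool × St) × ℕ) × List Bool => ((q.2, [], q.1.2) : Item) :=
      Primrec.pair Primrec.snd (Primrec.pair (Primrec.const []) (Primrec.snd.comp Primrec.fst))
    have := Primrec₂.comp primrec_vChild h3 h4
    exact this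
  have := Primrec.option_map h1 h2
  exact this

theorem primrec_dU : Primrec fun q : (List Bool × St) × ℕ => dU q.1.1 q.1.2 q.2 := by
  have hst : Primrec fun q : (List Bool × St) × ℕ => q.1.2 := Primrec.snd.comp Primrec.fst
  have hz : Primrec fun q : (List Bool × St) × ℕ => q.1.1 := Primrec.fst.comp Primrec.fst
  have hq : Primrec fun q : (List Bool × St) × ℕ =>
      ((sid q.1.2, q.1.2.2.1 ++ [q.2 + 1], q.1.1.length) : ℕ × List ℕ × ℕ) :=
    Primrec.pair (primrec_sid.comp hst) (Primrec.pair
      (Primrec.list_concat.comp (primrec_sg.comp hst) (Primrec.succ.comp Primrec.snd))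
      (Primrec.list_length.comp hz))
  have hf : Primrec fun q : (List Bool × St) × ℕ =>
      found (sid q.1.2) (q.1.2.2.1 ++ [q.2 + 1]) q.1.1.length := by
    have := Primrec.comp primrec_found hq
    exact this
  have h2 : Primrec fun p : ((List Bool × St) × ℕ) × List ℕ => gd p.1.1.1 p.2.length :=
    primrec_gd.comp (hz.comp Primrec.fst) (Primrec.list_length.comp Primrec.snd)
  have h3 : Primrec₂ fun (p : ((List Bool × St) × ℕ) × List ℕ) (y : List Bool) =>
      uChild p.1.1.2 p.2 y := by
    have h4 : Primrec fun r : (((List Bool × St) × ℕ) × List ℕ) × List Bool =>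
        ((r.1.1.1.2, r.1.2, r.2) : St × List ℕ × List Bool) :=
      Primrec.pair (hst.comp (Primrec.fst.comp Primrec.fst)) (Primrec.pair
        (Primrec.snd.comp Primrec.fst) Primrec.snd)
    have := Primrec.comp primrec_uChild h4
    exact this
  have h5 := Primrec.option_map h2 h3
  have h6 : Primrec₂ fun (q : (List Bool × St) × ℕ) (τ : List ℕ) =>
    (gd q.1.1 τ.length).map fun y => uChild q.1.2 τ y := h5
  have := Primrec.option_bind hf h6
  exact this

theorem primrec_dA : Primrec fun q : (List Bool × St) × ℕ => dA q.1.1 q.1.2 q.2 := by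
  have hst : Primrec fun q : (List Bool × St) × ℕ => q.1.2 := Primrec.snd.comp Primrec.fst
  have hz : Primrec fun q : (List Bool × St) × ℕ => q.1.1 := Primrec.fst.comp Primrec.fst
  have hp : Primrec fun q : (List Bool × St) × ℕ => q.2 - 1 :=
    Primrec.nat_sub.comp Primrec.snd (Primrec.const 1)
  have hr : Primrec fun q : ((List Bool × St) × ℕ) × Bool =>
      (((q.1.1, q.1.2 - 1)) : (List Bool × St) × ℕ) :=
    Primrec.pair (Primrec.fst.comp Primrec.fst) (hp.comp Primrec.fst)
  have hV : Primrec fun q : ((List Bool × St) × ℕ) × Bool => dV q.1.1.1 q.1.1.2 (q.1.2 - 1) := by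
    have := Primrec.comp primrec_dV hr
    exact this
  have hU : Primrec fun q : ((List Bool × St) × ℕ) × Bool => dU q.1.1.1 q.1.1.2 (q.1.2 - 1) := by
    have := Primrec.comp primrec_dU hr
    exact this
  have hi : Primrec₂ fun (q : (List Bool × St) × ℕ) (b : Bool) =>
      if b = false then dV q.1.1 q.1.2 (q.2 - 1) else dU q.1.1 q.1.2 (q.2 - 1) := by
    have := Primrec.ite (PrimrecRel.comp Primrec.eq Primrec.snd (Primrec.const false)) hV hU
    exact this
  have hg : Primrec fun q : (List Bool × St) × ℕ => q.1.1[2 * (q.2 - 1)]? :=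
    Primrec.list_getElem?.comp hz (Primrec.nat_mul.comp (Primrec.const 2) hp)
  have hb := Primrec.option_bind hg hi
  have hN : Primrec fun q : (List Bool × St) × ℕ => dN q.1.1 q.1.2 := by
    have := Primrec₂.comp primrec_dN hz hst
    exact this
  have := Primrec.ite (PrimrecRel.comp Primrec.eq (Primrec.snd (α := List Bool × St) (β := ℕ))
    (Primrec.const 0)) hN hb
  exact this

theorem primrec_dstep : Primrec₂ dstep := by
  have h1 : Primrec fun p : List Bool × St => fget p.1 p.2.2.1.length :=
    primrec_fget.comp Primrec.fst primrec_len1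
  have h2 : Primrec₂ fun (p : List Bool × St) (a : ℕ) => dA p.1 p.2 a := primrec_dA
  have h3 := Primrec.option_bind h1 h2
  have h4 : Primrec fun p : List Bool × St => dZ p.1 p.2 := primrec_dZ
  have h5 : PrimrecPred fun p : List Bool × St => attends p.2 := primrec_attends.comp Primrec.snd
  have := Primrec.ite h5 h3 h4
  exact this

theorem primrec_drun : Primrec₂ drun := by
  unfold drun
  have h : Primrec₂ fun (p : List Bool × ℕ) (q : ℕ × Option St) => q.2.bind (dstep p.1) := by
    have h1 : Primrec fun r : (List Bool × ℕ) × ℕ × Option St => r.2.2 :=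
      Primrec.snd.comp Primrec.snd
    have h2 : Primrec₂ fun (r : (List Bool × ℕ) × ℕ × Option St) (st : St) => dstep r.1.1 st := by
      have h3 : Primrec fun w : ((List Bool × ℕ) × ℕ × Option St) × St => w.1.1.1 :=
        Primrec.fst.comp (Primrec.fst.comp Primrec.fst)
      have := Primrec₂.comp primrec_dstep h3 Primrec.snd
      exact this
    have := Primrec.option_bind h1 h2
    exact this
  have := Primrec.nat_rec' (f := fun p : List Bool × ℕ => p.2) (g := fun _ => some root)
    Primrec.snd (Primrec.const _) h
  exact this

end prim

end Part11

section Part12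
/-! ### Correctness of the decoder and of the coding -/

/-- graph of a function, as a sequence -/
def graphSeq (f : ℕ → ℕ) : ℕ → Bool := fun m => decide (f m.unpair.1 = m.unpair.2)

theorem join_even (B C : ℕ → Bool) (n : ℕ) : join B C (2 * n) = B n := by
  simp [join]

theorem join_odd (B C : ℕ → Bool) (n : ℕ) : join B C (2 * n + 1) = C n := by
  have h1 : (2 * n + 1) % 2 = 1 := by omega
  have h2 : (2 * n + 1) / 2 = n := by omega
  simp [join, h1, h2]

section dec
variable {F : List Bool → ℕ → Option Bool} {k : ℕ} {A B : ℕ → Bool} {f : ℕ → ℕ}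

theorem fget_iff {m i v} : fget (restr (join B (graphSeq f)) m) i = some v ↔
    v = f i ∧ 2 * Nat.pair i v + 1 < m := by
  have hp : ∀ j a, (if (restr (join B (graphSeq f)) m)[2 * Nat.pair i j + 1]? = some true
      then some j else none) = some a ↔ a = j ∧ j = f i ∧ 2 * Nat.pair i j + 1 < m := by
    intro j a
    rw [restr_getElem?]
    by_cases hlt : 2 * Nat.pair i j + 1 < m
    · rw [if_pos hlt, join_odd]
      unfold graphSeq
      rw [Nat.unpair_pair]
      by_cases hfi : f i = j
      · simp [hfi, hlt, eq_comm]
      · have : ¬ j = f i := fun h => hfi h.symm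
        simp [hfi, this]
    · simp [hlt]
  unfold fget
  rw [bsearch_eq_some]
  constructor
  · rintro ⟨j, -, h, -⟩
    obtain ⟨rfl, h⟩ := (hp _ _).1 h
    exact h
  · rintro ⟨rfl, h⟩
    have hle : f i ≤ Nat.pair i (f i) := Nat.right_le_pair _ _
    refine ⟨f i, by simp; omega, (hp _ _).2 ⟨rfl, rfl, h⟩, fun j hj => ?_⟩
    rw [Option.eq_none_iff_forall_ne_some]
    intro a ha
    have := ((hp _ _).1 ha).2.1
    omega

theorem fget_mono {m m' i v} (hm : m ≤ m') (h : fget (restr (join B (graphSeq f)) m) i = some v) :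
    fget (restr (join B (graphSeq f)) m') i = some v := by
  rw [fget_iff] at h ⊢
  exact ⟨h.1, h.2.trans_le hm⟩

theorem gd_mono {m m' i v} (hm : m ≤ m') (h : gd (restr (join B (graphSeq f)) m) i = some v) :
    gd (restr (join B (graphSeq f)) m') i = some v := by
  unfold gd at *
  rw [Option.bind_eq_some_iff] at *
  obtain ⟨a, h1, h2⟩ := h
  exact ⟨a, fget_mono hm h1, h2⟩

theorem gd_ev {i y} (h : f i = Encodable.encode y) :
    ∃ m, gd (restr (join B (graphSeq f)) m) i = some y := by
  refine ⟨2 * Nat.pair i (f i) + 2, ?_⟩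
  unfold gd
  rw [fget_iff.2 ⟨rfl, by omega⟩, Option.bind_some, h, Encodable.encodek]

theorem dstep_mono {m m' st c} (hm : m ≤ m')
    (h : dstep (restr (join B (graphSeq f)) m) st = some c) :
    dstep (restr (join B (graphSeq f)) m') st = some c := by
  unfold dstep at *
  split_ifs at h ⊢ with ha
  · rw [Option.bind_eq_some_iff] at *
    obtain ⟨a, h1, h2⟩ := h
    refine ⟨a, fget_mono hm h1, ?_⟩
    unfold dA at *
    split_ifs at h2 ⊢ with h0
    · unfold dN at *
      rw [Option.map_eq_some_iff] at *
      obtain ⟨y, hy, rfl⟩ := h2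
      exact ⟨y, gd_mono hm hy, rfl⟩
    · rw [Option.bind_eq_some_iff] at *
      obtain ⟨b, hb, h2⟩ := h2
      refine ⟨b, prefix_getElem? (restr_pref _ hm) hb, ?_⟩
      split_ifs at h2 ⊢ with hbf
      · unfold dV at *
        rw [Option.map_eq_some_iff] at *
        obtain ⟨y, hy, rfl⟩ := h2
        exact ⟨y, gd_mono hm hy, rfl⟩
      · unfold dU at *
        rw [Option.bind_eq_some_iff] at *
        obtain ⟨τ, hτ, h2⟩ := h2
        refine ⟨τ, found_mono (by simpa using hm) hτ, ?_⟩
        rw [Option.map_eq_some_iff] at *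
        obtain ⟨y, hy, rfl⟩ := h2
        exact ⟨y, gd_mono hm hy, rfl⟩
  · unfold dZ at *
    rw [Option.map_eq_some_iff] at *
    obtain ⟨y, hy, rfl⟩ := h
    exact ⟨y, gd_mono hm hy, rfl⟩

theorem drun_mono {m m' s c} (hm : m ≤ m')
    (h : drun (restr (join B (graphSeq f)) m) s = some c) :
    drun (restr (join B (graphSeq f)) m') s = some c := by
  induction s generalizing c with
  | zero => exact h
  | succ s ih =>
    rw [drun_succ, Option.bind_eq_some_iff] at *
    obtain ⟨a, h1, h2⟩ := h
    exact ⟨a, ih h1, dstep_mono hm h2⟩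

/-- `F` computes `B` from `A` -/
def Cmp (F : List Bool → ℕ → Option Bool) (A B : ℕ → Bool) : Prop :=
  (∀ σ τ n v, σ <+: τ → F σ n = some v → F τ n = some v) ∧
    ∀ n, ∃ m, F (restr A m) n = some (B n)

theorem Cmp.eq (h : Cmp F A B) {m n v} (hv : F (restr A m) n = some v) : v = B n := by
  obtain ⟨m', hm'⟩ := h.2 n
  have h1 := h.1 _ _ _ _ (restr_pref A (le_max_left m m')) hv
  have h2 := h.1 _ _ _ _ (restr_pref A (le_max_right m m')) hm'
  rw [h1] at h2
  simpa using h2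

theorem Cmp.eq_cyl (h : Cmp F A B) {x n v} (hx : A ∈ cyl x) (hv : F x n = some v) : v = B n := by
  rw [mem_cyl.1 hx] at hv
  exact h.eq hv

/-- `f` is the function built along `A` -/
def Built (F : List Bool → ℕ → Option Bool) (k : ℕ) (A : ℕ → Bool) (f : ℕ → ℕ) : Prop :=
  ∀ s st, Tr F k A s st → ∀ i v, st.2.1[i]? = some v → f i = v

theorem dstep_ev (hB : Cmp F A B) (hf : Built F k A f) {s st c t} (h : Tr F k A (s+1) c)
    (hc : c ∈ children F k t st) : ∃ m, dstep (restr (join B (graphSeq f)) m) st = some c := by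
  have hA := h.mem
  have hfc := hf _ _ h
  rw [mem_children] at hc
  rcases hc with ⟨ha, it, hit, rfl | ⟨z, -, ⟨-, rfl⟩ | ⟨-, τ, hτ, rfl⟩⟩⟩ | ⟨ha, b, rfl⟩
  · have h1 : f st.2.1.length = it.2.2 + 1 := hfc _ _ (by simp [vChild])
    have h2 : f (st.2.1.length + 1) = Encodable.encode it.1 := hfc _ _ (by simp [vChild])
    have h3 : false = B it.2.2 := hB.eq_cyl (x := it.1) hA (sel_good hit).fv
    obtain ⟨m, hm⟩ := gd_ev (B := B) h2
    refine ⟨m + 2 * Nat.pair st.2.1.length (it.2.2 + 1) + 2 * it.2.2 + 2, ?_⟩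
    unfold dstep
    rw [if_pos ha, fget_iff.2 ⟨h1.symm, by omega⟩, Option.bind_some]
    unfold dA
    rw [if_neg (by omega), Nat.add_sub_cancel, restr_getElem?, if_pos (by omega), join_even, ← h3,
      Option.bind_some, if_pos rfl]
    unfold dV
    rw [gd_mono (by omega) hm]
    rfl
  · have h1 : f st.2.1.length = 0 := hfc _ _ (by simp [nChild])
    have h2 : f (st.2.1.length + 1) = Encodable.encode (it.2.1 ++ z) :=
      hfc _ _ (by simp [nChild])
    obtain ⟨m, hm⟩ := gd_ev (B := B) h2
    refine ⟨m + 2 * Nat.pair st.2.1.length 0 + 2, ?_⟩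
    unfold dstep
    rw [if_pos ha, fget_iff.2 ⟨h1.symm, by omega⟩, Option.bind_some]
    unfold dA
    rw [if_pos rfl]
    unfold dN
    rw [gd_mono (by omega) hm]
    rfl
  · have hpre := (found_spec hτ).1
    have h1 : f st.2.1.length = it.2.2 + 1 := by
      refine hfc _ _ ?_
      have : (st.2.1 ++ [it.2.2 + 1])[st.2.1.length]? = some (it.2.2 + 1) := by simp
      exact prefix_getElem? (hpre.trans (List.prefix_append _ _)) this
    have h2 : f τ.length = Encodable.encode (it.2.1 ++ z) := hfc _ _ (by simp [uChild])
    have h3 : true = B it.2.2 := 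
      hB.eq_cyl (x := it.2.1 ++ z) hA (hB.1 _ _ _ _ (List.prefix_append _ _) (sel_good hit).fu)
    obtain ⟨m, hm⟩ := gd_ev (B := B) h2
    refine ⟨m + t + 2 * Nat.pair st.2.1.length (it.2.2 + 1) + 2 * it.2.2 + 2, ?_⟩
    unfold dstep
    rw [if_pos ha, fget_iff.2 ⟨h1.symm, by omega⟩, Option.bind_some]
    unfold dA
    rw [if_neg (by omega), Nat.add_sub_cancel, restr_getElem?, if_pos (by omega), join_even, ← h3,
      Option.bind_some, if_neg (by simp)]
    unfold dU
    rw [restr_length, found_mono (by omega) hτ, Option.bind_some, gd_mono (by omega) hm]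
    rfl
  · have h2 : f st.2.1.length = Encodable.encode (st.1 ++ [b]) := hfc _ _ (by simp [zChild])
    obtain ⟨m, hm⟩ := gd_ev (B := B) h2
    refine ⟨m, ?_⟩
    unfold dstep
    rw [if_neg ha]
    unfold dZ
    rw [hm]
    rfl

theorem drun_ev (hB : Cmp F A B) (hf : Built F k A f) {s st} (h : Tr F k A s st) :
    ∃ m, drun (restr (join B (graphSeq f)) m) s = some st := by
  induction s generalizing st with
  | zero => exact ⟨0, by rw [h.unique Tr.root]; rfl⟩
  | succ s ih =>
    obtain ⟨st0, t, h0, hc⟩ := h.pred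
    obtain ⟨m, hm⟩ := ih h0
    obtain ⟨m', hm'⟩ := dstep_ev hB hf h hc
    refine ⟨max m m', ?_⟩
    rw [drun_succ, drun_mono (le_max_left m m') hm, Option.bind_some,
      dstep_mono (le_max_right m m') hm']

theorem Tr.lenx {X s st} (h : Tr F k X s st) : s ≤ st.1.length := by
  induction s generalizing st with
  | zero => exact Nat.zero_le _
  | succ s ih =>
    obtain ⟨st0, t, h0, hc⟩ := h.pred
    have := ih h0
    have := (child_facts hc).2.1
    omega

theorem A_le_join (hB : Cmp F A B) (hf : Built F k A f) (tt : ∀ s, ∃ st, Tr F k A s st) :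
    TRed A (join B (graphSeq f)) := by
  refine tred_of_approx (fun z i => (drun z (i+1)).bind fun st => st.1[i]?) ?_ _ _ ?_ ?_
  · have h1 : Primrec fun p : List Bool × ℕ => drun p.1 (p.2 + 1) :=
      primrec_drun.comp Primrec.fst (Primrec.succ.comp Primrec.snd)
    have h2 : Primrec₂ fun (p : List Bool × ℕ) (st : St) => st.1[p.2]? :=
      Primrec.list_getElem?.comp (Primrec.fst.comp Primrec.snd) (Primrec.snd.comp Primrec.fst)
    exact Primrec.option_bind h1 h2
  all_goals
    have key : ∀ i st, Tr F k A (i+1) st → st.1[i]? = some (A i) := by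
      intro i st h
      have := h.lenx
      rw [mem_cyl.1 h.mem, restr_getElem?, if_pos (by omega)]
  · intro i
    obtain ⟨st, h⟩ := tt (i+1)
    obtain ⟨m, hm⟩ := drun_ev hB hf h
    exact ⟨m, by simp only [hm, Option.bind_some, key i st h]⟩
  · intro i m v hv
    obtain ⟨st, h⟩ := tt (i+1)
    obtain ⟨m', hm'⟩ := drun_ev hB hf h
    simp only [Option.bind_eq_some_iff] at hv
    obtain ⟨st', h1, h2⟩ := hv
    have e1 := drun_mono (le_max_left m m') h1
    rw [drun_mono (le_max_right m m') hm'] at e1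
    obtain rfl : st = st' := by simpa using e1
    rw [key i st h] at h2
    simpa using h2.symm

/-- approximation of the graph -/
def gApp (F : List Bool → ℕ → Option Bool) (k : ℕ) (y : List Bool) (m : ℕ) : Option Bool :=
  (run F k y (m.unpair.1 + 1)).bind fun st =>
    (st.2.1[m.unpair.1]?).map fun v => decide (v = m.unpair.2)

theorem primrec_gApp (hF : Primrec₂ F) : Primrec₂ (gApp F k) := by
  have hu1 : Primrec fun p : List Bool × ℕ => p.2.unpair.1 :=
    Primrec.fst.comp (Primrec.unpair.comp Primrec.snd)
  have hu2 : Primrec fun p : List Bool × ℕ => p.2.unpair.2 :=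
    Primrec.snd.comp (Primrec.unpair.comp Primrec.snd)
  have h0 : Primrec fun p : List Bool × ℕ => ((k, p.1, p.2.unpair.1 + 1) : ℕ × List Bool × ℕ) :=
    Primrec.pair (Primrec.const k) (Primrec.pair Primrec.fst (Primrec.succ.comp hu1))
  have h1 : Primrec fun p : List Bool × ℕ => run F k p.1 (p.2.unpair.1 + 1) := by
    have := Primrec.comp (primrec_run hF) h0
    exact this
  have h2 : Primrec fun q : (List Bool × ℕ) × St => q.2.2.1[q.1.2.unpair.1]? :=
    Primrec.list_getElem?.comp (primrec_sg.comp Primrec.snd) (hu1.comp Primrec.fst)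
  have h3 : Primrec₂ fun (q : (List Bool × ℕ) × St) (v : ℕ) => decide (v = q.1.2.unpair.2) := by
    have h4 : Primrec fun r : ((List Bool × ℕ) × St) × ℕ => r.1.1.2.unpair.2 :=
      hu2.comp (Primrec.fst.comp Primrec.fst)
    exact (PrimrecRel.comp Primrec.eq Primrec.snd h4).decide
  have h5 : Primrec₂ fun (p : List Bool × ℕ) (st : St) =>
      (st.2.1[p.2.unpair.1]?).map fun v => decide (v = p.2.unpair.2) := by
    have := Primrec.option_map h2 h3
    exact this
  have := Primrec.option_bind h1 h5
  exact this

theorem gApp_ev (hf : Built F k A f) (tt : ∀ s, ∃ st, Tr F k A s st) (n : ℕ) :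
    ∃ m, gApp F k (restr A m) n = some (graphSeq f n) := by
  obtain ⟨st, h⟩ := tt (n.unpair.1 + 1)
  have hle := h.le
  have hfv := hf _ _ h
  obtain ⟨m, hm⟩ := h
  refine ⟨m, ?_⟩
  have hlt : n.unpair.1 < st.2.1.length := by omega
  have hv := hfv _ _ (List.getElem?_eq_getElem hlt)
  unfold gApp graphSeq
  rw [hm, Option.bind_some, List.getElem?_eq_getElem hlt, hv]
  rfl

theorem gApp_eq (hf : Built F k A f) {n m v} (h : gApp F k (restr A m) n = some v) :
    v = graphSeq f n := by
  unfold gApp at h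
  rw [Option.bind_eq_some_iff] at h
  obtain ⟨st, h1, h2⟩ := h
  rw [Option.map_eq_some_iff] at h2
  obtain ⟨a, h2, rfl⟩ := h2
  unfold graphSeq
  rw [hf _ _ ⟨m, h1⟩ _ _ h2]

theorem graph_le (hF : Primrec₂ F) (hf : Built F k A f) (tt : ∀ s, ∃ st, Tr F k A s st) :
    TRed (graphSeq f) A :=
  tred_of_approx (gApp F k) (primrec_gApp hF) _ _ (gApp_ev hf tt) fun _ _ _ h => gApp_eq hf h

theorem join_le_A (hF : Primrec₂ F) (hB : Cmp F A B) (hf : Built F k A f)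
    (tt : ∀ s, ∃ st, Tr F k A s st) : TRed (join B (graphSeq f)) A := by
  refine tred_of_approx (fun y n => if n % 2 = 0 then F y (n / 2) else gApp F k y (n / 2))
    ?_ _ _ ?_ ?_
  · have hd : Primrec fun p : List Bool × ℕ => p.2 / 2 :=
      Primrec.nat_div.comp Primrec.snd (Primrec.const 2)
    have hm : Primrec fun p : List Bool × ℕ => p.2 % 2 :=
      Primrec.nat_mod.comp Primrec.snd (Primrec.const 2)
    exact Primrec.ite (PrimrecRel.comp Primrec.eq hm (Primrec.const 0))
      (hF.comp Primrec.fst hd) ((primrec_gApp hF).comp Primrec.fst hd)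
  · intro n
    unfold join
    split_ifs with h
    · simpa [h] using hB.2 (n / 2)
    · simpa [h] using gApp_ev hf tt (n / 2)
  · intro n m v hv
    unfold join
    by_cases h : n % 2 = 0
    · rw [if_pos h]; simp only [h, if_true] at hv; exact hB.eq hv
    · rw [if_neg h]; simp only [h, if_false] at hv; exact gApp_eq hf hv

theorem exists_built (tt : ∀ s, ∃ st, Tr F k A s st) : ∃ f, Built F k A f := by
  choose S hS using tt
  refine ⟨fun i => ((S (i+1)).2.1[i]?).getD 0, ?_⟩
  intro s st h i v hv
  have hle := (hS (i+1)).le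
  have hlt : i < (S (i+1)).2.1.length := by omega
  have hw := List.getElem?_eq_getElem hlt
  have e1 : (S (i+1)).2.1[i]? = some v := by
    rcases le_total s (i+1) with hs | hs
    · exact prefix_getElem? (h.mono (hS _) hs).2.1 hv
    · have := prefix_getElem? ((hS _).mono h hs).2.1 hw
      rw [hv] at this
      rw [hw, this]
  change ((S (i+1)).2.1[i]?).getD 0 = v
  rw [e1]; rfl

end dec

end Part12

section Part13
open MeasureTheory

/-! ### The sequence `A` is not computable from the graph -/

/-- graph of a finite sequence -/
def Cstr (σ : List ℕ) : List Bool :=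
  (List.range σ.length).map fun m => decide (σ[m.unpair.1]? = some m.unpair.2)

theorem primrec_Cstr : Primrec Cstr := by
  unfold Cstr
  refine Primrec.list_map (Primrec.list_range.comp Primrec.list_length) ?_
  have h1 : Primrec fun p : List ℕ × ℕ => p.2.unpair.1 :=
    Primrec.fst.comp (Primrec.unpair.comp Primrec.snd)
  have h2 : Primrec fun p : List ℕ × ℕ => p.2.unpair.2 :=
    Primrec.snd.comp (Primrec.unpair.comp Primrec.snd)
  exact (PrimrecRel.comp Primrec.eq (Primrec.list_getElem?.comp Primrec.fst h1)
    (Primrec.option_some.comp h2)).decide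

theorem Cstr_eq {f : ℕ → ℕ} {σ : List ℕ} (h : ∀ i v, σ[i]? = some v → f i = v) :
    Cstr σ = restr (graphSeq f) σ.length := by
  unfold Cstr restr
  refine List.map_congr_left fun m hm => ?_
  have hm := List.mem_range.1 hm
  have hlt : m.unpair.1 < σ.length := (Nat.unpair_left_le m).trans_lt hm
  unfold graphSeq
  rw [List.getElem?_eq_getElem hlt, h _ _ (List.getElem?_eq_getElem hlt)]
  simp

section lg
variable (G : List Bool → ℕ → Option Bool)

/-- `τ` extends `σ` and forces many values -/
def Good (i : ℕ) (σ τ : List ℕ) : Prop :=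
  σ <+: τ ∧ ∀ n ∈ List.range (Encodable.encode σ + i + 1), (G (Cstr τ) n).isSome = true

instance goodDec (i σ τ) : Decidable (Good G i σ τ) := by unfold Good; infer_instance

/-- `τ` is the least good extension -/
def Least (i : ℕ) (σ τ : List ℕ) : Prop :=
  Good G i σ τ ∧ ∀ j ∈ List.range (Encodable.encode τ),
    ¬ ((Encodable.decode j : Option (List ℕ)).map fun τ' => decide (Good G i σ τ')) = some true

instance leastDec (i σ τ) : Decidable (Least G i σ τ) := by unfold Least; infer_instance

variable {G}

theorem primrec_good (hG : Primrec₂ G) :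
    PrimrecPred fun q : ℕ × List ℕ × List ℕ => Good G q.1 q.2.1 q.2.2 := by
  have hs : Primrec fun q : ℕ × List ℕ × List ℕ => q.2.1 := Primrec.fst.comp Primrec.snd
  have ht : Primrec fun q : ℕ × List ℕ × List ℕ => q.2.2 := Primrec.snd.comp Primrec.snd
  have hR : PrimrecRel fun (n : ℕ) (τ : List ℕ) => (G (Cstr τ) n).isSome = true := by
    have h1 : Primrec fun p : ℕ × List ℕ => (G (Cstr p.2) p.1).isSome :=
      Primrec.option_isSome.comp (hG.comp (primrec_Cstr.comp Primrec.snd) Primrec.fst)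
    exact PrimrecRel.comp Primrec.eq h1 (Primrec.const true)
  have hr : Primrec fun q : ℕ × List ℕ × List ℕ =>
      List.range (Encodable.encode q.2.1 + q.1 + 1) :=
    Primrec.list_range.comp (Primrec.succ.comp (Primrec.nat_add.comp (Primrec.encode.comp hs)
      Primrec.fst))
  unfold Good
  exact (PrimrecRel.comp primrec_pref hs ht).and (PrimrecRel.comp hR.forall_mem_list hr ht)

theorem primrec_least (hG : Primrec₂ G) :
    PrimrecPred fun q : ℕ × List ℕ × List ℕ => Least G q.1 q.2.1 q.2.2 := by
  have hR : PrimrecRel fun (j : ℕ) (q : ℕ × List ℕ × List ℕ) =>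
      ¬ ((Encodable.decode j : Option (List ℕ)).map fun τ' => decide (Good G q.1 q.2.1 τ')) =
        some true := by
    have h1 : Primrec fun p : ℕ × (ℕ × List ℕ × List ℕ) =>
        (Encodable.decode p.1 : Option (List ℕ)) := Primrec.decode.comp Primrec.fst
    have h2 : Primrec₂ fun (p : ℕ × (ℕ × List ℕ × List ℕ)) (τ' : List ℕ) =>
        decide (Good G p.2.1 p.2.2.1 τ') := by
      have h3 : Primrec fun r : (ℕ × (ℕ × List ℕ × List ℕ)) × List ℕ =>
          ((r.1.2.1, r.1.2.2.1, r.2) : ℕ × List ℕ × List ℕ) :=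
        Primrec.pair (Primrec.fst.comp (Primrec.snd.comp Primrec.fst)) (Primrec.pair
          (Primrec.fst.comp (Primrec.snd.comp (Primrec.snd.comp Primrec.fst))) Primrec.snd)
      have := ((primrec_good hG).comp h3).decide
      exact this
    have h4 := Primrec.option_map h1 h2
    exact (PrimrecRel.comp Primrec.eq h4 (Primrec.const (some true))).not
  have hr : Primrec fun q : ℕ × List ℕ × List ℕ => List.range (Encodable.encode q.2.2) :=
    Primrec.list_range.comp (Primrec.encode.comp (Primrec.snd.comp Primrec.snd))
  unfold Least
  exact (primrec_good hG).and (PrimrecRel.comp hR.forall_mem_list hr Primrec.id)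

theorem least_le {i σ τ τ'} (h : Least G i σ τ) (h' : Good G i σ τ') :
    Encodable.encode τ ≤ Encodable.encode τ' := by
  by_contra hlt
  push Not at hlt
  refine h.2 _ (List.mem_range.2 hlt) ?_
  simp [h']

theorem least_unique {i σ τ τ'} (h : Least G i σ τ) (h' : Least G i σ τ') : τ = τ' :=
  Encodable.encode_injective (le_antisymm (least_le h h'.1) (least_le h' h.1))

theorem exists_least {i σ τ} (h : Good G i σ τ) : ∃ τ', Least G i σ τ' := by
  classical
  have hex : ∃ n, ∃ τ, Encodable.encode τ = n ∧ Good G i σ τ := ⟨_, τ, rfl, h⟩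
  obtain ⟨τ', h1, h2⟩ := Nat.find_spec hex
  refine ⟨τ', h2, fun j hj hm => ?_⟩
  rw [List.mem_range, h1] at hj
  rw [Option.map_eq_some_iff] at hm
  obtain ⟨τ'', hd, hg⟩ := hm
  have hg := of_decide_eq_true hg
  refine Nat.find_min hex hj ⟨τ'', ?_, hg⟩
  obtain ⟨b, hb, hb'⟩ := Denumerable.decode_inv (α := List ℕ) j
  have : τ'' = b := by
    have h3 : (Encodable.decode j : Option (List ℕ)) = some b := hb
    rw [hd] at h3; simpa using h3
  rw [this]; exact hb'

/-- the set of strings to be met -/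
def WI (G : List Bool → ℕ → Option Bool) (i : ℕ) : Set (List ℕ) :=
  {τ | ∃ l ∈ List.range (τ.length + 1), Least G i (τ.take l) τ}

theorem exists_code (hG : Primrec₂ G) (i : ℕ) : ∃ e, WW e = WI G i := by
  classical
  have hP : PrimrecPred fun τ : List ℕ => ∃ l ∈ List.range (τ.length + 1),
      Least G i (τ.take l) τ := by
    have hR : PrimrecRel fun (l : ℕ) (τ : List ℕ) => Least G i (τ.take l) τ := by
      have h3 : Primrec fun r : ℕ × List ℕ => ((i, r.2.take r.1, r.2) : ℕ × List ℕ × List ℕ) :=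
        Primrec.pair (Primrec.const i) (Primrec.pair (Primrec.list_take.comp Primrec.fst
          Primrec.snd) Primrec.snd)
      have := (primrec_least hG).comp h3
      exact this
    have hr : Primrec fun τ : List ℕ => List.range (τ.length + 1) :=
      Primrec.list_range.comp (Primrec.succ.comp Primrec.list_length)
    exact PrimrecRel.comp hR.exists_mem_list hr Primrec.id
  obtain ⟨P, hPd⟩ : ∃ P : List ℕ → Prop, ∀ τ, P τ ↔ ∃ l ∈ List.range (τ.length + 1),
      Least G i (τ.take l) τ := ⟨_, fun _ => Iff.rfl⟩
  have hP' : PrimrecPred P := hP.of_eq fun τ => (hPd τ).symm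
  have hQ : Primrec fun τ : List ℕ => if P τ then some 0 else none :=
    Primrec.ite hP' (Primrec.const (some 0)) (Primrec.const none)
  have hO : Primrec fun x : ℕ => (Encodable.decode x : Option (List ℕ)).bind fun τ =>
      if P τ then some 0 else none := by
    have := Primrec.option_bind (Primrec.decode (α := List ℕ)) (hQ.comp₂ Primrec₂.right)
    exact this
  have hp := Partrec.nat_iff.1 (Computable.ofOption hO.to_comp)
  obtain ⟨c, hc⟩ := Nat.Partrec.Code.exists_code.1 hp
  refine ⟨Encodable.encode c, ?_⟩
  ext τ
  unfold WW WI
  rw [Set.mem_ofPred_eq, Set.mem_ofPred_eq, Denumerable.ofNat_encode, hc, ← hPd]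
  simp only [Encodable.encodek, Option.bind_some]
  by_cases h : P τ
  · rw [if_pos h]; exact iff_of_true trivial h
  · rw [if_neg h]; exact iff_of_false (fun h => h) h

/-- the test -/
def VI (G : List Bool → ℕ → Option Bool) (i : ℕ) (y : List Bool) (l : ℕ) (τ : List ℕ) : Prop :=
  Least G i (τ.take l) τ ∧ y.length = Encodable.encode (τ.take l) + i + 1 ∧
    ∀ n ∈ List.range y.length, G (Cstr τ) n = y[n]?

instance viDec (i y l τ) : Decidable (VI G i y l τ) := by unfold VI; infer_instance

theorem primrec_vi (hG : Primrec₂ G) :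
    PrimrecPred fun q : ℕ × List Bool × ℕ × List ℕ => VI G q.1 q.2.1 q.2.2.1 q.2.2.2 := by
  have hi : Primrec fun q : ℕ × List Bool × ℕ × List ℕ => q.1 := Primrec.fst
  have hy : Primrec fun q : ℕ × List Bool × ℕ × List ℕ => q.2.1 := Primrec.fst.comp Primrec.snd
  have hl : Primrec fun q : ℕ × List Bool × ℕ × List ℕ => q.2.2.1 :=
    Primrec.fst.comp (Primrec.snd.comp Primrec.snd)
  have ht : Primrec fun q : ℕ × List Bool × ℕ × List ℕ => q.2.2.2 :=
    Primrec.snd.comp (Primrec.snd.comp Primrec.snd)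
  have htl : Primrec fun q : ℕ × List Bool × ℕ × List ℕ => q.2.2.2.take q.2.2.1 :=
    Primrec.list_take.comp hl ht
  have h1 : PrimrecPred fun q : ℕ × List Bool × ℕ × List ℕ =>
      Least G q.1 (q.2.2.2.take q.2.2.1) q.2.2.2 := by
    have h3 : Primrec fun q : ℕ × List Bool × ℕ × List ℕ =>
      ((q.1, q.2.2.2.take q.2.2.1, q.2.2.2) : ℕ × List ℕ × List ℕ) :=
      Primrec.pair hi (Primrec.pair htl ht)
    have := (primrec_least hG).comp h3
    exact this
  have h2 : PrimrecPred fun q : ℕ × List Bool × ℕ × List ℕ =>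
      q.2.1.length = Encodable.encode (q.2.2.2.take q.2.2.1) + q.1 + 1 :=
    PrimrecRel.comp Primrec.eq (Primrec.list_length.comp hy) (Primrec.succ.comp
      (Primrec.nat_add.comp (Primrec.encode.comp htl) hi))
  have hR : PrimrecRel fun (n : ℕ) (p : List Bool × List ℕ) => G (Cstr p.2) n = p.1[n]? := by
    have h1 : Primrec fun p : ℕ × (List Bool × List ℕ) => G (Cstr p.2.2) p.1 :=
      hG.comp (primrec_Cstr.comp (Primrec.snd.comp Primrec.snd)) Primrec.fst
    have h2 : Primrec fun p : ℕ × (List Bool × List ℕ) => p.2.1[p.1]? :=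
      Primrec.list_getElem?.comp (Primrec.fst.comp Primrec.snd) Primrec.fst
    exact PrimrecRel.comp Primrec.eq h1 h2
  have h4 := PrimrecRel.comp hR.forall_mem_list (Primrec.list_range.comp
    (Primrec.list_length.comp hy)) (Primrec.pair hy ht)
  unfold VI
  exact h1.and (h2.and h4)

theorem vi_unique {i y y' l l' τ τ'} (h : VI G i y l τ) (h' : VI G i y' l' τ')
    (he : Encodable.encode (τ.take l) = Encodable.encode (τ'.take l')) : y = y' := by
  have e1 := Encodable.encode_injective he
  obtain ⟨a, b, c⟩ := h
  obtain ⟨a', b', c'⟩ := h'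
  rw [← e1] at a' b'
  obtain rfl := least_unique a a'
  refine List.ext_getElem? fun n => ?_
  by_cases hn : n < y.length
  · rw [← c n (List.mem_range.2 hn), ← c' n (List.mem_range.2 (by omega))]
  · rw [List.getElem?_eq_none (by omega), List.getElem?_eq_none (by omega)]

theorem vi_measure (i : ℕ) : coin (openOf {y | ∃ l τ, VI G i y l τ}) ≤ 2⁻¹ ^ i := by
  have hsub : openOf {y | ∃ l τ, VI G i y l τ} ⊆
      ⋃ c : ℕ, openOf {y | ∃ l τ, VI G i y l τ ∧ Encodable.encode (τ.take l) = c} := by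
    intro X hX
    rw [mem_openOf] at hX
    obtain ⟨y, ⟨l, τ, h⟩, hy⟩ := hX
    rw [Set.mem_iUnion]
    exact ⟨Encodable.encode (τ.take l), mem_openOf.2 ⟨y, ⟨l, τ, h, rfl⟩, hy⟩⟩
  have hc : ∀ c : ℕ, coin (openOf {y | ∃ l τ, VI G i y l τ ∧ Encodable.encode (τ.take l) = c}) ≤
      2⁻¹ ^ i * 2⁻¹ ^ (c + 1) := by
    intro c
    by_cases hne : ∃ y l τ, VI G i y l τ ∧ Encodable.encode (τ.take l) = c
    · obtain ⟨y, l, τ, h, he⟩ := hne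
      have : openOf {y | ∃ l τ, VI G i y l τ ∧ Encodable.encode (τ.take l) = c} ⊆ cyl y := by
        intro X hX
        rw [mem_openOf] at hX
        obtain ⟨y', ⟨l', τ', h', he'⟩, hy⟩ := hX
        rw [vi_unique h h' (he.trans he'.symm)]; exact hy
      refine (measure_mono this).trans (le_of_eq ?_)
      rw [coin_cyl, h.2.1, he, ← pow_add]
      congr 1; omega
    · have : openOf {y | ∃ l τ, VI G i y l τ ∧ Encodable.encode (τ.take l) = c} = ∅ := by
        rw [Set.eq_empty_iff_forall_notMem]
        intro X hX
        rw [mem_openOf] at hX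
        obtain ⟨y', ⟨l', τ', h', he'⟩, hy⟩ := hX
        exact hne ⟨y', l', τ', h', he'⟩
      rw [this, measure_empty]; exact zero_le
  refine (measure_mono hsub).trans ((measure_iUnion_le _).trans ?_)
  calc _ ≤ ∑' c : ℕ, (2⁻¹ : ℝ≥0∞) ^ i * 2⁻¹ ^ (c + 1) := ENNReal.tsum_le_tsum hc
    _ = 2⁻¹ ^ i := by
        rw [ENNReal.tsum_mul_left]
        simp [ENNReal.tsum_geometric_add_one, ENNReal.one_sub_inv_two]
        rw [ENNReal.inv_mul_cancel (by simp) (by simp), mul_one]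

theorem vi_test {A : ℕ → Bool} (hA : TwoRandom A) (hG : Primrec₂ G) :
    ∃ i, A ∉ openOf {y | ∃ l τ, VI G i y l τ} := by
  have hR : Primrec fun q : ℕ × List Bool × ℕ × ℕ =>
      (((Encodable.decode q.2.2.1.unpair.2 : Option (List ℕ)).map fun τ =>
        decide (VI G q.1 q.2.1 q.2.2.1.unpair.1 τ)).getD false) := by
    have hw : Primrec fun q : ℕ × List Bool × ℕ × ℕ => q.2.2.1.unpair :=
      Primrec.unpair.comp (Primrec.fst.comp (Primrec.snd.comp Primrec.snd))
    have h1 : Primrec fun q : ℕ × List Bool × ℕ × ℕ =>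
        (Encodable.decode q.2.2.1.unpair.2 : Option (List ℕ)) :=
      Primrec.decode.comp (Primrec.snd.comp hw)
    have h2 : Primrec₂ fun (q : ℕ × List Bool × ℕ × ℕ) (τ : List ℕ) =>
        decide (VI G q.1 q.2.1 q.2.2.1.unpair.1 τ) := by
      have h3 : Primrec fun r : (ℕ × List Bool × ℕ × ℕ) × List ℕ =>
          ((r.1.1, r.1.2.1, r.1.2.2.1.unpair.1, r.2) : ℕ × List Bool × ℕ × List ℕ) :=
        Primrec.pair (Primrec.fst.comp Primrec.fst) (Primrec.pair
          (Primrec.fst.comp (Primrec.snd.comp Primrec.fst)) (Primrec.pair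
          (Primrec.fst.comp (hw.comp Primrec.fst)) Primrec.snd))
      have := ((primrec_vi hG).comp h3).decide
      exact this
    have h3 := Primrec.option_map h1 h2
    have := Primrec.option_getD.comp h3 (Primrec.const false)
    exact this
  have heq : ∀ i, {σ : List Bool | ∃ w, ∀ v : ℕ, (fun q : ℕ × List Bool × ℕ × ℕ =>
      (((Encodable.decode q.2.2.1.unpair.2 : Option (List ℕ)).map fun τ =>
        decide (VI G q.1 q.2.1 q.2.2.1.unpair.1 τ)).getD false)) (i, σ, w, v) = true} =
      {y | ∃ l τ, VI G i y l τ} := by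
    intro i
    ext y
    rw [Set.mem_ofPred_eq, Set.mem_ofPred_eq]
    constructor
    · rintro ⟨w, hw⟩
      have := hw 0
      simp only at this
      cases hd : (Encodable.decode w.unpair.2 : Option (List ℕ)) with
      | none => rw [hd] at this; simp at this
      | some τ => rw [hd] at this; exact ⟨_, τ, by simpa using this⟩
    · rintro ⟨l, τ, h⟩
      refine ⟨Nat.pair l (Encodable.encode τ), fun v => ?_⟩
      simp [h]
  obtain ⟨i, hi⟩ := test_lemma hA _ hR (fun i => by rw [heq i]; exact vi_measure i)
  rw [heq i] at hi
  exact ⟨i, hi⟩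

end lg

theorem not_le {F : List Bool → ℕ → Option Bool} {k : ℕ} {A : ℕ → Bool} {f : ℕ → ℕ}
    (hA : TwoRandom A) (hF : Primrec₂ F) (hf : Built F k A f) (tt : ∀ s, ∃ st, Tr F k A s st) :
    ¬ TRed A (graphSeq f) := by
  rintro ⟨c, hc⟩
  obtain ⟨G, hG, mono, tot⟩ := use_principle c
  have hC : Cmp G (graphSeq f) A := ⟨mono, tot _ _ hc⟩
  obtain ⟨i, hi⟩ := vi_test hA hG
  obtain ⟨e, he⟩ := exists_code hG i
  obtain ⟨s, st, h, hgen⟩ := generic hA hF tt e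
  rw [he] at hgen
  rcases hgen with ⟨τ, ⟨l, -, hl⟩, hp⟩ | ⟨ρ, hp, hav⟩
  · have hCs : Cstr τ = restr (graphSeq f) τ.length :=
      Cstr_eq fun j v hj => hf s st h j v (prefix_getElem? hp hj)
    refine hi (mem_openOf.2 ⟨restr A (Encodable.encode (τ.take l) + i + 1),
      ⟨l, τ, hl, by simp, ?_⟩, mem_cyl_restr A _⟩)
    intro n hn
    rw [restr_length] at hn
    obtain ⟨v, hv⟩ := Option.isSome_iff_exists.1 (hl.1.2 n hn)
    rw [restr_getElem?, if_pos (List.mem_range.1 hn), hv]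
    rw [hCs] at hv
    rw [hC.eq hv]
  · have hall : ∀ N, ∃ m, ∀ n ∈ List.range N, (G (restr (graphSeq f) m) n).isSome = true := by
      intro N
      choose g hg using hC.2
      obtain ⟨m, hm⟩ := list_bound (List.range N) g
      refine ⟨m, fun n hn => ?_⟩
      rw [mono _ _ _ _ (restr_pref _ (hm n hn)) (hg n)]; rfl
    obtain ⟨m, hm⟩ := hall (Encodable.encode ρ + i + 1)
    obtain ⟨st', h'⟩ := tt (s + m)
    have hle := h'.le
    have hCs : Cstr st'.2.1 = restr (graphSeq f) st'.2.1.length :=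
      Cstr_eq fun j v hj => hf _ st' h' j v hj
    have hg : Good G i ρ st'.2.1 := by
      refine ⟨hp.trans (h.mono h' (by omega)).2.1, fun n hn => ?_⟩
      obtain ⟨v, hv⟩ := Option.isSome_iff_exists.1 (hm n hn)
      rw [hCs, mono _ _ _ _ (restr_pref _ (by omega)) hv]; rfl
    obtain ⟨τ, hτ⟩ := exists_least hg
    refine hav τ hτ.1.1 ⟨ρ.length, ?_, ?_⟩
    · have := hτ.1.1.length_le
      rw [List.mem_range]; omega
    · rw [← List.prefix_iff_eq_take.1 hτ.1.1]; exact hτ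

theorem main_aux (A : ℕ → Bool) (hA : TwoRandom A) :
    ∀ B : ℕ → Bool, ¬ ComputableSeq B → TRed B A → ¬ TRed A B →
      ∃ C : ℕ → Bool, TRed C A ∧ ¬ TRed A C ∧ TEquiv (join B C) A := by
  intro B hB hBA _
  obtain ⟨c, hc⟩ := hBA
  obtain ⟨F, hF, mono, tot⟩ := use_principle c
  have hC : Cmp F A B := ⟨mono, tot _ _ hc⟩
  obtain ⟨k, hk⟩ := exists_dead hA hF
  have tt := total hA hF mono hC.2 hB hk
  obtain ⟨f, hf⟩ := exists_built tt
  exact ⟨graphSeq f, graph_le hF hf tt, not_le hA hF hf tt, join_le_A hF hC hf tt,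
    A_le_join hC hf tt⟩

end Part13

/-- every 2-random Turing degree satisfies the join property. -/
theorem twoRandom_join_property (A : ℕ → Bool) (hA : TwoRandom A) :
    ∀ B : ℕ → Bool, ¬ ComputableSeq B → TRed B A → ¬ TRed A B →
      ∃ C : ℕ → Bool, TRed C A ∧ ¬ TRed A C ∧ TEquiv (join B C) A := by
  exact main_aux A hA

end TypicalDegree
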